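/- Let f, g ∈ ℚ_p[x₁,…,x_n] be nonzero polynomials such that there is no constant c ∈ ℚ_p with f = c·g, let D = {x ∈ ℚ_p^n : f(x) = 0 or g(x) = 0}, and let Φ : ℚ_p^n → ℂ be a test function. Define Z_Φ(s) = ∫_{ℚ_p^n ∖ D} Φ(x)·|f(x)/g(x)|_p^s dμ(x). Then: (1) there exist real numbers β < 0 < α such that for every s ∈ ℂ with β < Re(s) < α the function x ↦ Φ(x)·|f(x)/g(x)|_p^s is integrable on ℚ_p^n ∖ D; (2) there exist a finite family of pairs (N_i, v_i), i ∈ I, with N_i ∈ ℤ ∖ {0} and v_i ∈ ℤ_{>0}, and a Laurent polynomial P ∈ ℂ[T, T⁻¹], such that for all s ∈ ℂ with β < Re(s) < α one has Z_Φ(s) · ∏_{i∈I} (1 − p^{−v_i − N_i·s}) = P(p^{−s}); in particular Z_Φ extends to a meromorphic function on ℂ, every pole of this extension is of the form s = −v_i/N_i + (2π√−1·k)/(N_i·ln p) for some i ∈ I and k ∈ ℤ, and every pole has order at most n. -/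

import Mathlib

set_option linter.unusedSectionVars false

namespace PadicZeta
open MvPowerSeries

section Substitution

variable {σ A : Type*} [Fintype σ] [DecidableEq σ] [CommRing A]

/-- Power series involving only the variables in `S`. -/
def Vars (A : Type*) [CommRing A] (S : Finset σ) : Subalgebra A (MvPowerSeries σ A) where
  carrier := {F | ∀ d, coeff d F ≠ 0 → d.support ⊆ S}
  mul_mem' := by
    intro F G hF hG d hd
    rw [coeff_mul] at hd
    obtain ⟨⟨a, b⟩, hab, h⟩ := Finset.exists_ne_zero_of_sum_ne_zero hd
    obtain rfl := Finset.HasAntidiagonal.mem_antidiagonal.mp hab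
    exact Finsupp.support_add.trans
      (Finset.union_subset (hF _ (left_ne_zero_of_mul h)) (hG _ (right_ne_zero_of_mul h)))
  add_mem' := by
    intro F G hF hG d hd
    by_cases h : coeff d F = 0
    · exact hG d fun h' => hd (by simp [h, h'])
    · exact hF d h
  algebraMap_mem' := by
    intro r d hd
    rw [MvPowerSeries.algebraMap_apply, Algebra.algebraMap_self, RingHom.id_apply, coeff_C] at hd
    have : d = 0 := by
      by_contra h
      simp [h] at hd
    simp [this]

theorem Vars_mono {S T : Finset σ} (h : S ⊆ T) : Vars A S ≤ Vars A T :=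
  fun _ hF d hd => (hF d hd).trans h

theorem mem_Vars_univ (F : MvPowerSeries σ A) : F ∈ Vars A (Finset.univ : Finset σ) :=
  fun _ _ => Finset.subset_univ _

theorem X_mem_Vars {S : Finset σ} {i : σ} (hi : i ∈ S) : X i ∈ Vars A S := by
  intro d hd
  rw [coeff_X] at hd
  have : d = Finsupp.single i 1 := by
    by_contra h
    simp [h] at hd
  subst this
  exact Finsupp.support_single_subset.trans (by simpa using hi)

theorem C_mem_Vars (S : Finset σ) (c : A) : C c ∈ Vars A S := (Vars A S).algebraMap_mem c

theorem eq_C_of_mem_Vars_empty {F : MvPowerSeries σ A} (hF : F ∈ Vars A (∅ : Finset σ)) :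
    F = C (constantCoeff F) := by
  ext d
  rw [coeff_C]
  split_ifs with h
  · simp [h]
  · by_contra h'
    exact h (by simpa using hF d h')

theorem hasSubst_zero {τ : Type*} {a : σ → MvPowerSeries τ A}
    (ha : ∀ s, constantCoeff (a s) = 0) : HasSubst a :=
  hasSubst_of_constantCoeff_zero ha

theorem constantCoeff_subst' {τ : Type*} {a : σ → MvPowerSeries τ A}
    (ha : ∀ s, constantCoeff (a s) = 0)
    (F : MvPowerSeries σ A) : constantCoeff (subst a F) = constantCoeff F := by
  have h := constantCoeff_subst_eq_zero (hasSubst_zero ha) ha (f := F - C (constantCoeff F))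
    (by simp)
  rw [subst_sub (hasSubst_zero ha), subst_C, map_sub] at h
  simpa [sub_eq_zero] using h

theorem subst_mem_Vars {a : σ → MvPowerSeries σ A} (ha : ∀ s, constantCoeff (a s) = 0)
    {S T : Finset σ} (h : ∀ s ∈ S, a s ∈ Vars A T) {F : MvPowerSeries σ A} (hF : F ∈ Vars A S) :
    subst a F ∈ Vars A T := by
  intro e he
  rw [coeff_subst (hasSubst_zero ha)] at he
  obtain ⟨d, hd⟩ : ∃ d, _ ≠ _ := by
    by_contra! h'
    exact he (finsum_eq_zero_of_forall_eq_zero h')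
  have h1 := hF d (left_ne_zero_of_mul hd)
  have h2 : (d.prod fun s e => a s ^ e) ∈ Vars A T :=
    Subalgebra.prod_mem _ fun s hs => Subalgebra.pow_mem _ (h s (h1 hs)) _
  exact h2 e (right_ne_zero_of_mul hd)

theorem subst_congr_Vars {τ : Type*} {a b : σ → MvPowerSeries τ A}
    (ha : ∀ s, constantCoeff (a s) = 0)
    (hb : ∀ s, constantCoeff (b s) = 0) {S : Finset σ} (h : ∀ s ∈ S, a s = b s)
    {F : MvPowerSeries σ A} (hF : F ∈ Vars A S) : subst a F = subst b F := by
  ext e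
  rw [coeff_subst (hasSubst_zero ha), coeff_subst (hasSubst_zero hb)]
  refine finsum_congr fun d => ?_
  by_cases hd : coeff d F = 0
  · simp [hd]
  · congr 2
    exact Finsupp.prod_congr fun s hs => by rw [h s (hF d hd hs)]

/-- The values of the substitution `X i ↦ τ - τ(0)`, other variables fixed. -/
noncomputable def subVal (i : σ) (τ : MvPowerSeries σ A) : σ → MvPowerSeries σ A :=
  Function.update X i (τ - C (constantCoeff τ))

theorem constantCoeff_subVal (i : σ) (τ : MvPowerSeries σ A) (s : σ) :
    constantCoeff (subVal i τ s) = 0 := by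
  unfold subVal
  by_cases h : s = i
  · subst h; simp
  · simp [Function.update_of_ne h]

/-- The substitution `X i ↦ τ - τ(0)`, other variables fixed. -/
noncomputable def sub (i : σ) (τ : MvPowerSeries σ A) : MvPowerSeries σ A →ₐ[A] MvPowerSeries σ A :=
  substAlgHom (hasSubst_zero (constantCoeff_subVal i τ))

theorem sub_apply (i : σ) (τ F : MvPowerSeries σ A) : sub i τ F = subst (subVal i τ) F :=
  substAlgHom_apply _ _

@[simp] theorem sub_C (i : σ) (τ : MvPowerSeries σ A) (c : A) : sub i τ (C c) = C c := by
  rw [sub_apply, subst_C]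

theorem sub_X_self {i : σ} {τ : MvPowerSeries σ A} (h : constantCoeff τ = 0) :
    sub i τ (X i) = τ := by
  rw [sub_apply, subst_X (hasSubst_zero (constantCoeff_subVal i τ))]
  simp [subVal, h]

theorem sub_X_of_ne {i j : σ} {τ : MvPowerSeries σ A} (h : j ≠ i) : sub i τ (X j) = X j := by
  rw [sub_apply, subst_X (hasSubst_zero (constantCoeff_subVal i τ))]
  simp [subVal, Function.update_of_ne h]

@[simp] theorem constantCoeff_sub (i : σ) (τ F : MvPowerSeries σ A) :
    constantCoeff (sub i τ F) = constantCoeff F := by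
  rw [sub_apply, constantCoeff_subst' (constantCoeff_subVal i τ)]

theorem subVal_mem_Vars {S : Finset σ} {i : σ} {τ : MvPowerSeries σ A} (hτ : τ ∈ Vars A S)
    {s : σ} (hs : s ∈ S) : subVal i τ s ∈ Vars A S := by
  unfold subVal
  by_cases h : s = i
  · subst h
    simpa using Subalgebra.sub_mem _ hτ (C_mem_Vars _ _)
  · simpa [Function.update_of_ne h] using X_mem_Vars hs

theorem sub_mem_Vars {S : Finset σ} {i : σ} {τ F : MvPowerSeries σ A} (hτ : τ ∈ Vars A S)
    (hF : F ∈ Vars A S) : sub i τ F ∈ Vars A S := by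
  rw [sub_apply]
  exact subst_mem_Vars (constantCoeff_subVal i τ) (fun s hs => subVal_mem_Vars hτ hs) hF

theorem sub_eq_self {S : Finset σ} {i : σ} {τ F : MvPowerSeries σ A} (hi : i ∉ S)
    (hF : F ∈ Vars A S) : sub i τ F = F := by
  rw [sub_apply, subst_congr_Vars (b := X) (constantCoeff_subVal i τ) (by simp) _ hF, subst_self,
    id]
  intro s hs
  exact Function.update_of_ne (by rintro rfl; exact hi hs) _ _

theorem subst_sub {τ : Type*} {b : σ → MvPowerSeries τ A} (hb : ∀ s, constantCoeff (b s) = 0)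
    (i : σ) (τ F : MvPowerSeries σ A) :
    subst b (sub i τ F) = subst (fun s => subst b (subVal i τ s)) F := by
  rw [sub_apply, subst_comp_subst_apply (hasSubst_zero (constantCoeff_subVal i τ))
    (hasSubst_zero hb)]

/-- The monomial with exponent vector `a`. -/
noncomputable def mono (A : Type*) [CommRing A] (a : σ → ℕ) : MvPowerSeries σ A := ∏ s, X s ^ a s

theorem mono_eq_monomial (a : σ → ℕ) :
    mono A a = monomial (Finsupp.equivFunOnFinite.symm a) 1 := by
  rw [monomial_one_eq, Finsupp.prod_fintype _ _ (by simp)]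
  simp [mono]

theorem mono_mem_Vars {S : Finset σ} {a : σ → ℕ} (h : ∀ s, s ∉ S → a s = 0) :
    mono A a ∈ Vars A S := by
  refine Subalgebra.prod_mem _ fun s _ => ?_
  by_cases hs : s ∈ S
  · exact Subalgebra.pow_mem _ (X_mem_Vars hs) _
  · simp [h s hs]

theorem mono_add (a b : σ → ℕ) : mono A (a + b) = mono A a * mono A b := by
  simp [mono, pow_add, Finset.prod_mul_distrib]

theorem mono_zero : mono A (0 : σ → ℕ) = 1 := by simp [mono]

theorem mono_single (i : σ) (k : ℕ) : mono A (Pi.single i k) = X i ^ k := by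
  unfold mono
  rw [Finset.prod_eq_single i] <;> simp +contextual

theorem mono_ne_zero [Nontrivial A] (a : σ → ℕ) : mono A a ≠ 0 := by
  rw [mono_eq_monomial]
  intro h
  have := congrArg (coeff (Finsupp.equivFunOnFinite.symm a)) h
  simp at this

theorem constantCoeff_mono (a : σ → ℕ) (h : a ≠ 0) : constantCoeff (mono A a) = 0 := by
  obtain ⟨s, hs⟩ := Function.ne_iff.mp h
  unfold mono
  rw [map_prod]
  exact Finset.prod_eq_zero (Finset.mem_univ s) (by simpa using zero_pow hs)

end Substitution
end PadicZeta

namespace PadicZeta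
open MvPowerSeries

section Slices

variable {σ A : Type*} [Fintype σ] [DecidableEq σ] [CommRing A]

/-- The coefficient of `X l ^ k`, as a power series in the other variables. -/
noncomputable def cl (l : σ) (k : ℕ) (F : MvPowerSeries σ A) : MvPowerSeries σ A :=
  fun d => if d l = 0 then coeff (d + Finsupp.single l k) F else 0

/-- The quotient of the division of `F` by `X l ^ k`. -/
noncomputable def tl (l : σ) (k : ℕ) (F : MvPowerSeries σ A) : MvPowerSeries σ A :=
  fun d => coeff (d + Finsupp.single l k) F

theorem coeff_cl (l : σ) (k : ℕ) (F : MvPowerSeries σ A) (d : σ →₀ ℕ) :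
    coeff d (cl l k F) = if d l = 0 then coeff (d + Finsupp.single l k) F else 0 := rfl

theorem coeff_tl (l : σ) (k : ℕ) (F : MvPowerSeries σ A) (d : σ →₀ ℕ) :
    coeff d (tl l k F) = coeff (d + Finsupp.single l k) F := rfl

theorem cl_zero_add (l : σ) (F : MvPowerSeries σ A) : F = cl l 0 F + X l * tl l 1 F := by
  ext d
  rw [map_add, coeff_cl, X_def, coeff_monomial_mul, coeff_tl]
  by_cases h : d l = 0
  · simp [h]
  · have : Finsupp.single l 1 ≤ d := by
      rw [Finsupp.single_le_iff]; omega
    simp [h, this, tsub_add_cancel_of_le]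

theorem tl_one_tl (l : σ) (k : ℕ) (F : MvPowerSeries σ A) : tl l 1 (tl l k F) = tl l (k + 1) F := by
  ext d
  simp only [coeff_tl]
  rw [add_assoc, ← Finsupp.single_add, add_comm 1 k]

theorem cl_zero_tl (l : σ) (k : ℕ) (F : MvPowerSeries σ A) : cl l 0 (tl l k F) = cl l k F := by
  ext d
  simp [coeff_cl, coeff_tl]

theorem eq_sum_cl_add (l : σ) (D : ℕ) (F : MvPowerSeries σ A) :
    F = ∑ k ∈ Finset.range D, cl l k F * X l ^ k + X l ^ D * tl l D F := by
  induction D with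
  | zero => ext d; simp [coeff_tl]
  | succ D ih =>
    rw [Finset.sum_range_succ]
    conv_lhs => rw [ih, cl_zero_add l (tl l D F), tl_one_tl, cl_zero_tl]
    ring

theorem cl_mem_Vars {S : Finset σ} {F : MvPowerSeries σ A} (hF : F ∈ Vars A S) (l : σ) (k : ℕ) :
    cl l k F ∈ Vars A (S.erase l) := by
  intro d hd
  rw [coeff_cl] at hd
  split_ifs at hd with h
  · intro s hs
    refine Finset.mem_erase.mpr ⟨?_, hF _ hd (by simp at hs ⊢; omega)⟩
    rintro rfl
    simp [h] at hs
  · exact absurd rfl hd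

theorem tl_mem_Vars {S : Finset σ} {F : MvPowerSeries σ A} (hF : F ∈ Vars A S) (l : σ) (k : ℕ) :
    tl l k F ∈ Vars A S := by
  intro d hd s hs
  exact hF _ hd (by simp at hs ⊢; omega)

theorem constantCoeff_cl (l : σ) (k : ℕ) (F : MvPowerSeries σ A) :
    constantCoeff (cl l k F) = coeff (Finsupp.single l k) F := by
  rw [← coeff_zero_eq_constantCoeff_apply, coeff_cl]
  simp

theorem constantCoeff_tl (l : σ) (k : ℕ) (F : MvPowerSeries σ A) :
    constantCoeff (tl l k F) = coeff (Finsupp.single l k) F := by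
  rw [← coeff_zero_eq_constantCoeff_apply, coeff_tl]
  simp

theorem X_dvd_of_sub_zero {i : σ} {F : MvPowerSeries σ A} (h : sub i 0 F = 0) : X i ∣ F := by
  have h1 := congrArg (sub i 0) (cl_zero_add i F)
  have h2 : sub i 0 (cl i 0 F) = cl i 0 F :=
    sub_eq_self (Finset.notMem_erase i _) (cl_mem_Vars (mem_Vars_univ F) i 0)
  rw [h, map_add, map_mul, sub_X_self (by simp), h2, zero_mul, add_zero] at h1
  rw [cl_zero_add i F, ← h1, zero_add]
  exact dvd_mul_right _ _

theorem X_dvd_or_dvd [IsDomain A] {i : σ} {F G : MvPowerSeries σ A} (h : X i ∣ F * G) :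
    X i ∣ F ∨ X i ∣ G := by
  obtain ⟨q, hq⟩ := h
  have h1 := congrArg (sub i 0) hq
  rw [map_mul, map_mul, sub_X_self (by simp), zero_mul, mul_eq_zero] at h1
  exact h1.imp X_dvd_of_sub_zero X_dvd_of_sub_zero

/-- A monomial times a series with nonzero constant coefficient. -/
def IsMon (F : MvPowerSeries σ A) : Prop :=
  ∃ (a : σ → ℕ) (u : MvPowerSeries σ A), constantCoeff u ≠ 0 ∧ F = mono A a * u

theorem X_mul_mono (i : σ) (a : σ → ℕ) :
    X i * mono A a = mono A (a + Pi.single i 1) := by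
  rw [mono_add, mono_single, pow_one, mul_comm]

theorem IsMon.of_dvd [IsDomain A] {F G : MvPowerSeries σ A} (hG : IsMon G) (h : F ∣ G) :
    IsMon F := by
  obtain ⟨a, u, hu, rfl⟩ := hG
  obtain ⟨q, hq⟩ := h
  induction hn : ∑ s, a s generalizing a F q with
  | zero =>
    have ha : a = 0 := by
      ext s
      simpa using (Finset.sum_eq_zero_iff.mp hn) s (Finset.mem_univ s)
    subst ha
    refine ⟨0, F, ?_, by simp [mono_zero]⟩
    intro h0
    apply hu
    have := congrArg constantCoeff hq
    simpa [mono_zero, h0] using this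
  | succ N ih =>
    obtain ⟨i, hi⟩ : ∃ i, a i ≠ 0 := by
      by_contra! h
      simp [h] at hn
    obtain ⟨b, rfl⟩ : ∃ b : σ → ℕ, a = b + Pi.single i 1 := by
      refine ⟨a - Pi.single i 1, (tsub_add_cancel_of_le ?_).symm⟩
      intro s
      by_cases h : s = i
      · subst h; simp; omega
      · simp [h]
    have hb : ∑ s, b s = N := by
      simp only [Pi.add_apply, Finset.sum_add_distrib] at hn
      rw [Finset.sum_pi_single'] at hn
      simpa using hn
    rw [← X_mul_mono, mul_assoc] at hq
    rcases X_dvd_or_dvd (Dvd.intro _ hq) with ⟨F', rfl⟩ | ⟨q', rfl⟩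
    · rw [mul_assoc] at hq
      obtain ⟨c, v, hv, rfl⟩ := ih b _ (mul_left_cancel₀ (X_ne_zero_aux i) hq) hb
      exact ⟨c + Pi.single i 1, v, hv, by rw [← X_mul_mono, mul_assoc]⟩
    · rw [mul_left_comm F] at hq
      exact ih b _ (mul_left_cancel₀ (X_ne_zero_aux i) hq) hb
where
  X_ne_zero_aux (i : σ) : (X i : MvPowerSeries σ A) ≠ 0 := by
    have := mono_ne_zero (A := A) (Pi.single i 1)
    rwa [mono_single, pow_one] at this

open Classical in
theorem coeff_mono_mul (a b : σ → ℕ) (u : MvPowerSeries σ A) :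
    coeff (Finsupp.equivFunOnFinite.symm b) (mono A a * u) =
      if a ≤ b then coeff (Finsupp.equivFunOnFinite.symm (b - a)) u else 0 := by
  rw [mono_eq_monomial, coeff_monomial_mul, one_mul]
  have h : Finsupp.equivFunOnFinite.symm b - Finsupp.equivFunOnFinite.symm a =
      Finsupp.equivFunOnFinite.symm (b - a) := by ext; simp
  rw [h]
  exact if_congr Iff.rfl rfl rfl

theorem mono_comparable {a b : σ → ℕ} {u v : MvPowerSeries σ A} (hu : constantCoeff u ≠ 0)
    (hv : constantCoeff v ≠ 0)
    (h : mono A a * u - mono A b * v = 0 ∨ IsMon (mono A a * u - mono A b * v)) :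
    a ≤ b ∨ b ≤ a := by
  have h0 : ∀ (c : σ → ℕ) (w : MvPowerSeries σ A),
      coeff (Finsupp.equivFunOnFinite.symm (c - c)) w = constantCoeff w := by
    intro c w
    rw [tsub_self, ← coeff_zero_eq_constantCoeff_apply]
    congr 2
    ext; simp
  by_contra! hab
  rcases h with h | ⟨c, w, hw, h⟩
  · have := congrArg (coeff (Finsupp.equivFunOnFinite.symm a)) h
    rw [map_sub, coeff_mono_mul, coeff_mono_mul, if_pos le_rfl, if_neg hab.2, h0] at this
    simp [hu] at this
  · have ha := congrArg (coeff (Finsupp.equivFunOnFinite.symm a)) h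
    have hb := congrArg (coeff (Finsupp.equivFunOnFinite.symm b)) h
    have hc := congrArg (coeff (Finsupp.equivFunOnFinite.symm c)) h
    rw [map_sub, coeff_mono_mul, coeff_mono_mul, coeff_mono_mul] at ha hb hc
    rw [if_pos le_rfl, if_neg hab.2, h0] at ha
    rw [if_pos le_rfl, if_neg hab.1, h0] at hb
    rw [if_pos (le_refl c), h0] at hc
    have hca : c ≤ a := by
      by_contra h'
      rw [if_neg h'] at ha
      simp [hu] at ha
    have hcb : c ≤ b := by
      by_contra h'
      rw [if_neg h'] at hb
      simp [hv] at hb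
    by_cases h1 : a ≤ c
    · exact hab.1 (h1.trans hcb)
    · by_cases h2 : b ≤ c
      · exact hab.2 (h2.trans hca)
      · rw [if_neg h1, if_neg h2, sub_zero] at hc
        exact hw hc.symm

end Slices

section Good

variable {σ : Type*} [Fintype σ] [DecidableEq σ] {p : ℕ} [Fact p.Prime]

/-- Series that become monomial times non-vanishing after finitely many blow-ups,
shears and scalings of the variables in `S`. -/
inductive Good (S : Finset σ) : MvPowerSeries σ ℤ_[p] → Prop
  | leaf {F} (h : IsMon F) : Good S F
  | blowup {F} (i j : σ) (hi : i ∈ S) (hj : j ∈ S) (hij : i ≠ j)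
      (h1 : ∀ η : ℤ_[p], Good S (sub i (X j * (X i + C η)) F * X j))
      (h2 : ∀ η : ℤ_[p], Good S (sub j (X i * (X j + C η)) F * X i)) : Good S F
  | shear {F} (i : σ) (hi : i ∈ S) (φ : MvPowerSeries σ ℤ_[p]) (hφ : φ ∈ Vars ℤ_[p] (S.erase i))
      (hφ0 : constantCoeff φ = 0) (h : Good S (sub i (X i + φ) F)) : Good S F
  | scale {F} (i : σ) (hi : i ∈ S) (c : ℤ_[p]) (hc : c ≠ 0)
      (h : Good S (sub i (C c * X i) F)) : Good S F

theorem Good.mono_set {S T : Finset σ} (hST : S ⊆ T) {F : MvPowerSeries σ ℤ_[p]}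
    (h : Good S F) : Good T F := by
  induction h with
  | leaf h => exact .leaf h
  | blowup i j hi hj hij _ _ ih1 ih2 => exact .blowup i j (hST hi) (hST hj) hij ih1 ih2
  | shear i hi φ hφ hφ0 _ ih =>
    exact .shear i (hST hi) φ (Vars_mono (Finset.erase_subset_erase _ hST) hφ) hφ0 ih
  | scale i hi c hc _ ih => exact .scale i (hST hi) c hc ih

theorem Good.mul_unit {S : Finset σ} {F : MvPowerSeries σ ℤ_[p]}
    (h : Good S F) {u : MvPowerSeries σ ℤ_[p]} (hu : constantCoeff u ≠ 0) : Good S (F * u) := by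
  induction h generalizing u with
  | leaf h =>
    obtain ⟨a, v, hv, rfl⟩ := h
    exact .leaf ⟨a, v * u, by simp [hu, hv], by ring⟩
  | blowup i j hi hj hij _ _ ih1 ih2 =>
    refine .blowup i j hi hj hij (fun η => ?_) (fun η => ?_)
    · rw [map_mul, mul_right_comm]
      exact ih1 η (by simpa using hu)
    · rw [map_mul, mul_right_comm]
      exact ih2 η (by simpa using hu)
  | shear i hi φ hφ hφ0 _ ih =>
    refine .shear i hi φ hφ hφ0 ?_
    rw [map_mul]
    exact ih (by simpa using hu)
  | scale i hi c hc _ ih =>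
    refine .scale i hi c hc ?_
    rw [map_mul]
    exact ih (by simpa using hu)

end Good
end PadicZeta

namespace PadicZeta
open MvPowerSeries

section Taylor

variable {σ A : Type*} [Fintype σ] [DecidableEq σ] [CommRing A]

theorem cl_mul_X_pow {l : σ} {c : MvPowerSeries σ A} (hc : c ∈ Vars A (Finset.univ.erase l))
    (k m : ℕ) : cl l k (c * X l ^ m) = if m = k then c else 0 := by
  have hc' : ∀ d : σ →₀ ℕ, d l ≠ 0 → coeff d c = 0 := by
    intro d hd
    by_contra h
    simpa using hc d h (Finsupp.mem_support_iff.mpr hd)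
  ext d
  rw [coeff_cl, X_pow_eq, coeff_mul_monomial, mul_one]
  by_cases hd : d l = 0
  · rw [if_pos hd]
    by_cases hm : m = k
    · subst hm
      simp
    · rw [if_neg hm]
      split_ifs with h
      · rw [Finsupp.single_le_iff] at h
        simp only [Finsupp.add_apply, Finsupp.single_eq_same] at h
        rw [hc', map_zero]
        simp
        omega
      · simp
  · rw [if_neg hd]
    split_ifs
    · exact (hc' d hd).symm
    · simp

theorem cl_sum {ι : Type*} (s : Finset ι) (f : ι → MvPowerSeries σ A) (l : σ) (k : ℕ) :
    cl l k (∑ i ∈ s, f i) = ∑ i ∈ s, cl l k (f i) := by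
  ext d
  rw [coeff_cl, map_sum, map_sum]
  split_ifs with h
  · exact Finset.sum_congr rfl fun i _ => by rw [coeff_cl, if_pos h]
  · exact (Finset.sum_eq_zero fun i _ => by rw [coeff_cl, if_neg h]).symm

theorem cl_mul_add_pow {l : σ} {c φ : MvPowerSeries σ A} (hc : c ∈ Vars A (Finset.univ.erase l))
    (hφ : φ ∈ Vars A (Finset.univ.erase l)) (k n : ℕ) :
    cl l k (c * (X l + φ) ^ n) = c * φ ^ (n - k) * (n.choose k : MvPowerSeries σ A) := by
  rw [add_pow, Finset.mul_sum, cl_sum]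
  have h : ∀ m ∈ Finset.range (n + 1),
      cl l k (c * (X l ^ m * φ ^ (n - m) * (n.choose m : MvPowerSeries σ A))) =
        if m = k then c * φ ^ (n - k) * (n.choose k : MvPowerSeries σ A) else 0 := by
    intro m _
    have : c * (X l ^ m * φ ^ (n - m) * (n.choose m : MvPowerSeries σ A)) =
      (c * φ ^ (n - m) * (n.choose m : MvPowerSeries σ A)) * X l ^ m := by ring
    rw [this, cl_mul_X_pow]
    · split_ifs with h
      · rw [h]
      · rfl
    · exact Subalgebra.mul_mem _ (Subalgebra.mul_mem _ hc (Subalgebra.pow_mem _ hφ _))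
        (natCast_mem _ _)
  rw [Finset.sum_congr rfl h, Finset.sum_ite_eq']
  split_ifs with h'
  · rfl
  · rw [Finset.mem_range, not_lt] at h'
    rw [Nat.choose_eq_zero_of_lt (by omega)]
    simp

/-- The Hasse derivative of order `k` with respect to `X l`. -/
noncomputable def hasse (l : σ) (k : ℕ) (F : MvPowerSeries σ A) : MvPowerSeries σ A :=
  fun d => ((d l + k).choose k : A) * coeff (d + Finsupp.single l k) F

theorem coeff_hasse (l : σ) (k : ℕ) (F : MvPowerSeries σ A) (d : σ →₀ ℕ) :
    coeff d (hasse l k F) = ((d l + k).choose k : A) * coeff (d + Finsupp.single l k) F := rfl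

theorem hasse_mem_Vars {S : Finset σ} {F : MvPowerSeries σ A} (hF : F ∈ Vars A S) (l : σ) (k : ℕ) :
    hasse l k F ∈ Vars A S := by
  intro d hd s hs
  rw [coeff_hasse] at hd
  exact hF _ (right_ne_zero_of_mul hd) (by simp at hs ⊢; omega)

theorem prod_subVal {l : σ} {τ : MvPowerSeries σ A} (hτ : constantCoeff τ = 0) (d : σ →₀ ℕ) :
    (d.prod fun s e => subVal l τ s ^ e) = (∏ s ∈ Finset.univ.erase l, X s ^ d s) * τ ^ d l := by
  rw [Finsupp.prod_fintype _ _ (by simp), ← Finset.mul_prod_erase _ _ (Finset.mem_univ l), mul_comm]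
  congr 1
  · refine Finset.prod_congr rfl fun s hs => ?_
    rw [subVal, Function.update_of_ne (Finset.ne_of_mem_erase hs)]
  · simp [subVal, hτ]

theorem cl_sub_add {l : σ} {φ : MvPowerSeries σ A} (hφ : φ ∈ Vars A (Finset.univ.erase l))
    (hφ0 : constantCoeff φ = 0) (k : ℕ) (F : MvPowerSeries σ A) :
    cl l k (sub l (X l + φ) F) = sub l φ (hasse l k F) := by
  have hM : ∀ d : σ →₀ ℕ, (∏ s ∈ Finset.univ.erase l, X s ^ d s) ∈ Vars A (Finset.univ.erase l) :=
    fun d => Subalgebra.prod_mem _ fun s hs => Subalgebra.pow_mem _ (X_mem_Vars hs) _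
  ext e
  rw [coeff_cl]
  by_cases he : e l = 0
  · rw [if_pos he, sub_apply, sub_apply, coeff_subst (hasSubst_zero (constantCoeff_subVal _ _)),
      coeff_subst (hasSubst_zero (constantCoeff_subVal _ _))]
    have h1 : ∀ d : σ →₀ ℕ, coeff (e + Finsupp.single l k)
        (d.prod fun s e => subVal l (X l + φ) s ^ e) =
        ((d l).choose k : A) * coeff e ((∏ s ∈ Finset.univ.erase l, X s ^ d s) * φ ^ (d l - k)) := by
      intro d
      rw [prod_subVal (by simp [hφ0])]
      have h2 := congrArg (coeff e) (cl_mul_add_pow (hM d) hφ k (d l))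
      rw [coeff_cl, if_pos he, ← map_natCast C, coeff_mul_C] at h2
      rw [h2, mul_comm]
    have hinj : Function.Injective fun d : σ →₀ ℕ => d + Finsupp.single l k :=
      add_left_injective _
    have h3 : ∀ f : (σ →₀ ℕ) → A, (∀ d, d l < k → f d = 0) →
        finsum f = ∑ᶠ d, f (d + Finsupp.single l k) := by
      intro f hf
      rw [← finsum_mem_range hinj, ← finsum_mem_univ]
      refine finsum_mem_inter_support_eq' _ _ _ fun d hd => ?_
      simp only [Set.mem_univ, Set.mem_range, true_iff]
      refine ⟨d - Finsupp.single l k, tsub_add_cancel_of_le ?_⟩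
      rw [Finsupp.single_le_iff]
      by_contra! h
      exact hd (hf d h)
    rw [h3]
    · refine finsum_congr fun d => ?_
      rw [h1, prod_subVal hφ0, coeff_hasse]
      simp only [Finsupp.add_apply, Finsupp.single_eq_same, add_tsub_cancel_right, smul_eq_mul]
      have : ∏ s ∈ Finset.univ.erase l, X (R := A) s ^ (d s + Finsupp.single l k s) =
          ∏ s ∈ Finset.univ.erase l, X s ^ d s :=
        Finset.prod_congr rfl fun s hs => by
          rw [Finsupp.single_eq_of_ne (Finset.ne_of_mem_erase hs), add_zero]
      rw [this]
      ring
    · intro d hd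
      rw [h1, Nat.choose_eq_zero_of_lt hd]
      simp
  · rw [if_neg he]
    have : sub l φ (hasse l k F) ∈ Vars A (Finset.univ.erase l) := by
      rw [sub_apply]
      refine subst_mem_Vars (constantCoeff_subVal _ _) (S := Finset.univ) (fun s _ => ?_)
        (mem_Vars_univ _)
      by_cases h : s = l
      · subst h; simpa [subVal, hφ0] using hφ
      · simpa [subVal, Function.update_of_ne h] using X_mem_Vars (by simpa using h)
    by_contra h
    simpa using this e (Ne.symm h) (Finsupp.mem_support_iff.mpr he)

theorem sub_mem_Vars_erase {S : Finset σ} {l : σ} {φ F : MvPowerSeries σ A}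
    (hφ : φ ∈ Vars A (S.erase l)) (hF : F ∈ Vars A S) : sub l φ F ∈ Vars A (S.erase l) := by
  rw [sub_apply]
  refine subst_mem_Vars (constantCoeff_subVal _ _) (fun s hs => ?_) hF
  by_cases h : s = l
  · subst h
    simpa [subVal] using Subalgebra.sub_mem _ hφ (C_mem_Vars _ _)
  · simpa [subVal, Function.update_of_ne h] using X_mem_Vars (Finset.mem_erase.mpr ⟨h, hs⟩)

theorem coeff_sub_congr (I : Ideal A) {l : σ} {φ ψ : MvPowerSeries σ A}
    (h : ∀ d, coeff d φ - coeff d ψ ∈ I) (B : MvPowerSeries σ A) (d : σ →₀ ℕ) :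
    coeff d (sub l φ B) - coeff d (sub l ψ B) ∈ I := by
  have h1 : map (Ideal.Quotient.mk I) φ = map (Ideal.Quotient.mk I) ψ := by
    ext d
    rw [coeff_map, coeff_map, Ideal.Quotient.eq]
    exact h d
  rw [← Ideal.Quotient.eq, ← coeff_map, ← coeff_map, sub_apply, sub_apply,
    map_subst (hasSubst_zero (constantCoeff_subVal _ _)),
    map_subst (hasSubst_zero (constantCoeff_subVal _ _))]
  refine congrArg (fun f => coeff d (subst f (map (Ideal.Quotient.mk I) B))) (funext fun s => ?_)
  by_cases hs : s = l
  · subst hs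
    simp only [subVal, Function.update_self, map_sub, map_C, h1]
    rw [← constantCoeff_map (Ideal.Quotient.mk I) φ, ← constantCoeff_map (Ideal.Quotient.mk I) ψ, h1]
  · simp only [subVal, Function.update_of_ne hs]

end Taylor

section Tschirnhaus

variable {σ : Type*} [Fintype σ] [DecidableEq σ] {p : ℕ} [Fact p.Prime]

theorem eq_zero_of_forall_mem_span_pow {x : ℤ_[p]} (h : ∀ n : ℕ, x ∈ Ideal.span {(p : ℤ_[p]) ^ n}) :
    x = 0 := by
  apply IsHausdorff.haus' (I := IsLocalRing.maximalIdeal ℤ_[p]) x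
  intro n
  rw [SModEq.zero, smul_eq_mul, Ideal.mul_top, PadicInt.maximalIdeal_eq_span_p,
    Ideal.span_singleton_pow]
  exact h n

theorem exists_limit (f : ℕ → ℤ_[p]) (h : ∀ n, f (n + 1) - f n ∈ Ideal.span {(p : ℤ_[p]) ^ n}) :
    ∃ L, ∀ n, f n - L ∈ Ideal.span {(p : ℤ_[p]) ^ n} := by
  have hle : ∀ {m n : ℕ}, m ≤ n → f m - f n ∈ Ideal.span {(p : ℤ_[p]) ^ m} := by
    intro m n hmn
    induction n, hmn using Nat.le_induction with
    | base => simp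
    | succ n hmn ih =>
      have h1 : Ideal.span {(p : ℤ_[p]) ^ n} ≤ Ideal.span {(p : ℤ_[p]) ^ m} := by
        rw [Ideal.span_singleton_le_span_singleton]
        exact pow_dvd_pow _ hmn
      have := Ideal.sub_mem _ ih (h1 (h n))
      simpa using this
  obtain ⟨L, hL⟩ := IsPrecomplete.prec' (I := IsLocalRing.maximalIdeal ℤ_[p]) f (by
    intro m n hmn
    rw [SModEq.sub_mem, smul_eq_mul, Ideal.mul_top, PadicInt.maximalIdeal_eq_span_p,
      Ideal.span_singleton_pow]
    exact hle hmn)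
  refine ⟨L, fun n => ?_⟩
  have := hL n
  rwa [SModEq.sub_mem, smul_eq_mul, Ideal.mul_top, PadicInt.maximalIdeal_eq_span_p,
      Ideal.span_singleton_pow] at this

theorem exists_fixedPoint {S : Finset σ} {l : σ} {B : MvPowerSeries σ ℤ_[p]}
    (hB : B ∈ Vars ℤ_[p] S) (hB0 : constantCoeff B = 0) :
    ∃ φ ∈ Vars ℤ_[p] (S.erase l), constantCoeff φ = 0 ∧ φ = C (p : ℤ_[p]) * sub l φ B := by
  let φ : ℕ → MvPowerSeries σ ℤ_[p] := fun n => n.rec 0 fun _ ψ => C (p : ℤ_[p]) * sub l ψ B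
  have hs : ∀ n, φ (n + 1) = C (p : ℤ_[p]) * sub l (φ n) B := fun n => rfl
  have hV : ∀ n, φ n ∈ Vars ℤ_[p] (S.erase l) := by
    intro n
    induction n with
    | zero => exact Subalgebra.zero_mem _
    | succ n ih =>
      rw [hs]
      exact Subalgebra.mul_mem _ (C_mem_Vars _ _) (sub_mem_Vars_erase ih hB)
  have h0 : ∀ n, constantCoeff (φ n) = 0 := by
    intro n
    cases n with
    | zero => exact map_zero _
    | succ n => rw [hs]; simp [hB0]
  have step : ∀ (n : ℕ) (α β : MvPowerSeries σ ℤ_[p]),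
      (∀ d, coeff d α - coeff d β ∈ Ideal.span {(p : ℤ_[p]) ^ n}) →
      ∀ d, coeff d (C (p : ℤ_[p]) * sub l α B) - coeff d (C (p : ℤ_[p]) * sub l β B) ∈
        Ideal.span {(p : ℤ_[p]) ^ (n + 1)} := by
    intro n α β h d
    rw [coeff_C_mul, coeff_C_mul, ← mul_sub, pow_succ', Ideal.mem_span_singleton]
    exact mul_dvd_mul_left _ (Ideal.mem_span_singleton.mp (coeff_sub_congr _ h B d))
  have hd : ∀ n d, coeff d (φ (n + 1)) - coeff d (φ n) ∈ Ideal.span {(p : ℤ_[p]) ^ n} := by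
    intro n
    induction n with
    | zero => intro d; simp
    | succ n ih =>
      rw [hs (n + 1), hs n]
      exact step n _ _ ih
  choose L hL using fun d => exists_limit (fun n => coeff d (φ n)) (fun n => hd n d)
  have hL0 : ∀ d, (∀ n, coeff d (φ n) = 0) → L d = 0 := by
    intro d h
    refine eq_zero_of_forall_mem_span_pow fun n => ?_
    simpa [h] using hL d n
  refine ⟨L, ?_, hL0 0 h0, ?_⟩
  · intro d hd
    by_contra h
    refine hd (hL0 d fun n => ?_)
    by_contra h'
    exact h (hV n d h')
  · ext d
    rw [← sub_eq_zero]
    refine eq_zero_of_forall_mem_span_pow fun n => ?_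
    have h1 := hL d (n + 1)
    have h2 := step n (φ n) L (fun d => hL d n) d
    rw [← hs] at h2
    have h3 : Ideal.span {(p : ℤ_[p]) ^ (n + 1)} ≤ Ideal.span {(p : ℤ_[p]) ^ n} := by
      rw [Ideal.span_singleton_le_span_singleton]
      exact pow_dvd_pow _ n.le_succ
    have h4 := Ideal.sub_mem _ (h3 h2) (h3 h1)
    rwa [sub_sub_sub_cancel_left] at h4

theorem rescale_mem_Vars {S : Finset σ} {F : MvPowerSeries σ ℤ_[p]} (hF : F ∈ Vars ℤ_[p] S)
    (a : σ → ℤ_[p]) : rescale a F ∈ Vars ℤ_[p] S := by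
  intro d hd
  rw [coeff_rescale] at hd
  exact hF d (right_ne_zero_of_mul hd)

theorem prod_pow_ne_zero {a : σ → ℤ_[p]} (ha : ∀ i, a i ≠ 0) (d : σ →₀ ℕ) :
    (d.prod fun s m => a s ^ m) ≠ 0 :=
  Finset.prod_ne_zero_iff.mpr fun s _ => pow_ne_zero _ (ha s)

theorem exists_tschirnhaus {S : Finset σ} {l : σ} {h : MvPowerSeries σ ℤ_[p]}
    (hh : h ∈ Vars ℤ_[p] S) {D : ℕ} (h0 : coeff (Finsupp.single l D) h = 0)
    (hD : coeff (Finsupp.single l (D + 1)) h ≠ 0) :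
    ∃ a : σ → ℤ_[p], (∀ i, a i ≠ 0) ∧ ∃ φ ∈ Vars ℤ_[p] (S.erase l), constantCoeff φ = 0 ∧
      cl l D (sub l (X l + φ) (rescale a h)) = 0 ∧
      coeff (Finsupp.single l (D + 1)) (sub l (X l + φ) (rescale a h)) ≠ 0 := by
  set c : ℤ_[p] := (D + 1 : ℕ) * coeff (Finsupp.single l (D + 1)) h with hc
  have hc0 : c ≠ 0 := mul_ne_zero (by exact_mod_cast D.succ_ne_zero) hD
  have hp0 : (p : ℤ_[p]) ≠ 0 := by exact_mod_cast (Fact.out : p.Prime).ne_zero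
  set a : σ → ℤ_[p] := fun i => if i = l then c * p else c ^ 2 * p ^ 2 with ha
  have ha0 : ∀ i, a i ≠ 0 := by
    intro i
    rw [ha]
    dsimp only
    split_ifs <;> simp [hc0, hp0]
  set K := hasse l D h with hK
  have hK0 : coeff 0 K = 0 := by rw [hK, coeff_hasse]; simp [h0]
  have hK1 : coeff (Finsupp.single l 1) K = c := by
    rw [hK, coeff_hasse, ← Finsupp.single_add, add_comm 1 D]
    simp only [Finsupp.single_eq_same, hc]
    rw [add_comm 1 D, Nat.choose_symm_add]
    simp
  have hdvd : ∀ d : σ →₀ ℕ, ∃ b : ℤ_[p], coeff d (rescale a K) =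
      c ^ 2 * p * (coeff d (X l) - p * b) := by
    intro d
    rw [coeff_rescale]
    by_cases hd0 : d = 0
    · subst hd0
      exact ⟨0, by simp [hK0]⟩
    by_cases hd1 : d = Finsupp.single l 1
    · subst hd1
      refine ⟨0, ?_⟩
      rw [hK1, coeff_index_single_self_X, Finsupp.prod_single_index (by simp)]
      simp only [ha, if_true]
      ring
    · rw [coeff_X, if_neg hd1]
      have : c ^ 2 * p ^ 2 ∣ d.prod fun s m => a s ^ m := by
        rw [Finsupp.prod_fintype _ _ (by simp)]
        by_cases hi : ∃ i, i ≠ l ∧ d i ≠ 0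
        · obtain ⟨i, hil, hi⟩ := hi
          refine Dvd.dvd.trans ?_ (Finset.dvd_prod_of_mem _ (Finset.mem_univ i))
          simp only [ha, if_neg hil]
          exact dvd_pow_self _ hi
        · push Not at hi
          refine Dvd.dvd.trans ?_ (Finset.dvd_prod_of_mem _ (Finset.mem_univ l))
          simp only [ha, if_true]
          rw [← mul_pow]
          refine pow_dvd_pow _ ?_
          by_contra hlt
          have hl : d l = 0 ∨ d l = 1 := by omega
          have hdl : d = Finsupp.single l (d l) := by
            ext i
            by_cases h : i = l
            · subst h; simp
            · rw [hi i h, Finsupp.single_eq_of_ne h]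
          rcases hl with hl | hl <;> rw [hl] at hdl
          · exact hd0 (by simpa using hdl)
          · exact hd1 hdl
      obtain ⟨q, hq⟩ := this
      exact ⟨-(q * coeff d K), by rw [hq]; ring⟩
  choose b hb using hdvd
  let B : MvPowerSeries σ ℤ_[p] := b
  have hcp : c ^ 2 * (p : ℤ_[p]) ≠ 0 := mul_ne_zero (pow_ne_zero _ hc0) hp0
  have hBeq : rescale a K = C (c ^ 2 * (p : ℤ_[p])) * (X l - C (p : ℤ_[p]) * B) := by
    ext d
    rw [coeff_C_mul, map_sub, coeff_C_mul, hb]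
    rfl
  have hBd : ∀ d, coeff d K = 0 → coeff d (X l : MvPowerSeries σ ℤ_[p]) = 0 → coeff d B = 0 := by
    intro d h1 h2
    have := hb d
    rw [coeff_rescale, h1, h2, mul_zero, zero_sub] at this
    exact (mul_eq_zero.mp (neg_eq_zero.mp ((mul_eq_zero.mp this.symm).resolve_left hcp))).resolve_left
      hp0
  have hl : l ∈ S := by
    have := hh _ hD
    exact this (by simp)
  have hBV : B ∈ Vars ℤ_[p] S := by
    intro d hd
    by_cases h1 : coeff d K = 0
    · by_cases h2 : coeff d (X l : MvPowerSeries σ ℤ_[p]) = 0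
      · exact absurd (hBd d h1 h2) hd
      · exact X_mem_Vars hl d h2
    · exact hasse_mem_Vars hh l D d h1
  obtain ⟨φ, hφ, hφ0, hfix⟩ := exists_fixedPoint (l := l) hBV
    (by rw [← coeff_zero_eq_constantCoeff_apply]; exact hBd 0 hK0 (by simp))
  have hφ' : φ ∈ Vars ℤ_[p] (Finset.univ.erase l) :=
    Vars_mono (Finset.erase_subset_erase _ (Finset.subset_univ _)) hφ
  refine ⟨a, ha0, φ, hφ, hφ0, ?_, ?_⟩
  · rw [cl_sub_add hφ' hφ0]
    have : hasse l D (rescale a h) = C (a l ^ D) * rescale a K := by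
      ext d
      rw [coeff_C_mul, coeff_rescale, coeff_hasse, coeff_rescale, hK, coeff_hasse,
        Finsupp.prod_fintype _ _ (by simp), Finsupp.prod_fintype _ _ (by simp)]
      have : ∏ i, a i ^ (d + Finsupp.single l D) i = a l ^ D * ∏ i, a i ^ d i := by
        simp only [Finsupp.add_apply, pow_add, Finset.prod_mul_distrib]
        rw [mul_comm]
        congr 1
        rw [Finset.prod_eq_single l] <;> simp +contextual [eq_comm]
      rw [this]
      ring
    rw [this, hBeq, map_mul (sub l φ), map_mul (sub l φ), map_sub, map_mul (sub l φ) _ B,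
      sub_X_self hφ0, sub_C l φ p, ← hfix, sub_self, mul_zero, mul_zero]
  · rw [← constantCoeff_cl, cl_sub_add hφ' hφ0, constantCoeff_sub,
      ← coeff_zero_eq_constantCoeff_apply, coeff_hasse, coeff_rescale]
    refine mul_ne_zero (by simp) (mul_ne_zero (prod_pow_ne_zero ha0 _) ?_)
    simpa using hD

end Tschirnhaus
end PadicZeta

namespace PadicZeta
open MvPowerSeries

section Restriction

variable {σ A : Type*} [Fintype σ] [DecidableEq σ] [CommRing A]

/-- The substitution killing the variables outside `S`. -/
noncomputable def resVal (A : Type*) [CommRing A] (S : Finset σ) (s : σ) : MvPowerSeries σ A :=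
  if s ∈ S then X s else 0

theorem constantCoeff_resVal (S : Finset σ) (s : σ) : constantCoeff (resVal A S s) = 0 := by
  unfold resVal; split_ifs <;> simp

/-- Restriction of a power series to the coordinate subspace of the variables in `S`. -/
noncomputable def res (S : Finset σ) : MvPowerSeries σ A →ₐ[A] MvPowerSeries σ A :=
  substAlgHom (hasSubst_zero (constantCoeff_resVal S))

theorem res_apply (S : Finset σ) (F : MvPowerSeries σ A) : res S F = subst (resVal A S) F :=
  substAlgHom_apply _ _

theorem res_X (S : Finset σ) (s : σ) : res S (X s) = resVal A S s := by
  rw [res_apply, subst_X (hasSubst_zero (constantCoeff_resVal S))]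

theorem res_X_of_mem {S : Finset σ} {s : σ} (h : s ∈ S) : res S (X s : MvPowerSeries σ A) = X s := by
  rw [res_X, resVal, if_pos h]

theorem res_X_of_notMem {S : Finset σ} {s : σ} (h : s ∉ S) :
    res S (X s : MvPowerSeries σ A) = 0 := by
  rw [res_X, resVal, if_neg h]

@[simp] theorem res_C (S : Finset σ) (c : A) : res S (C c) = C c := by
  rw [res_apply, subst_C]

theorem res_eq_self {S T : Finset σ} (hST : S ⊆ T) {F : MvPowerSeries σ A} (hF : F ∈ Vars A S) :
    res T F = F := by
  rw [res_apply, subst_congr_Vars (b := X) (constantCoeff_resVal T) (by simp) _ hF, subst_self, id]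
  intro s hs
  rw [resVal, if_pos (hST hs)]

theorem res_mem_Vars (S : Finset σ) (F : MvPowerSeries σ A) : res S F ∈ Vars A S := by
  rw [res_apply]
  refine subst_mem_Vars (constantCoeff_resVal S) (S := Finset.univ) (fun s _ => ?_)
    (mem_Vars_univ _)
  unfold resVal
  split_ifs with h
  · exact X_mem_Vars h
  · exact Subalgebra.zero_mem _

theorem coeff_res_single (l : σ) (k : ℕ) (F : MvPowerSeries σ A) :
    coeff (Finsupp.single l k) (res {l} F) = coeff (Finsupp.single l k) F := by
  have hprod : ∀ d : σ →₀ ℕ, (d.prod fun s e => resVal A {l} s ^ e) =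
      if d = Finsupp.single l (d l) then X l ^ d l else 0 := by
    intro d
    rw [Finsupp.prod_fintype _ _ (by simp)]
    split_ifs with h
    · rw [Finset.prod_eq_single l]
      · simp [resVal]
      · intro s _ hs
        rw [h, Finsupp.single_eq_of_ne hs, pow_zero]
      · simp
    · obtain ⟨s, hs, hs'⟩ : ∃ s, s ≠ l ∧ d s ≠ 0 := by
        by_contra! h'
        apply h
        ext s
        by_cases hs : s = l
        · subst hs; simp
        · rw [h' s hs, Finsupp.single_eq_of_ne hs]
      refine Finset.prod_eq_zero (Finset.mem_univ s) ?_
      simp [resVal, hs, hs']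
  rw [res_apply, coeff_subst (hasSubst_zero (constantCoeff_resVal _)),
    finsum_eq_single _ (Finsupp.single l k)]
  · rw [hprod]
    simp [coeff_X_pow]
  · intro d hd
    rw [hprod]
    split_ifs with h
    · rw [coeff_X_pow, if_neg, smul_zero]
      intro h'
      apply hd
      rw [h, h']
    · simp

theorem res_sub_eq {S : Finset σ} {j : σ} {τ ρ : MvPowerSeries σ A} {T : Finset σ}
    (hτ : constantCoeff τ = 0) (hρ : constantCoeff ρ = 0)
    (h : ∀ s, s ≠ j → (s ∈ T ↔ s ∈ S)) (hj : j ∈ S) (hτρ : res T τ = ρ)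
    (F : MvPowerSeries σ A) :
    res T (sub j τ F) = sub j ρ (res S F) := by
  rw [res_apply, subst_sub (constantCoeff_resVal T), res_apply, sub_apply,
    subst_comp_subst_apply (hasSubst_zero (constantCoeff_resVal S))
      (hasSubst_zero (constantCoeff_subVal _ _))]
  refine congrArg (fun f => subst f F) (funext fun s => ?_)
  rw [← res_apply, ← sub_apply]
  by_cases hs : s = j
  · subst hs
    simp [subVal, hτ, resVal, hj, sub_X_self hρ, hτρ]
  · rw [subVal, Function.update_of_ne hs, res_X, resVal, resVal]
    simp only [h s hs]
    split_ifs
    · rw [sub_X_of_ne hs]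
    · simp

end Restriction

section Generic

variable {σ : Type*} [Fintype σ] [DecidableEq σ] {p : ℕ} [Fact p.Prime]

theorem good_of_rescale {S : Finset σ} {F : MvPowerSeries σ ℤ_[p]} (hF : F ∈ Vars ℤ_[p] S)
    {a : σ → ℤ_[p]} (ha : ∀ i, a i ≠ 0) (h : Good S (rescale a F)) : Good S F := by
  have key : ∀ T ⊆ S, Good S (rescale (fun i => if i ∈ T then a i else 1) F) → Good S F := by
    intro T
    induction T using Finset.induction_on with
    | empty =>
      intro _ h
      simpa [show (fun i : σ => (1 : ℤ_[p])) = 1 from rfl, rescale_one] using h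
    | insert i T hi ih =>
      intro hT h
      rw [Finset.insert_subset_iff] at hT
      refine ih hT.2 (.scale i hT.1 (a i) (ha i) ?_)
      convert h using 1
      rw [rescale_eq_subst, rescale_eq_subst, sub_apply,
        subst_comp_subst_apply (HasSubst.smul_X _) (hasSubst_zero (constantCoeff_subVal _ _))]
      refine congrArg (fun f => subst f F) (funext fun s => ?_)
      rw [← sub_apply, Pi.smul_apply', Pi.smul_apply', map_smul]
      by_cases hs : s = i
      · subst hs
        rw [sub_X_self (by simp)]
        simp [hi, smul_eq_C_mul]
      · rw [sub_X_of_ne hs]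
        simp [hs]
  refine key S subset_rfl ?_
  convert h using 1
  ext d
  rw [coeff_rescale, coeff_rescale]
  by_cases hd : coeff d F = 0
  · simp [hd]
  · congr 1
    exact Finsupp.prod_congr fun s hs => by rw [if_pos (hF d hd hs)]

theorem exists_sub_ne_zero {j l : σ} (hjl : l ≠ j) {F : MvPowerSeries σ ℤ_[p]} (hF : F ≠ 0) :
    ∃ c : ℤ_[p], sub j (C c * X l) F ≠ 0 := by
  obtain ⟨d, hd⟩ := (ne_zero_iff_exists_coeff_ne_zero F).mp hF
  set m := d l + d j with hm
  set e : σ →₀ ℕ := d - Finsupp.single l (d l) - Finsupp.single j (d j) with he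
  have hej : e j = 0 := by simp [he]
  have hel : e l = 0 := by simp [he]
  have hde : d = e + Finsupp.single l (d l) + Finsupp.single j (d j) := by
    ext s
    by_cases h1 : s = j
    · subst h1; simp [hej, hjl]
    · by_cases h2 : s = l
      · subst h2; simp [hel, h1]
      · simp [he, h1, h2]
  let q : Polynomial ℤ_[p] := ∑ k ∈ Finset.range (m + 1),
    Polynomial.C (coeff (e + Finsupp.single l (m - k) + Finsupp.single j k) F) * Polynomial.X ^ k
  have hq : q ≠ 0 := by
    intro h
    have := congrArg (fun r => Polynomial.coeff r (d j)) h
    simp only [q, Polynomial.finsetSum_coeff, Polynomial.coeff_C_mul_X_pow, Polynomial.coeff_zero]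
      at this
    rw [Finset.sum_ite_eq, if_pos (by rw [Finset.mem_range]; omega), hm, Nat.add_sub_cancel,
      ← hde] at this
    exact hd this
  obtain ⟨c, hc⟩ : ∃ c, q.eval c ≠ 0 := by
    by_contra! h
    exact hq (Polynomial.funext fun x => by simpa using h x)
  refine ⟨c, fun h0 => hc ?_⟩
  have h1 := congrArg (coeff (e + Finsupp.single l m)) h0
  rw [map_zero, eq_sum_cl_add j (m + 1) F, map_add, map_sum, map_add, map_sum, map_mul, map_pow,
    sub_X_self (by simp)] at h1
  have h2 : coeff (e + Finsupp.single l m)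
      ((C c * X l) ^ (m + 1) * sub j (C c * X l) (tl j (m + 1) F)) = 0 := by
    rw [mul_pow, mul_assoc, ← map_pow, coeff_C_mul, X_pow_eq, coeff_monomial_mul, if_neg, mul_zero]
    rw [Finsupp.single_le_iff]
    simp [hel]
  rw [h2, add_zero] at h1
  rw [← h1, Polynomial.eval_finsetSum]
  refine Finset.sum_congr rfl fun k hk => ?_
  rw [Finset.mem_range] at hk
  rw [map_mul, map_pow, sub_X_self (by simp), sub_eq_self (Finset.notMem_erase j _)
    (cl_mem_Vars (mem_Vars_univ F) j k), mul_pow, ← map_pow, mul_left_comm, coeff_C_mul, X_pow_eq,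
    coeff_mul_monomial, if_pos, mul_one, coeff_cl, if_pos]
  · simp only [Polynomial.eval_mul, Polynomial.eval_C, Polynomial.eval_pow, Polynomial.eval_X]
    rw [mul_comm]
    congr 3
    rw [add_left_inj]
    ext s
    by_cases h : s = l
    · subst h; simp; omega
    · simp [h]
  · simp [hej, hjl]
  · rw [Finsupp.single_le_iff]
    simp; omega

theorem good_of_regular {S : Finset σ} {l : σ} (hl : l ∈ S)
    (H : ∀ h ∈ Vars ℤ_[p] S, (∃ k, coeff (Finsupp.single l k) h ≠ 0) → Good S h)
    {F : MvPowerSeries σ ℤ_[p]} (hF : F ∈ Vars ℤ_[p] S) (hF0 : F ≠ 0) : Good S F := by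
  have key : ∀ (T : Finset σ), T ⊆ S.erase l → ∀ F ∈ Vars ℤ_[p] S, res (insert l T) F ≠ 0 →
      Good S F := by
    intro T
    induction T using Finset.induction_on with
    | empty =>
      intro _ F hF h0
      refine H F hF ?_
      obtain ⟨d, hd⟩ := (ne_zero_iff_exists_coeff_ne_zero _).mp h0
      have hd' := res_mem_Vars _ F d hd
      refine ⟨d l, ?_⟩
      rw [← coeff_res_single]
      have : d = Finsupp.single l (d l) := by
        ext s
        by_cases h : s = l
        · subst h; simp
        · rw [Finsupp.single_eq_of_ne h]
          by_contra h'
          exact h (by simpa using hd' (Finsupp.mem_support_iff.mpr h'))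
      rw [← this]
      exact hd
    | insert j T hj ih =>
      intro hT F hF h0
      rw [Finset.insert_subset_iff, Finset.mem_erase] at hT
      obtain ⟨⟨hjl, hjS⟩, hT⟩ := hT
      obtain ⟨c, hc⟩ := exists_sub_ne_zero hjl.symm h0
      have hφ : C c * X l ∈ Vars ℤ_[p] (S.erase j) :=
        Subalgebra.mul_mem _ (C_mem_Vars _ _) (X_mem_Vars (Finset.mem_erase.mpr ⟨hjl.symm, hl⟩))
      refine .shear j hjS (C c * X l) hφ (by simp) (ih hT _ (sub_mem_Vars
        (Subalgebra.add_mem _ (X_mem_Vars hjS) (Vars_mono (Finset.erase_subset _ _) hφ)) hF) ?_)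
      have hj' : j ∉ insert l T := by simp [hjl, hj]
      have h1 := res_sub_eq (T := insert l T) (S := insert l (insert j T)) (j := j)
        (τ := X j + C c * X l) (ρ := C c * X l) (by simp) (by simp)
        (fun s hs => by simp [hs]) (by simp)
        (by rw [map_add, map_mul, res_C, res_X_of_mem (Finset.mem_insert_self l T),
          res_X_of_notMem hj', zero_add]) F
      rw [h1]
      exact hc
  refine key (S.erase l) subset_rfl F hF ?_
  rw [Finset.insert_erase hl, res_eq_self subset_rfl hF]
  exact hF0

end Generic

section Fewnomial

theorem eq_zero_of_sum_choose {ι K : Type*} [DecidableEq ι] [CommRing K] [IsDomain K] [CharZero K]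
    (J : Finset ι) (ε : ι → ℕ) (hε : Set.InjOn ε J) (a : ι → K)
    (h : ∀ k < J.card, ∑ j ∈ J, a j * ((ε j).choose k : K) = 0) : ∀ j ∈ J, a j = 0 := by
  induction J using Finset.induction_on generalizing a with
  | empty => simp
  | insert i J hi ih =>
    have h1 : ∀ j ∈ J, a j = 0 := by
      intro j hj
      have hne : (ε j : K) - ε i ≠ 0 := by
        rw [sub_ne_zero]
        intro h'
        have := hε (Finset.mem_insert_of_mem hj) (Finset.mem_insert_self i J) (by exact_mod_cast h')
        exact hi (this ▸ hj)
      refine (mul_eq_zero.mp (ih (hε.mono (by simp)) (fun j => a j * (ε j - ε i)) ?_ j hj)).resolve_right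
        hne
      intro k hk
      have e0 := h k (by rw [Finset.card_insert_of_notMem hi]; omega)
      have e1 := h (k + 1) (by rw [Finset.card_insert_of_notMem hi]; omega)
      have id1 : ∀ n : ℕ, (n : K) * n.choose k = (k + 1) * n.choose (k + 1) + k * n.choose k := by
        intro n
        have := Nat.choose_succ_right_eq n k
        by_cases hnk : k ≤ n
        · have h2 : (n.choose (k + 1) : K) * (k + 1) = n.choose k * (n - k) := by
            have := congrArg (Nat.cast (R := K)) this
            push_cast [Nat.cast_sub hnk] at this
            exact this
          linear_combination -h2
        · rw [Nat.choose_eq_zero_of_lt (by omega : n < k),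
            Nat.choose_eq_zero_of_lt (by omega : n < k + 1)]
          simp
      have e2 : ∑ j ∈ insert i J, a j * (ε j - ε i) * ((ε j).choose k : K) = 0 := by
        have : ∀ j ∈ insert i J, a j * (ε j - ε i) * ((ε j).choose k : K) =
            (k + 1) * (a j * ((ε j).choose (k + 1) : K)) +
              (k - ε i) * (a j * ((ε j).choose k : K)) := by
          intro j _
          linear_combination a j * id1 (ε j)
        rw [Finset.sum_congr rfl this, Finset.sum_add_distrib, ← Finset.mul_sum, ← Finset.mul_sum,
          e0, e1]
        simp
      rw [Finset.sum_insert hi] at e2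
      simpa using e2
    intro j hj
    rcases Finset.mem_insert.mp hj with rfl | hj
    · have := h 0 (by simp [hi])
      rw [Finset.sum_insert hi, Finset.sum_eq_zero (fun j hj => by rw [h1 j hj, zero_mul])] at this
      simpa using this
    · exact h1 j hj

variable {σ A : Type*} [Fintype σ] [DecidableEq σ] [CommRing A]

theorem coeff_single_C_mul_X_add_pow (v : σ) (c η : A) (n k : ℕ) :
    coeff (Finsupp.single v k) (C c * (X v + C η) ^ n) = c * (η ^ (n - k) * (n.choose k : A)) := by
  rw [coeff_C_mul, add_pow, map_sum]
  have : ∀ m ∈ Finset.range (n + 1), coeff (Finsupp.single v k)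
      (X v ^ m * C η ^ (n - m) * (n.choose m : MvPowerSeries σ A)) =
      if m = k then η ^ (n - k) * (n.choose k : A) else 0 := by
    intro m _
    rw [← map_pow, ← map_natCast C, mul_assoc, ← map_mul, coeff_mul_C, coeff_X_pow]
    by_cases h : m = k
    · subst h; simp
    · rw [if_neg, if_neg h, zero_mul]
      intro h'
      exact h (Finsupp.single_injective v h').symm
  rw [Finset.sum_congr rfl this, Finset.sum_ite_eq']
  split_ifs with h
  · rfl
  · rw [Finset.mem_range, not_lt] at h
    rw [Nat.choose_eq_zero_of_lt (by omega)]
    simp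

theorem exists_coeff_fewnomial_ne_zero [IsDomain A] [CharZero A] {ι : Type*} [DecidableEq ι]
    (v : σ) {J : Finset ι}
    (hJ : J.Nonempty) {ε : ι → ℕ} (hε : Set.InjOn ε J) {c : ι → A} (hc : ∀ j ∈ J, c j ≠ 0) {η : A}
    (hη : η ≠ 0) :
    ∃ k < J.card, coeff (Finsupp.single v k) (∑ j ∈ J, C (c j) * (X v + C η) ^ ε j) ≠ 0 := by
  by_contra! h
  obtain ⟨i, hi⟩ := hJ
  have := eq_zero_of_sum_choose J ε hε (fun j => c j * η ^ ε j) (fun k hk => ?_) i hi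
  · exact mul_ne_zero (hc i hi) (pow_ne_zero _ hη) this
  · have h1 := h k hk
    rw [map_sum] at h1
    have h2 := congrArg (η ^ k * ·) h1
    rw [Finset.mul_sum, mul_zero] at h2
    rw [← h2]
    refine Finset.sum_congr rfl fun j _ => ?_
    rw [coeff_single_C_mul_X_add_pow]
    by_cases hk : k ≤ ε j
    · have : η ^ ε j = η ^ k * η ^ (ε j - k) := by rw [← pow_add]; congr 1; omega
      rw [this]; ring
    · rw [Nat.choose_eq_zero_of_lt (by omega)]
      simp

end Fewnomial
end PadicZeta

namespace PadicZeta

section Principalization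

variable {σ : Type*} [DecidableEq σ]

/-- The exponent vector of a monomial after the blowup `x_t = y_u y_t`, `x_u = y_u`. -/
def blowExp (t u : σ) (e : σ → ℕ) : σ → ℕ := Function.update e u (e t + e u)

theorem blowExp_self (t u : σ) (e : σ → ℕ) : blowExp t u e u = e t + e u := by simp [blowExp]

theorem blowExp_of_ne {t u s : σ} (h : s ≠ u) (e : σ → ℕ) : blowExp t u e s = e s := by
  simp [blowExp, h]

theorem principalize_pair_aux {ξ : Type*} {S : Finset σ} {M : Finset σ → ξ → Prop}
    {b : σ → σ → ξ → ξ}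
    (hstep : ∀ V E t u, t ∈ S → u ∈ S → t ∉ V → u ∉ V → t ≠ u → M V (b t u E) →
      M (insert t V) (b t u E) → M V (b u t E) → M (insert u V) (b u t E) → M V E)
    (δ : ξ → σ → ℤ) (hδ : ∀ t u E, δ (b t u E) u = δ E t + δ E u)
    (hδ' : ∀ t u s E, s ≠ u → δ (b t u E) s = δ E s)
    (hcomp : ∀ V E, (∀ s ∈ S \ V, 0 ≤ δ E s) → M V E) (B T : ℕ)
    (ih : ∀ V E, (∀ s ∈ S \ V, (δ E s).natAbs ≤ B + 1) →
      ((S \ V).filter fun s => (δ E s).natAbs = B + 1).card ≤ T → M V E) (N : ℕ) :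
    ∀ V E, (∀ s ∈ S \ V, (δ E s).natAbs ≤ B + 1) →
      ((S \ V).filter fun s => (δ E s).natAbs = B + 1).card ≤ T + 1 →
      (∃ t ∈ S \ V, δ E t = B + 1) → ((S \ V).filter fun s => δ E s < 0).card ≤ N → M V E := by
  induction N with
  | zero =>
    intro V E _ _ _ hN
    refine hcomp V E fun s hs => ?_
    by_contra! h
    rw [Nat.le_zero, Finset.card_eq_zero] at hN
    exact Finset.notMem_empty s (hN ▸ Finset.mem_filter.mpr ⟨hs, h⟩)
  | succ N ihN =>
    intro V E hB hT ⟨t, ht, hδt⟩ hN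
    by_cases hneg : ∃ u ∈ S \ V, δ E u < 0
    swap
    · push Not at hneg
      exact hcomp V E hneg
    obtain ⟨u, hu, hδu⟩ := hneg
    have htu : t ≠ u := by rintro rfl; omega
    have hBu := hB u hu
    have ht' := Finset.mem_sdiff.mp ht
    have hu' := Finset.mem_sdiff.mp hu
    have hbd1 : ∀ s ∈ S \ V, (δ (b t u E) s).natAbs ≤ B + 1 := by
      intro s hs
      by_cases h : s = u
      · subst h; rw [hδ]; omega
      · rw [hδ' _ _ _ _ h]; exact hB s hs
    have hbd2 : ∀ s ∈ S \ V, (δ (b u t E) s).natAbs ≤ B + 1 := by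
      intro s hs
      by_cases h : s = t
      · subst h; rw [hδ]; omega
      · rw [hδ' _ _ _ _ h]; exact hB s hs
    have hins : ∀ x, S \ insert x V ⊆ S \ V := fun x =>
      Finset.sdiff_subset_sdiff subset_rfl (Finset.subset_insert _ _)
    refine hstep V E t u ht'.1 hu'.1 ht'.2 hu'.2 htu ?_ ?_ ?_ ?_
    · refine ihN V _ hbd1 ((Finset.card_le_card ?_).trans hT) ⟨t, ht, by rw [hδ' _ _ _ _ htu, hδt]⟩ ?_
      · intro s hs
        rw [Finset.mem_filter] at hs ⊢
        by_cases h : s = u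
        · subst h; rw [hδ] at hs; omega
        · rwa [hδ' _ _ _ _ h] at hs
      · refine Nat.le_of_lt_succ ((Finset.card_lt_card ?_).trans_le hN)
        refine Finset.ssubset_iff_of_subset ?_ |>.mpr
          ⟨u, Finset.mem_filter.mpr ⟨hu, hδu⟩, ?_⟩
        · intro s hs
          rw [Finset.mem_filter] at hs ⊢
          by_cases h : s = u
          · subst h; rw [hδ] at hs; omega
          · rwa [hδ' _ _ _ _ h] at hs
        · rw [Finset.mem_filter, hδ]; omega
    · refine ih _ _ (fun s hs => hbd1 s (hins t hs)) ?_
      refine Nat.le_of_lt_succ ((Finset.card_lt_card ?_).trans_le hT)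
      refine Finset.ssubset_iff_of_subset ?_ |>.mpr
        ⟨t, Finset.mem_filter.mpr ⟨ht, by omega⟩, by simp⟩
      intro s hs
      rw [Finset.mem_filter] at hs ⊢
      refine ⟨hins t hs.1, ?_⟩
      by_cases h : s = u
      · subst h; rw [hδ] at hs; omega
      · rw [hδ' _ _ _ _ h] at hs; exact hs.2
    all_goals
      refine ih _ _ (fun s hs => hbd2 s (by first | exact hs | exact hins u hs)) ?_
      refine Nat.le_of_lt_succ ((Finset.card_lt_card ?_).trans_le hT)
      refine Finset.ssubset_iff_of_subset ?_ |>.mpr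
        ⟨t, Finset.mem_filter.mpr ⟨ht, by omega⟩, by rw [Finset.mem_filter, hδ]; omega⟩
      intro s hs
      rw [Finset.mem_filter] at hs ⊢
      refine ⟨by first | exact hs.1 | exact hins u hs.1, ?_⟩
      by_cases h : s = t
      · subst h; omega
      · rw [hδ' _ _ _ _ h] at hs; exact hs.2

theorem principalize_pair {ξ : Type*} {S : Finset σ} {M : Finset σ → ξ → Prop}
    {b : σ → σ → ξ → ξ}
    (hstep : ∀ V E t u, t ∈ S → u ∈ S → t ∉ V → u ∉ V → t ≠ u → M V (b t u E) →
      M (insert t V) (b t u E) → M V (b u t E) → M (insert u V) (b u t E) → M V E)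
    (δ : ξ → σ → ℤ) (hδ : ∀ t u E, δ (b t u E) u = δ E t + δ E u)
    (hδ' : ∀ t u s E, s ≠ u → δ (b t u E) s = δ E s)
    (hcomp : ∀ V E, (∀ s ∈ S \ V, 0 ≤ δ E s) → M V E)
    (hcomp' : ∀ V E, (∀ s ∈ S \ V, δ E s ≤ 0) → M V E) (V : Finset σ) (E : ξ) : M V E := by
  have key : ∀ B T V E, (∀ s ∈ S \ V, (δ E s).natAbs ≤ B) →
      ((S \ V).filter fun s => (δ E s).natAbs = B).card ≤ T → M V E := by
    intro B
    induction B with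
    | zero =>
      intro T V E hB _
      exact hcomp V E fun s hs => by have := hB s hs; omega
    | succ B ihB =>
      intro T
      induction T with
      | zero =>
        intro V E hB hT
        rw [Nat.le_zero, Finset.card_eq_zero] at hT
        refine ihB _ V E (fun s hs => ?_) le_rfl
        have := hB s hs
        by_contra h
        exact Finset.notMem_empty s (hT ▸ Finset.mem_filter.mpr ⟨hs, by omega⟩)
      | succ T ihT =>
        intro V E hB hT
        by_cases h1 : ∃ t ∈ S \ V, δ E t = B + 1
        · exact principalize_pair_aux hstep δ hδ hδ' hcomp B T ihT _ V E hB hT h1 le_rfl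
        by_cases h2 : ∃ t ∈ S \ V, -δ E t = B + 1
        · refine principalize_pair_aux hstep (fun E s => -δ E s) (fun t u E => ?_)
            (fun t u s E h => ?_) (fun V E h => hcomp' V E fun s hs => ?_) B T ?_ _ V E ?_ ?_ h2
            le_rfl
          · rw [hδ]; ring
          · rw [hδ' _ _ _ _ h]
          · have := h s hs; omega
          · simpa only [Int.natAbs_neg] using ihT
          · simpa only [Int.natAbs_neg] using hB
          · simpa only [Int.natAbs_neg] using hT
        · refine ihB _ V E (fun s hs => ?_) le_rfl
          have := hB s hs
          by_contra h
          have h3 : δ E s = B + 1 ∨ -δ E s = B + 1 := by omega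
          rcases h3 with h3 | h3
          · exact h1 ⟨s, hs, h3⟩
          · exact h2 ⟨s, hs, h3⟩
  refine key (∑ s ∈ S \ V, (δ E s).natAbs) _ V E (fun s hs => ?_) le_rfl
  exact Finset.single_le_sum (f := fun s => (δ E s).natAbs) (fun _ _ => Nat.zero_le _) hs

/-- Blowups make all the exponent vectors pairwise comparable. -/
theorem principalize {ι : Type*} [DecidableEq ι] {S : Finset σ}
    {M : Finset σ → (ι → σ → ℕ) → Prop}
    (hstep : ∀ V E t u, t ∈ S → u ∈ S → t ∉ V → u ∉ V → t ≠ u →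
      M V (fun k => blowExp t u (E k)) → M (insert t V) (fun k => blowExp t u (E k)) →
      M V (fun k => blowExp u t (E k)) → M (insert u V) (fun k => blowExp u t (E k)) → M V E)
    (P : Finset (ι × ι))
    (hP : ∀ V E, (∀ q ∈ P, (∀ s ∈ S \ V, E q.1 s ≤ E q.2 s) ∨ (∀ s ∈ S \ V, E q.2 s ≤ E q.1 s)) →
      M V E) (V : Finset σ) (E : ι → σ → ℕ) : M V E := by
  induction P using Finset.induction_on generalizing V E with
  | empty => exact hP V E (by simp)
  | insert q P hq ih =>
    refine ih (fun V E hVE => ?_) V E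
    let cmp : Finset σ → (ι → σ → ℕ) → Prop := fun V E =>
      ∀ q ∈ P, (∀ s ∈ S \ V, E q.1 s ≤ E q.2 s) ∨ (∀ s ∈ S \ V, E q.2 s ≤ E q.1 s)
    have hblow : ∀ V E t u, t ∈ S → u ∈ S → t ∉ V → u ∉ V → cmp V E →
        cmp V (fun k => blowExp t u (E k)) := by
      intro V E t u ht hu ht' hu' h q hq
      have h2 := fun x y (h : ∀ s ∈ S \ V, E x s ≤ E y s) (s) (hs : s ∈ S \ V) =>
        show blowExp t u (E x) s ≤ blowExp t u (E y) s from by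
          by_cases hsu : s = u
          · subst hsu
            rw [blowExp_self, blowExp_self]
            exact Nat.add_le_add (h t (by simp [ht, ht'])) (h s hs)
          · rw [blowExp_of_ne hsu, blowExp_of_ne hsu]
            exact h s hs
      exact (h q hq).imp (h2 _ _) (h2 _ _)
    have hins : ∀ V E x, cmp V E → cmp (insert x V) E := by
      intro V E x h q hq
      have := Finset.sdiff_subset_sdiff (subset_refl S) (Finset.subset_insert x V)
      exact (h q hq).imp (fun h s hs => h s (this hs)) (fun h s hs => h s (this hs))
    refine principalize_pair (ξ := ι → σ → ℕ) (S := S) (M := fun V E => cmp V E → M V E)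
      (b := fun t u E k => blowExp t u (E k)) ?_
      (fun E s => (E q.1 s : ℤ) - E q.2 s) ?_ ?_ ?_ ?_ V E hVE
    · intro V E t u ht hu ht' hu' htu h1 h2 h3 h4 hc
      have c1 := hblow V E t u ht hu ht' hu' hc
      have c2 := hblow V E u t hu ht hu' ht' hc
      exact hstep V E t u ht hu ht' hu' htu (h1 c1) (h2 (hins V (fun k => blowExp t u (E k)) t c1)) (h3 c2)
        (h4 (hins V (fun k => blowExp u t (E k)) u c2))
    · intro t u E
      simp only [blowExp_self]
      push_cast; ring
    · intro t u s E h
      simp only [blowExp_of_ne h]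
    · intro V E h hc
      refine hP V E (Finset.forall_mem_insert _ _ _ |>.mpr ⟨.inr fun s hs => ?_, hc⟩)
      have := h s hs; omega
    · intro V E h hc
      refine hP V E (Finset.forall_mem_insert _ _ _ |>.mpr ⟨.inl fun s hs => ?_, hc⟩)
      have := h s hs; omega

end Principalization
end PadicZeta

namespace PadicZeta
open MvPowerSeries

section Toric

variable {σ : Type*} [Fintype σ] [DecidableEq σ]

theorem res_sub_of_eq_zero {A : Type*} [CommRing A] {T : Finset σ} {t : σ} {τ : MvPowerSeries σ A}
    (hτ : constantCoeff τ = 0) (h : res T τ = 0) (F : MvPowerSeries σ A) :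
    res T (sub t τ F) = res (T.erase t) F := by
  rw [res_apply, subst_sub (constantCoeff_resVal T), res_apply]
  refine congrArg (fun f => subst f F) (funext fun s => ?_)
  by_cases hs : s = t
  · subst hs
    rw [← res_apply]
    simp [subVal, hτ, resVal, h]
  · rw [subVal, Function.update_of_ne hs, ← res_apply, res_X]
    simp [resVal, hs]

theorem res_empty {A : Type*} [CommRing A] (F : MvPowerSeries σ A) :
    res ∅ F = C (constantCoeff F) := by
  have h := eq_C_of_mem_Vars_empty (res_mem_Vars ∅ F)
  rw [h]
  congr 1
  rw [res_apply, constantCoeff_subst' (constantCoeff_resVal ∅)]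

theorem sub_mono {A : Type*} [CommRing A] {t u : σ} (htu : t ≠ u) (η : A) (e : σ → ℕ) :
    sub t (X u * (X t + C η)) (mono A e) =
      mono A (Function.update (blowExp t u e) t 0) * (X t + C η) ^ e t := by
  have h1 : ∀ f : σ → MvPowerSeries σ A, ∏ s, f s =
      f t * (f u * ∏ s ∈ (Finset.univ.erase t).erase u, f s) := by
    intro f
    rw [Finset.mul_prod_erase _ _ (by simp [htu.symm]), Finset.mul_prod_erase _ _ (by simp)]
  rw [mono, map_prod, h1, mono, h1]
  simp only [map_pow]
  rw [sub_X_self (by simp), sub_X_of_ne htu.symm, Function.update_self,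
    Function.update_of_ne htu.symm, blowExp_self]
  have h2 : ∏ s ∈ (Finset.univ.erase t).erase u,
        sub t (X u * (X t + C η)) (X s : MvPowerSeries σ A) ^ e s =
      ∏ s ∈ (Finset.univ.erase t).erase u,
        (X s : MvPowerSeries σ A) ^ Function.update (blowExp t u e) t 0 s := by
    refine Finset.prod_congr rfl fun s hs => ?_
    simp only [Finset.mem_erase] at hs
    rw [sub_X_of_ne hs.2.1, Function.update_of_ne hs.2.1, blowExp_of_ne hs.1]
  rw [h2, mul_pow, pow_add, pow_zero]
  ring

theorem mono_update_mul {A : Type*} [CommRing A] (t : σ) (e : σ → ℕ) :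
    mono A (Function.update e t 0) * X t ^ e t = mono A e := by
  rw [← mono_single, ← mono_add]
  congr 1
  ext s
  by_cases h : s = t
  · subst h; simp
  · simp [h]

/-- The part of an exponent vector outside `V`. -/
def offExp (V : Finset σ) (e : σ → ℕ) (s : σ) : ℕ := if s ∈ V then 0 else e s

/-- The vector measuring whether exponent vectors depend affinely on their index. -/
def slopeDiff (E : ℕ → σ → ℕ) (j k j' k' : ℕ) (s : σ) : ℤ :=
  ((j' : ℤ) - k') * ((E j s : ℤ) - E k s) - ((j : ℤ) - k) * ((E j' s : ℤ) - E k' s)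

theorem slopeDiff_blow_self (E : ℕ → σ → ℕ) (t u : σ) (j k j' k' : ℕ) :
    slopeDiff (fun i => blowExp t u (E i)) j k j' k' u =
      slopeDiff E j k j' k' t + slopeDiff E j k j' k' u := by
  simp only [slopeDiff, blowExp_self]; push_cast; ring

theorem slopeDiff_blow_of_ne (E : ℕ → σ → ℕ) {t u s : σ} (h : s ≠ u) (j k j' k' : ℕ) :
    slopeDiff (fun i => blowExp t u (E i)) j k j' k' s = slopeDiff E j k j' k' s := by
  simp only [slopeDiff, blowExp_of_ne h]

variable {p : ℕ} [Fact p.Prime]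

/-- Regularity in one variable of order less than `D` suffices for goodness. -/
def Reg (p : ℕ) [Fact p.Prime] (S : Finset σ) (D : ℕ) : Prop :=
  ∀ l ∈ S, ∀ m ∈ Vars ℤ_[p] (S.erase l), m ≠ 0 → ∀ h ∈ Vars ℤ_[p] S,
    (∃ k < D, coeff (Finsupp.single l k) h ≠ 0) → Good S (m * h)

/-- The data of a sum of monomials times units, with the units having prescribed restrictions to
the coordinate axes of the variables in `V`. -/
structure ToricData (S : Finset σ) (J : Finset ℕ) (V : Finset σ) (E : ℕ → σ → ℕ) (a : σ → ℕ)
    (w : ℕ → MvPowerSeries σ ℤ_[p]) (η : σ → ℤ_[p]) : Prop where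
  sub : V ⊆ S
  eta : ∀ v ∈ V, η v ≠ 0
  suppE : ∀ j ∈ J, ∀ s, s ∉ S → E j s = 0
  suppa : ∀ s, s ∉ S → a s = 0
  a_zero : ∀ v ∈ V, a v = 0
  mem : ∀ j ∈ J, w j ∈ Vars ℤ_[p] S
  unit : ∀ j ∈ J, constantCoeff (w j) ≠ 0
  line : ∀ j ∈ J, ∀ v ∈ V, ∃ c ≠ 0, res {v} (w j) = C c * (X v + C (η v)) ^ E j v
  inj : ∀ j ∈ J, ∀ k ∈ J, E j = E k → j = k
  sign : ∀ j ∈ J, ∀ k ∈ J, ∀ j' ∈ J, ∀ k' ∈ J, k < j → k' < j' →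
    (∀ s, 0 ≤ slopeDiff E j k j' k' s) ∨ (∀ s, slopeDiff E j k j' k' s ≤ 0)
  zero : ∀ j ∈ J, ∀ k ∈ J, ∀ j' ∈ J, ∀ k' ∈ J, k < j → k' < j' →
    (∀ s, s ∉ V → slopeDiff E j k j' k' s = 0) → ∀ s, slopeDiff E j k j' k' s = 0

namespace ToricData

variable {S : Finset σ} {J : Finset ℕ} {V : Finset σ} {E : ℕ → σ → ℕ} {a : σ → ℕ}
  {w : ℕ → MvPowerSeries σ ℤ_[p]} {η : σ → ℤ_[p]}

theorem good_chart (hd : ToricData S J V E a w η) {t u : σ} (ht : t ∈ S) (hu : u ∈ S)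
    (htV : t ∉ V) (huV : u ∉ V) (htu : t ≠ u)
    (h1 : ∀ a w η, ToricData (p := p) S J V (fun k => blowExp t u (E k)) a w η →
      Good S (mono _ a * ∑ j ∈ J, mono _ (offExp V (blowExp t u (E j))) * w j))
    (h2 : ∀ a w η, ToricData (p := p) S J (insert t V) (fun k => blowExp t u (E k)) a w η →
      Good S (mono _ a * ∑ j ∈ J, mono _ (offExp (insert t V) (blowExp t u (E j))) * w j))
    (η₀ : ℤ_[p]) :
    Good S (PadicZeta.sub t (X u * (X t + C η₀))
      (mono _ a * ∑ j ∈ J, mono _ (offExp V (E j)) * w j) * X u) := by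
  set τ : MvPowerSeries σ ℤ_[p] := X u * (X t + C η₀) with hτ
  have hτ0 : constantCoeff τ = 0 := by simp [hτ]
  have hτS : τ ∈ Vars ℤ_[p] S := Subalgebra.mul_mem _ (X_mem_Vars hu)
    (Subalgebra.add_mem _ (X_mem_Vars ht) (C_mem_Vars _ _))
  have hbs : ∀ e : σ → ℕ, (∀ s, s ∉ S → e s = 0) → ∀ s, s ∉ S → blowExp t u e s = 0 := by
    intro e he s hs
    rw [blowExp_of_ne (by rintro rfl; exact hs hu)]
    exact he s hs
  have hinj : ∀ j ∈ J, ∀ k ∈ J, blowExp t u (E j) = blowExp t u (E k) → j = k := by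
    intro j hj k hk h
    refine hd.inj j hj k hk (funext fun s => ?_)
    have ht := congrFun h t
    rw [blowExp_of_ne htu, blowExp_of_ne htu] at ht
    have hs := congrFun h s
    by_cases hsu : s = u
    · subst hsu
      rw [blowExp_self, blowExp_self] at hs
      omega
    · rwa [blowExp_of_ne hsu, blowExp_of_ne hsu] at hs
  have hsign : ∀ j ∈ J, ∀ k ∈ J, ∀ j' ∈ J, ∀ k' ∈ J, k < j → k' < j' →
      (∀ s, 0 ≤ slopeDiff (fun k => blowExp t u (E k)) j k j' k' s) ∨
        (∀ s, slopeDiff (fun k => blowExp t u (E k)) j k j' k' s ≤ 0) := by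
    intro j hj k hk j' hj' k' hk' hjk hjk'
    refine (hd.sign j hj k hk j' hj' k' hk' hjk hjk').imp (fun h s => ?_) (fun h s => ?_)
    all_goals
      by_cases hsu : s = u
      · subst hsu
        rw [slopeDiff_blow_self]
        have := h s; have := h t; omega
      · rw [slopeDiff_blow_of_ne _ hsu]; exact h s
  have hzero : ∀ V' ⊆ insert t V, ∀ j ∈ J, ∀ k ∈ J, ∀ j' ∈ J, ∀ k' ∈ J, k < j → k' < j' →
      (∀ s, s ∉ V' → slopeDiff (fun k => blowExp t u (E k)) j k j' k' s = 0) →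
        ∀ s, slopeDiff (fun k => blowExp t u (E k)) j k j' k' s = 0 := by
    intro V' hV' j hj k hk j' hj' k' hk' hjk hjk' h
    have htu0 : slopeDiff E j k j' k' t = 0 ∧ slopeDiff E j k j' k' u = 0 := by
      have := h u (fun h => by simpa [htu.symm, huV] using hV' h)
      rw [slopeDiff_blow_self] at this
      rcases hd.sign j hj k hk j' hj' k' hk' hjk hjk' with h | h <;>
      · have := h t; have := h u; omega
    have h0 := hd.zero j hj k hk j' hj' k' hk' hjk hjk' fun s hs => by
      by_cases hsu : s = u
      · subst hsu; exact htu0.2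
      by_cases hst : s = t
      · subst hst; exact htu0.1
      rw [← slopeDiff_blow_of_ne E (t := t) hsu]
      exact h s (fun h => by simpa [hst, hs] using hV' h)
    intro s
    by_cases hsu : s = u
    · subst hsu; rw [slopeDiff_blow_self, h0, h0, add_zero]
    · rw [slopeDiff_blow_of_ne _ hsu, h0]
  have hoff : ∀ j, (offExp V (E j)) t = E j t := fun j => by simp [offExp, htV]
  have hblow : ∀ j, blowExp t u (offExp V (E j)) = offExp V (blowExp t u (E j)) := by
    intro j
    ext s
    by_cases hsu : s = u
    · subst hsu; simp [blowExp_self, offExp, htV, huV]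
    · simp [blowExp_of_ne hsu, offExp]
  have hresτ : ∀ v, v ≠ u → res {v} τ = 0 := by
    intro v hv
    rw [hτ, map_mul, res_X_of_notMem (by simpa using hv.symm), zero_mul]
  rw [map_mul, map_sum, hτ, sub_mono htu, ← hτ]
  by_cases hη : η₀ = 0
  · have := h1 (blowExp t u a + Pi.single u 1) (fun j => PadicZeta.sub t τ (w j)) η
      { sub := hd.sub
        eta := hd.eta
        suppE := fun j hj => hbs _ (hd.suppE j hj)
        suppa := fun s hs => by
          rw [Pi.add_apply, hbs a hd.suppa s hs, Pi.single_eq_of_ne (by rintro rfl; exact hs hu), add_zero]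
        a_zero := fun v hv => by
          have : v ≠ u := by rintro rfl; exact huV hv
          rw [Pi.add_apply, Pi.single_eq_of_ne this, blowExp_of_ne this, hd.a_zero v hv, add_zero]
        mem := fun j hj => sub_mem_Vars hτS (hd.mem j hj)
        unit := fun j hj => by simpa using hd.unit j hj
        line := fun j hj v hv => by
          have hvu : v ≠ u := by rintro rfl; exact huV hv
          have hvt : t ≠ v := by rintro rfl; exact htV hv
          rw [res_sub_of_eq_zero hτ0 (hresτ v hvu), Finset.erase_eq_of_notMem (by simpa using hvt),
            blowExp_of_ne hvu]
          exact hd.line j hj v hv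
        inj := hinj
        sign := hsign
        zero := hzero V (Finset.subset_insert _ _) }
    convert this using 1
    have e1 : ∀ e : σ → ℕ, mono ℤ_[p] (Function.update (blowExp t u e) t 0) * (X t + C η₀) ^ e t =
        mono ℤ_[p] (blowExp t u e) := by
      intro e
      have := mono_update_mul (A := ℤ_[p]) t (blowExp t u e)
      rw [blowExp_of_ne htu] at this
      rw [hη, map_zero, add_zero, this]
    rw [mono_add, mono_single, pow_one, e1, mul_right_comm]
    congr 1
    refine Finset.sum_congr rfl fun j _ => ?_
    rw [map_mul, hτ, sub_mono htu, e1, hblow]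
  · have := h2 (Function.update (blowExp t u a + Pi.single u 1) t 0)
      (fun j => PadicZeta.sub t τ (w j) * (X t + C η₀) ^ E j t) (Function.update η t η₀)
      { sub := Finset.insert_subset ht hd.sub
        eta := fun v hv => by
          by_cases hvt : v = t
          · subst hvt; simpa using hη
          · rw [Function.update_of_ne hvt]
            exact hd.eta v (by simpa [hvt] using hv)
        suppE := fun j hj => hbs _ (hd.suppE j hj)
        suppa := fun s hs => by
          rw [Function.update_of_ne (by rintro rfl; exact hs ht), Pi.add_apply,
            hbs a hd.suppa s hs, Pi.single_eq_of_ne (by rintro rfl; exact hs hu), add_zero]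
        a_zero := fun v hv => by
          by_cases hvt : v = t
          · subst hvt; simp
          have hv : v ∈ V := by simpa [hvt] using hv
          have : v ≠ u := by rintro rfl; exact huV hv
          rw [Function.update_of_ne hvt, Pi.add_apply, Pi.single_eq_of_ne this,
            blowExp_of_ne this, hd.a_zero v hv, add_zero]
        mem := fun j hj => Subalgebra.mul_mem _ (sub_mem_Vars hτS (hd.mem j hj))
          (Subalgebra.pow_mem _ (Subalgebra.add_mem _ (X_mem_Vars ht) (C_mem_Vars _ _)) _)
        unit := fun j hj => by simpa using ⟨hd.unit j hj, fun h => absurd h hη⟩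
        line := fun j hj v hv => by
          by_cases hvt : v = t
          · subst hvt
            refine ⟨constantCoeff (w j), hd.unit j hj, ?_⟩
            rw [map_mul, res_sub_of_eq_zero hτ0 (hresτ v htu), map_pow, map_add, res_C,
              res_X_of_mem (by simp), Function.update_self, blowExp_of_ne htu]
            simp only [Finset.erase_singleton, res_empty]
          have hv : v ∈ V := by simpa [hvt] using hv
          have hvu : v ≠ u := by rintro rfl; exact huV hv
          obtain ⟨c, hc, hw⟩ := hd.line j hj v hv
          refine ⟨c * η₀ ^ E j t, mul_ne_zero hc (pow_ne_zero _ hη), ?_⟩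
          rw [map_mul, res_sub_of_eq_zero hτ0 (hresτ v hvu),
            Finset.erase_eq_of_notMem (by simpa using Ne.symm hvt), hw, map_pow, map_add, res_C,
            res_X_of_notMem (by simpa using Ne.symm hvt), zero_add, Function.update_of_ne hvt,
            blowExp_of_ne hvu, map_mul, map_pow]
          ring
        inj := hinj
        sign := hsign
        zero := hzero _ subset_rfl }
    have := this.mul_unit (u := (X t + C η₀) ^ a t) (by simpa using fun h => absurd h hη)
    convert this using 1
    have e2 : ∀ j, mono ℤ_[p] (Function.update (blowExp t u (offExp V (E j))) t 0) =
        mono ℤ_[p] (offExp (insert t V) (blowExp t u (E j))) := by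
      intro j
      congr 1
      ext s
      by_cases hst : s = t
      · subst hst; simp [offExp]
      · rw [Function.update_of_ne hst, hblow]
        simp [offExp, hst]
    have e3 : Function.update (blowExp t u a + Pi.single u 1) t 0 =
        Function.update (blowExp t u a) t 0 + Pi.single u 1 := by
      ext s
      by_cases hst : s = t
      · subst hst; simp [htu]
      · simp [hst]
    have e4 : ∑ j ∈ J, PadicZeta.sub t τ (mono ℤ_[p] (offExp V (E j)) * w j) =
        ∑ j ∈ J, mono ℤ_[p] (offExp (insert t V) (blowExp t u (E j))) *
          (PadicZeta.sub t τ (w j) * (X t + C η₀) ^ E j t) := by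
      refine Finset.sum_congr rfl fun j _ => ?_
      rw [map_mul, hτ, sub_mono htu, e2, hoff]
      ring
    rw [e3, mono_add, mono_single, pow_one, e4]
    ring

theorem good_of_comparable (hd : ToricData S J V E a w η) (hJ : J.Nonempty)
    (hreg : Reg p S J.card)
    (hcmp : ∀ j ∈ J, ∀ k ∈ J, (∀ s ∈ S \ V, E j s ≤ E k s) ∨ (∀ s ∈ S \ V, E k s ≤ E j s)) :
    Good S (mono _ a * ∑ j ∈ J, mono _ (offExp V (E j)) * w j) := by
  obtain ⟨j₀, hj₀, hmin⟩ := Finset.exists_min_image J (fun j => ∑ s ∈ S \ V, E j s) hJ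
  have hle : ∀ j ∈ J, offExp V (E j₀) ≤ offExp V (E j) := by
    intro j hj s
    rw [offExp, offExp]
    split_ifs with hs
    · exact le_rfl
    by_cases hsS : s ∈ S
    swap
    · rw [hd.suppE _ hj₀ s hsS]; exact Nat.zero_le _
    have hs' : s ∈ S \ V := Finset.mem_sdiff.mpr ⟨hsS, hs⟩
    rcases hcmp j₀ hj₀ j hj with h | h
    · exact h s hs'
    · exact ((Finset.sum_eq_sum_iff_of_le h).mp (le_antisymm (Finset.sum_le_sum h) (hmin j hj))
        s hs').ge
  set e₀ := offExp V (E j₀) with he₀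
  set d : ℕ → σ → ℕ := fun j => offExp V (E j) - e₀ with hdd
  have hde : ∀ j ∈ J, offExp V (E j) = e₀ + d j := fun j hj =>
    (add_tsub_cancel_of_le (hle j hj)).symm
  have hF : mono ℤ_[p] a * ∑ j ∈ J, mono _ (offExp V (E j)) * w j =
      mono _ (a + e₀) * ∑ j ∈ J, mono _ (d j) * w j := by
    rw [mono_add, mul_assoc, Finset.mul_sum (a := mono _ e₀)]
    congr 1
    refine Finset.sum_congr rfl fun j hj => ?_
    rw [hde j hj, mono_add, mul_assoc]
  rw [hF]
  have hdV : ∀ j, ∀ v ∈ V, d j v = 0 := fun j v hv => by simp [hdd, offExp, hv]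
  have hdS : ∀ j ∈ J, ∀ v, v ∉ S → d j v = 0 := fun j hj v hv => by
    simp [hdd, offExp, hd.suppE j hj v hv]
  have hd₀ : d j₀ = 0 := by simp [hdd, he₀]
  set J₀ := J.filter fun j => d j = 0 with hJ₀
  have hJ₀J : J₀ ⊆ J := Finset.filter_subset _ _
  have hj₀' : j₀ ∈ J₀ := Finset.mem_filter.mpr ⟨hj₀, hd₀⟩
  by_cases hone : ∀ j ∈ J₀, j = j₀
  · refine .leaf ⟨_, _, ?_, rfl⟩
    rw [map_sum, Finset.sum_eq_single j₀]
    · rw [hd₀, mono_zero, one_mul]; exact hd.unit j₀ hj₀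
    · intro j hj hne
      rw [map_mul, constantCoeff_mono, zero_mul]
      exact fun h => hne (hone j (Finset.mem_filter.mpr ⟨hj, h⟩))
    · exact fun h => absurd hj₀ h
  obtain ⟨j₁, k₁, hj₁, hk₁, hlt⟩ : ∃ j₁ k₁, j₁ ∈ J₀ ∧ k₁ ∈ J₀ ∧ k₁ < j₁ := by
    push Not at hone
    obtain ⟨j, hj, hne⟩ := hone
    rcases lt_or_gt_of_ne hne with h | h
    · exact ⟨j₀, j, hj₀', hj, h⟩
    · exact ⟨j, j₀, hj, hj₀', h⟩
  have heq : ∀ j ∈ J₀, ∀ s, s ∉ V → E j s = E j₀ s := by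
    intro j hj s hs
    have h1 := hde j (hJ₀J hj)
    rw [(Finset.mem_filter.mp hj).2, add_zero, he₀] at h1
    simpa [offExp, hs] using congrFun h1 s
  obtain ⟨v, hv⟩ : ∃ v, E j₁ v ≠ E k₁ v := by
    by_contra! h
    exact hlt.ne' (hd.inj _ (hJ₀J hj₁) _ (hJ₀J hk₁) (funext h))
  have hvV : v ∈ V := by
    by_contra h
    exact hv ((heq _ hj₁ v h).trans (heq _ hk₁ v h).symm)
  have hneq : ∀ j ∈ J₀, ∀ k ∈ J₀, k < j → E j v ≠ E k v := by
    intro j hj k hk hjk h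
    have := hd.zero j (hJ₀J hj) k (hJ₀J hk) j₁ (hJ₀J hj₁) k₁ (hJ₀J hk₁) hjk hlt
      (fun s hs => by simp [slopeDiff, heq _ hj s hs, heq _ hk s hs, heq _ hj₁ s hs,
        heq _ hk₁ s hs]) v
    rw [slopeDiff, h, sub_self, mul_zero, zero_sub, neg_eq_zero, mul_eq_zero] at this
    omega
  have hinj : Set.InjOn (fun j => E j v) J₀ := by
    intro j hj k hk h
    by_contra hne
    rcases lt_or_gt_of_ne hne with h' | h'
    · exact hneq k hk j hj h' h.symm
    · exact hneq j hj k hk h' h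
  have hex : ∀ j, ∃ c : ℤ_[p], j ∈ J → c ≠ 0 ∧ res {v} (w j) = C c * (X v + C (η v)) ^ E j v := by
    intro j
    by_cases hj : j ∈ J
    · obtain ⟨c, hc⟩ := hd.line j hj v hvV
      exact ⟨c, fun _ => hc⟩
    · exact ⟨0, fun h => absurd h hj⟩
  choose c hc using hex
  obtain ⟨k, hk, hk'⟩ := exists_coeff_fewnomial_ne_zero v ⟨j₀, hj₀'⟩ hinj
    (fun j hj => (hc j (hJ₀J hj)).1) (hd.eta v hvV)
  refine hreg v (hd.sub hvV) _ (mono_mem_Vars fun s hs => ?_) (mono_ne_zero _) _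
    (Subalgebra.sum_mem _ fun j hj => Subalgebra.mul_mem _ (mono_mem_Vars (hdS j hj)) (hd.mem j hj))
    ⟨k, hk.trans_le (Finset.card_le_card hJ₀J), ?_⟩
  · rw [Finset.mem_erase, not_and_or, not_not] at hs
    rcases hs with rfl | hs
    · simp [hd.a_zero s hvV, he₀, offExp, hvV]
    · simp [hd.suppa s hs, he₀, offExp, hd.suppE _ hj₀ s hs]
  · rw [← coeff_res_single, map_sum]
    convert hk' using 2
    rw [hJ₀, Finset.sum_filter]
    refine Finset.sum_congr rfl fun j hj => ?_
    rw [map_mul]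
    split_ifs with h
    · rw [h, mono_zero, map_one, one_mul, (hc j hj).2]
    · obtain ⟨s, hs⟩ : ∃ s, d j s ≠ 0 := by
        by_contra! h'
        exact h (funext h')
      have hsv : s ≠ v := by rintro rfl; exact hs (hdV j s hvV)
      rw [mono, map_prod, Finset.prod_eq_zero (Finset.mem_univ s), zero_mul]
      rw [map_pow, res_X_of_notMem (by simpa using hsv), zero_pow hs]

theorem good (hd : ToricData S J V E a w η) (hJ : J.Nonempty) (hreg : Reg p S J.card) :
    Good S (mono _ a * ∑ j ∈ J, mono _ (offExp V (E j)) * w j) := by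
  refine principalize (S := S) (M := fun V E => ∀ a w η, ToricData (p := p) S J V E a w η →
    Good S (mono _ a * ∑ j ∈ J, mono _ (offExp V (E j)) * w j)) ?_ (J ×ˢ J) ?_ V E a w η hd
  · intro V E t u ht hu htV huV htu h1 h2 h3 h4 a w η hd
    exact .blowup t u ht hu htu (hd.good_chart ht hu htV huV htu h1 h2)
      (hd.good_chart hu ht huV htV htu.symm h3 h4)
  · intro V E h a w η hd
    exact hd.good_of_comparable hJ hreg fun j hj k hk =>
      h (j, k) (Finset.mem_product.mpr ⟨hj, hk⟩)

end ToricData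

end Toric
end PadicZeta

namespace PadicZeta
open MvPowerSeries

section Lift

variable {σ : Type*} [Fintype σ] [DecidableEq σ] {p : ℕ} [Fact p.Prime]

theorem supp_of_mono_mul_mem_Vars {A : Type*} [CommRing A] {T : Finset σ} {a : σ → ℕ}
    {u : MvPowerSeries σ A} (hu : constantCoeff u ≠ 0) (h : mono A a * u ∈ Vars A T) :
    (∀ s, s ∉ T → a s = 0) ∧ u ∈ Vars A T := by
  have key : ∀ d : σ →₀ ℕ, coeff d u ≠ 0 → ∀ s, s ∉ T → a s + d s = 0 := by
    intro d hd s hs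
    have h1 := h (Finsupp.equivFunOnFinite.symm (a + d)) (by
      rw [coeff_mono_mul, if_pos (by simp)]
      convert hd using 2
      ext; simp)
    by_contra h2
    exact hs (h1 (by simpa using h2))
  refine ⟨fun s hs => ?_, fun d hd s hs => ?_⟩
  · have := key 0 (by simpa using hu) s hs
    simpa using this
  · by_contra h2
    have := key d hd s h2
    rw [Finsupp.mem_support_iff] at hs
    omega

/-- Being zero or dividing `G`. -/
def ZeroOrDvd (G F : MvPowerSeries σ ℤ_[p]) : Prop := F = 0 ∨ F ∣ G

theorem ZeroOrDvd.map {G F : MvPowerSeries σ ℤ_[p]} (h : ZeroOrDvd G F)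
    (f : MvPowerSeries σ ℤ_[p] →ₐ[ℤ_[p]] MvPowerSeries σ ℤ_[p]) : ZeroOrDvd (f G) (f F) := by
  rcases h with rfl | h
  · exact .inl (map_zero _)
  · exact .inr (map_dvd f h)

theorem ZeroOrDvd.mul {G F : MvPowerSeries σ ℤ_[p]} (h : ZeroOrDvd G F)
    (H : MvPowerSeries σ ℤ_[p]) : ZeroOrDvd (G * H) F :=
  h.imp_right fun h => h.mul_right H

/-- The binomial measuring whether the Newton slopes between the terms of index `j, k` and
`j', k'` of a polynomial with coefficients `c` are comparable. -/
def slopeBinomial {R : Type*} [CommRing R] (c : ℕ → R) (j k j' k' : ℕ) : R :=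
  c j ^ (j' - k') * c k' ^ (j - k) - c k ^ (j' - k') * c j' ^ (j - k)

theorem map_slopeBinomial {R R' F : Type*} [CommRing R] [CommRing R'] [FunLike F R R']
    [RingHomClass F R R'] (f : F) (c : ℕ → R) (j k j' k' : ℕ) :
    f (slopeBinomial c j k j' k') = slopeBinomial (fun i => f (c i)) j k j' k' := by
  simp [slopeBinomial]

/-- A polynomial in `X_l` without second coefficient, whose coefficients are controlled by `G`. -/
structure LiftData (T : Finset σ) (l : σ) (D : ℕ) (G m : MvPowerSeries σ ℤ_[p])
    (c : ℕ → MvPowerSeries σ ℤ_[p]) (w : MvPowerSeries σ ℤ_[p]) : Prop where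
  m_mem : m ∈ Vars ℤ_[p] T
  m_dvd : m ∣ G
  c_mem : ∀ j, c j ∈ Vars ℤ_[p] T
  c_dvd : ∀ j ≤ D + 1, ZeroOrDvd G (c j)
  c_last : c (D + 1) = 1
  c_second : c D = 0
  slope : ∀ j ≤ D + 1, ∀ k ≤ D + 1, ∀ j' ≤ D + 1, ∀ k' ≤ D + 1, k < j → k' < j' →
    ZeroOrDvd G (slopeBinomial c j k j' k')
  w_mem : w ∈ Vars ℤ_[p] (insert l T)
  w_unit : constantCoeff w ≠ 0

theorem Reg.mono {S : Finset σ} {D D' : ℕ} (h : D' ≤ D) (hr : Reg p S D) : Reg p S D' :=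
  fun l hl m hm hm0 F hF ⟨k, hk, hk'⟩ => hr l hl m hm hm0 F hF ⟨k, hk.trans_le h, hk'⟩

theorem LiftData.sub {T : Finset σ} {l : σ} {D : ℕ} {G m : MvPowerSeries σ ℤ_[p]}
    {c : ℕ → MvPowerSeries σ ℤ_[p]} {w : MvPowerSeries σ ℤ_[p]} (hd : LiftData T l D G m c w)
    {i : σ} {τ : MvPowerSeries σ ℤ_[p]} (hτ : τ ∈ Vars ℤ_[p] T) {H : MvPowerSeries σ ℤ_[p]}
    (hH : H ∈ Vars ℤ_[p] T) :
    LiftData T l D (sub i τ G * H) (PadicZeta.sub i τ m * H) (fun j => PadicZeta.sub i τ (c j))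
      (PadicZeta.sub i τ w) where
  m_mem := Subalgebra.mul_mem _ (sub_mem_Vars hτ hd.m_mem) hH
  m_dvd := mul_dvd_mul_right (map_dvd _ hd.m_dvd) _
  c_mem j := sub_mem_Vars hτ (hd.c_mem j)
  c_dvd j hj := ((hd.c_dvd j hj).map _).mul _
  c_last := by rw [hd.c_last, map_one]
  c_second := by rw [hd.c_second, map_zero]
  slope j hj k hk j' hj' k' hk' h h' := by
    rw [← map_slopeBinomial]
    exact ((hd.slope j hj k hk j' hj' k' hk' h h').map _).mul _
  w_mem := sub_mem_Vars (Vars_mono (Finset.subset_insert _ _) hτ) hd.w_mem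
  w_unit := by simpa using hd.w_unit

theorem sub_lift_form {i l : σ} (hil : l ≠ i) (τ m w : MvPowerSeries σ ℤ_[p]) (D : ℕ)
    (c : ℕ → MvPowerSeries σ ℤ_[p]) :
    sub i τ (m * (∑ j ∈ Finset.range D, c j * X l ^ j + X l ^ D * w)) =
      sub i τ m * (∑ j ∈ Finset.range D, sub i τ (c j) * X l ^ j + X l ^ D * sub i τ w) := by
  simp only [map_mul, map_add, map_sum, map_pow, sub_X_of_ne hil]

theorem LiftData.good_of_isMon {T : Finset σ} {l : σ} (hl : l ∉ T) {D : ℕ}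
    (hreg : Reg p (insert l T) (D + 1)) {G m : MvPowerSeries σ ℤ_[p]}
    {c : ℕ → MvPowerSeries σ ℤ_[p]} {w : MvPowerSeries σ ℤ_[p]} (hd : LiftData T l D G m c w)
    (hG : IsMon G) :
    Good (insert l T) (m * (∑ j ∈ Finset.range (D + 1), c j * X l ^ j + X l ^ (D + 1) * w)) := by
  classical
  obtain ⟨a, um, hum, hm⟩ := hG.of_dvd hd.m_dvd
  have hmT := supp_of_mono_mul_mem_Vars hum (hm ▸ hd.m_mem)
  set J := (Finset.range (D + 2)).filter fun j => c j ≠ 0 with hJ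
  have hJD : D + 1 ∈ J := by simp [hJ, hd.c_last]
  have hJmem : ∀ {j}, j ∈ J ↔ j ≤ D + 1 ∧ c j ≠ 0 := by
    intro j; rw [hJ, Finset.mem_filter, Finset.mem_range, Nat.lt_succ_iff]
  have hcard : J.card ≤ D + 1 := by
    have : J ⊆ (Finset.range (D + 2)).erase D := by
      intro j hj
      rw [hJmem] at hj
      rw [Finset.mem_erase, Finset.mem_range]
      exact ⟨by rintro rfl; exact hj.2 hd.c_second, by omega⟩
    refine (Finset.card_le_card this).trans ?_
    rw [Finset.card_erase_of_mem (by simp), Finset.card_range]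
    omega
  have hex : ∀ j, ∃ b : σ → ℕ, ∃ u : MvPowerSeries σ ℤ_[p], j ∈ J →
      constantCoeff u ≠ 0 ∧ c j = mono _ b * u := by
    intro j
    by_cases hj : j ∈ J
    · obtain ⟨h1, h2⟩ := hJmem.mp hj
      obtain ⟨b, u, hu, h⟩ := hG.of_dvd ((hd.c_dvd j h1).resolve_left h2)
      exact ⟨b, u, fun _ => ⟨hu, h⟩⟩
    · exact ⟨0, 0, fun h => absurd h hj⟩
  choose b u hbu using hex
  have hbT : ∀ j ∈ J, (∀ s, s ∉ T → b j s = 0) ∧ u j ∈ Vars ℤ_[p] T := fun j hj =>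
    supp_of_mono_mul_mem_Vars (hbu j hj).1 ((hbu j hj).2 ▸ hd.c_mem j)
  set W : ℕ → MvPowerSeries σ ℤ_[p] := fun j => if j = D + 1 then w else 1 with hW
  have hWu : ∀ j, constantCoeff (W j) ≠ 0 := by
    intro j; simp only [hW]; split_ifs
    · exact hd.w_unit
    · simp
  have hWmem : ∀ j, W j ∈ Vars ℤ_[p] (insert l T) := by
    intro j; simp only [hW]; split_ifs
    · exact hd.w_mem
    · exact Subalgebra.one_mem _
  set E : ℕ → σ → ℕ := fun j => b j + Pi.single l j with hE
  have hEl : ∀ j ∈ J, E j l = j := fun j hj => by simp [hE, (hbT j hj).1 l hl]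
  have hEs : ∀ j s, s ≠ l → E j s = b j s := fun j s hs => by simp [hE, hs]
  have hsign : ∀ j ∈ J, ∀ k ∈ J, ∀ j' ∈ J, ∀ k' ∈ J, k < j → k' < j' →
      (∀ s, 0 ≤ slopeDiff E j k j' k' s) ∨ (∀ s, slopeDiff E j k j' k' s ≤ 0) := by
    intro j hj k hk j' hj' k' hk' hjk hjk'
    have hpow : ∀ i i' n n', i ∈ J → i' ∈ J → c i ^ n * c i' ^ n' =
        mono _ (n • b i + n' • b i') * (u i ^ n * u i' ^ n') := by
      intro i i' n n' hi hi'
      have hmp : ∀ (n : ℕ) (e : σ → ℕ), mono ℤ_[p] (n • e) = mono _ e ^ n := by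
        intro n e
        simp [mono, ← Finset.prod_pow, pow_mul, mul_comm n]
      rw [mono_add, hmp, hmp, (hbu i hi).2, (hbu i' hi').2]
      ring
    have hs := hd.slope j (hJmem.mp hj).1 k (hJmem.mp hk).1 j' (hJmem.mp hj').1 k' (hJmem.mp hk').1
      hjk hjk'
    rw [slopeBinomial, hpow j k' _ _ hj hk', hpow k j' _ _ hk hj'] at hs
    have hu : ∀ i i' n n', i ∈ J → i' ∈ J → constantCoeff (u i ^ n * u i' ^ n') ≠ 0 := by
      intro i i' n n' hi hi'
      rw [map_mul, map_pow, map_pow]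
      exact mul_ne_zero (pow_ne_zero _ (hbu i hi).1) (pow_ne_zero _ (hbu i' hi').1)
    have hc := mono_comparable (hu j k' _ _ hj hk') (hu k j' _ _ hk hj')
      (hs.imp_right fun h => hG.of_dvd h)
    have hcoe : ∀ s, slopeDiff E j k j' k' s =
        ((((j' - k') • b j + (j - k) • b k') s : ℕ) : ℤ) -
          (((j' - k') • b k + (j - k) • b j') s : ℕ) := by
      intro s
      simp only [slopeDiff, Pi.add_apply, Pi.smul_apply, smul_eq_mul]
      by_cases hsl : s = l
      · subst hsl
        rw [hEl j hj, hEl k hk, hEl j' hj', hEl k' hk', (hbT j hj).1 s hl, (hbT k hk).1 s hl,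
          (hbT j' hj').1 s hl, (hbT k' hk').1 s hl]
        push_cast; ring
      · rw [hEs _ _ hsl, hEs _ _ hsl, hEs _ _ hsl, hEs _ _ hsl]
        push_cast [Nat.cast_sub hjk.le, Nat.cast_sub hjk'.le]
        ring
    rcases hc with h | h
    · right; intro s; rw [hcoe, sub_nonpos]; exact_mod_cast h s
    · left; intro s; rw [hcoe, sub_nonneg]; exact_mod_cast h s
  have htd : ToricData (p := p) (insert l T) J ∅ E a (fun j => u j * W j) 0 :=
    { sub := Finset.empty_subset _
      eta := by simp
      suppE := fun j hj s hs => by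
        rw [Finset.mem_insert, not_or] at hs
        rw [hEs j s hs.1, (hbT j hj).1 s hs.2]
      suppa := fun s hs => hmT.1 s fun h => hs (Finset.mem_insert_of_mem h)
      a_zero := by simp
      mem := fun j hj => Subalgebra.mul_mem _
        (Vars_mono (Finset.subset_insert _ _) (hbT j hj).2) (hWmem j)
      unit := fun j hj => by rw [map_mul]; exact mul_ne_zero (hbu j hj).1 (hWu j)
      line := by simp
      inj := fun j hj k hk h => by
        have := congrFun h l
        rwa [hEl j hj, hEl k hk] at this
      sign := hsign
      zero := fun j hj k hk j' hj' k' hk' h h' h0 s => h0 s (Finset.notMem_empty s) }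
  have := (htd.good ⟨_, hJD⟩ (hreg.mono hcard)).mul_unit hum
  convert this using 1
  have e1 : ∑ j ∈ Finset.range (D + 1), c j * X l ^ j + X l ^ (D + 1) * w =
      ∑ j ∈ J, c j * X l ^ j * W j := by
    rw [hJ, Finset.sum_filter_of_ne, Finset.sum_range_succ (n := D + 1), hd.c_last]
    · congr 1
      · refine Finset.sum_congr rfl fun j hj => ?_
        rw [Finset.mem_range] at hj
        simp [hW, hj.ne]
      · simp [hW]
    · intro j _ h h0
      simp [h0] at h
  have e2 : ∑ j ∈ J, c j * X l ^ j * W j = ∑ j ∈ J, mono _ (offExp ∅ (E j)) * (u j * W j) := by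
    refine Finset.sum_congr rfl fun j hj => ?_
    have : offExp ∅ (E j) = b j + Pi.single l j := by ext; simp [offExp, hE]
    rw [this, mono_add, mono_single, (hbu j hj).2]
    ring
  rw [e1, e2, hm]
  ring

theorem Good.lift {T : Finset σ} {l : σ} (hl : l ∉ T) {D : ℕ}
    (hreg : Reg p (insert l T) (D + 1)) {G : MvPowerSeries σ ℤ_[p]} (hG : Good T G)
    {m : MvPowerSeries σ ℤ_[p]}
    {c : ℕ → MvPowerSeries σ ℤ_[p]} {w : MvPowerSeries σ ℤ_[p]} (hd : LiftData T l D G m c w) :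
    Good (insert l T) (m * (∑ j ∈ Finset.range (D + 1), c j * X l ^ j + X l ^ (D + 1) * w)) := by
  induction hG generalizing m c w with
  | leaf h => exact hd.good_of_isMon hl hreg h
  | blowup i j hi hj hij h1 h2 ih1 ih2 =>
    have hil : l ≠ i := by rintro rfl; exact hl hi
    have hjl : l ≠ j := by rintro rfl; exact hl hj
    refine .blowup i j (Finset.mem_insert_of_mem hi) (Finset.mem_insert_of_mem hj) hij
      (fun η => ?_) (fun η => ?_)
    · rw [sub_lift_form hil, mul_right_comm]
      exact ih1 η (hd.sub (Subalgebra.mul_mem _ (X_mem_Vars hj)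
        (Subalgebra.add_mem _ (X_mem_Vars hi) (C_mem_Vars _ _))) (X_mem_Vars hj))
    · rw [sub_lift_form hjl, mul_right_comm]
      exact ih2 η (hd.sub (Subalgebra.mul_mem _ (X_mem_Vars hi)
        (Subalgebra.add_mem _ (X_mem_Vars hj) (C_mem_Vars _ _))) (X_mem_Vars hi))
  | shear i hi φ hφ hφ0 h ih =>
    have hil : l ≠ i := by rintro rfl; exact hl hi
    refine .shear i (Finset.mem_insert_of_mem hi) φ
      (Vars_mono (Finset.erase_subset_erase _ (Finset.subset_insert _ _)) hφ) hφ0 ?_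
    rw [sub_lift_form hil]
    have := hd.sub (i := i) (τ := X i + φ) (Subalgebra.add_mem _ (X_mem_Vars hi)
      (Vars_mono (Finset.erase_subset _ _) hφ)) (Subalgebra.one_mem _)
    rw [mul_one, mul_one] at this
    exact ih this
  | scale i hi a ha h ih =>
    have hil : l ≠ i := by rintro rfl; exact hl hi
    refine .scale i (Finset.mem_insert_of_mem hi) a ha ?_
    rw [sub_lift_form hil]
    have := hd.sub (i := i) (τ := C a * X i) (Subalgebra.mul_mem _ (C_mem_Vars _ _)
      (X_mem_Vars hi)) (Subalgebra.one_mem _)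
    rw [mul_one, mul_one] at this
    exact ih this

end Lift

section Main

variable {σ : Type*} [Fintype σ] [DecidableEq σ] {p : ℕ} [Fact p.Prime]

open Classical in
/-- Replace zero by one. -/
noncomputable def nz {R : Type*} [CommRing R] (x : R) : R := if x = 0 then 1 else x

theorem nz_ne_zero {R : Type*} [CommRing R] [Nontrivial R] (x : R) : nz x ≠ 0 := by
  unfold nz; split_ifs with h
  · exact one_ne_zero
  · exact h

theorem nz_mem {S : Finset σ} {x : MvPowerSeries σ ℤ_[p]} (hx : x ∈ Vars ℤ_[p] S) :
    nz x ∈ Vars ℤ_[p] S := by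
  unfold nz; split_ifs with h
  · exact Subalgebra.one_mem _
  · exact hx

theorem zeroOrDvd_of_nz_dvd {x G : MvPowerSeries σ ℤ_[p]} (h : nz x ∣ G) : ZeroOrDvd G x := by
  unfold nz at h
  split_ifs at h with h'
  · exact .inl h'
  · exact .inr h

theorem slopeBinomial_mem {S : Finset σ} {c : ℕ → MvPowerSeries σ ℤ_[p]}
    (hc : ∀ j, c j ∈ Vars ℤ_[p] S) (j k j' k' : ℕ) :
    slopeBinomial c j k j' k' ∈ Vars ℤ_[p] S := by
  have h := fun i n => Subalgebra.pow_mem _ (hc i) n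
  exact Subalgebra.sub_mem _ (Subalgebra.mul_mem _ (h _ _) (h _ _))
    (Subalgebra.mul_mem _ (h _ _) (h _ _))

theorem exists_liftData {T : Finset σ} {l : σ} {D : ℕ} {m w : MvPowerSeries σ ℤ_[p]}
    {c : ℕ → MvPowerSeries σ ℤ_[p]} (hm : m ∈ Vars ℤ_[p] T) (hm0 : m ≠ 0)
    (hc : ∀ j, c j ∈ Vars ℤ_[p] T) (hc1 : c (D + 1) = 1) (hc0 : c D = 0)
    (hw : w ∈ Vars ℤ_[p] (insert l T)) (hw0 : constantCoeff w ≠ 0) :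
    ∃ G ∈ Vars ℤ_[p] T, G ≠ 0 ∧ LiftData T l D G m c w := by
  let r := Finset.range (D + 2)
  have hr : ∀ {j}, j ≤ D + 1 → j ∈ r := fun h => Finset.mem_range.mpr (Nat.lt_succ_of_le h)
  refine ⟨m * ((∏ j ∈ r, nz (c j)) * ∏ q ∈ r ×ˢ r ×ˢ r ×ˢ r,
    nz (slopeBinomial c q.1 q.2.1 q.2.2.1 q.2.2.2)), ?_, ?_, ?_⟩
  · exact Subalgebra.mul_mem _ hm (Subalgebra.mul_mem _
      (Subalgebra.prod_mem _ fun j _ => nz_mem (hc j))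
      (Subalgebra.prod_mem _ fun j _ => nz_mem (slopeBinomial_mem hc _ _ _ _)))
  · exact mul_ne_zero hm0 (mul_ne_zero (Finset.prod_ne_zero_iff.mpr fun _ _ => nz_ne_zero _)
      (Finset.prod_ne_zero_iff.mpr fun _ _ => nz_ne_zero _))
  · refine ⟨hm, dvd_mul_right _ _, hc, fun j hj => ?_, hc1, hc0,
      fun j hj k hk j' hj' k' hk' _ _ => ?_, hw, hw0⟩
    · exact zeroOrDvd_of_nz_dvd ((Finset.dvd_prod_of_mem (fun j => nz (c j)) (hr hj)).trans
        ((dvd_mul_right _ _).trans (dvd_mul_left _ _)))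
    · refine zeroOrDvd_of_nz_dvd ((Finset.dvd_prod_of_mem
        (fun q : ℕ × ℕ × ℕ × ℕ => nz (slopeBinomial c q.1 q.2.1 q.2.2.1 q.2.2.2))
        (a := (j, k, j', k')) ?_).trans ((dvd_mul_left _ _).trans (dvd_mul_left _ _)))
      simp only [Finset.mem_product]
      exact ⟨hr hj, hr hk, hr hj', hr hk'⟩

theorem rescale_ne_zero {a : σ → ℤ_[p]} (ha : ∀ i, a i ≠ 0) {F : MvPowerSeries σ ℤ_[p]}
    (hF : F ≠ 0) : rescale a F ≠ 0 := by
  obtain ⟨d, hd⟩ := (ne_zero_iff_exists_coeff_ne_zero F).mp hF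
  refine (ne_zero_iff_exists_coeff_ne_zero _).mpr ⟨d, ?_⟩
  rw [coeff_rescale]
  exact mul_ne_zero (prod_pow_ne_zero ha d) hd

theorem reg_of_erase {S : Finset σ}
    (IH : ∀ l ∈ S, ∀ F ∈ Vars ℤ_[p] (S.erase l), F ≠ 0 → Good (S.erase l) F) (D : ℕ) :
    Reg p S D := by
  induction D with
  | zero => rintro l _ m _ _ h _ ⟨k, hk, _⟩; omega
  | succ D ih =>
    rintro l hl m hm hm0 h hh ⟨k, hk, hk'⟩
    by_cases hlow : ∃ k < D, coeff (Finsupp.single l k) h ≠ 0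
    · exact ih l hl m hm hm0 h hh hlow
    push Not at hlow
    obtain rfl : k = D := by
      by_contra hne
      exact hk' (hlow k (by omega))
    cases k with
    | zero =>
      refine ((IH l hl m hm hm0).mono_set (Finset.erase_subset _ _)).mul_unit ?_
      simpa using hk'
    | succ D =>
      obtain ⟨a, ha, φ, hφ, hφ0, h1, h2⟩ := exists_tschirnhaus hh (hlow D (by omega)) hk'
      have hmS := Vars_mono (Finset.erase_subset l S) hm
      refine good_of_rescale (Subalgebra.mul_mem _ hmS hh) ha
        (.shear l hl φ hφ hφ0 ?_)
      set h' := sub l (X l + φ) (rescale a h) with hh'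
      have hh'S : h' ∈ Vars ℤ_[p] S := sub_mem_Vars (Subalgebra.add_mem _ (X_mem_Vars hl)
        (Vars_mono (Finset.erase_subset _ _) hφ)) (rescale_mem_Vars hh a)
      rw [map_mul, map_mul, ← hh', sub_eq_self (Finset.notMem_erase l S) (rescale_mem_Vars hm a)]
      have hlT : l ∉ S.erase l := Finset.notMem_erase l S
      have hS : insert l (S.erase l) = S := Finset.insert_erase hl
      obtain ⟨G, hG, hG0, hd⟩ := exists_liftData (l := l) (D := D) (m := rescale a m)
        (w := tl l (D + 1) h') (c := fun j => if j < D + 1 then cl l j h' else 1)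
        (rescale_mem_Vars hm a) (rescale_ne_zero ha hm0)
        (fun j => by
          split_ifs
          · exact cl_mem_Vars hh'S l j
          · exact Subalgebra.one_mem _)
        (by simp) (by simpa using h1) (by rw [hS]; exact tl_mem_Vars hh'S l (D + 1))
        (by rw [constantCoeff_tl]; exact h2)
      have := (IH l hl G hG hG0).lift hlT (by rw [hS]; exact ih) hd
      rw [hS] at this
      have e : ∑ j ∈ Finset.range (D + 1), (if j < D + 1 then cl l j h' else 1) * X l ^ j =
          ∑ j ∈ Finset.range (D + 1), cl l j h' * X l ^ j :=
        Finset.sum_congr rfl fun j hj => by rw [if_pos (Finset.mem_range.mp hj)]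
      rwa [e, ← eq_sum_cl_add] at this

/-- Every nonzero power series over `ℤ_p` becomes a monomial times a unit under finitely many
blowups, shears and scalings. -/
theorem good_of_ne_zero (S : Finset σ) : ∀ F ∈ Vars ℤ_[p] S, F ≠ 0 → Good S F := by
  induction S using Finset.strongInduction with
  | H S IH =>
    intro F hF hF0
    rcases S.eq_empty_or_nonempty with rfl | ⟨l, hl⟩
    · have := eq_C_of_mem_Vars_empty hF
      refine .leaf ⟨0, F, fun h => hF0 ?_, by rw [mono_zero, one_mul]⟩
      rw [this, h, map_zero]
    · refine good_of_regular hl (fun h hh ⟨k, hk⟩ => ?_) hF hF0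
      have := reg_of_erase (fun l hl => IH _ (Finset.erase_ssubset hl)) (k + 1) l hl 1
        (Subalgebra.one_mem _) one_ne_zero h hh ⟨k, Nat.lt_succ_self k, hk⟩
      rwa [one_mul] at this

end Main
end PadicZeta

namespace PadicZeta
open MvPowerSeries

section Evaluation

variable {σ : Type*} [Fintype σ] [DecidableEq σ] {p : ℕ} [Fact p.Prime]

theorem isLinearTopology_padicInt : IsLinearTopology ℤ_[p] ℤ_[p] := by
  rw [isLinearTopology_iff_hasBasis_ideal]
  refine Filter.hasBasis_iff.2 fun t => ⟨fun ht => ?_, ?_⟩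
  · obtain ⟨ε, hε, h⟩ := Metric.mem_nhds_iff.1 ht
    obtain ⟨k, hk⟩ := exists_pow_lt_of_lt_one hε
      (inv_lt_one_of_one_lt₀ (by exact_mod_cast (Fact.out : p.Prime).one_lt) : ((p : ℝ)⁻¹) < 1)
    have key : ∀ x : ℤ_[p], x ∈ (Ideal.span {(p : ℤ_[p]) ^ k} : Ideal ℤ_[p]) ↔
        ‖x‖ ≤ (p : ℝ)⁻¹ ^ k := by
      intro x
      rw [← PadicInt.norm_le_pow_iff_mem_span_pow, zpow_neg, zpow_natCast, inv_pow]
    refine ⟨Ideal.span {(p : ℤ_[p]) ^ k}, ?_, fun x hx => h ?_⟩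
    · refine Filter.mem_of_superset (Metric.ball_mem_nhds 0 (ε := (p : ℝ)⁻¹ ^ k) ?_) ?_
      · have := (Fact.out : p.Prime).pos
        positivity
      · intro x hx
        rw [mem_ball_zero_iff] at hx
        exact (key x).2 hx.le
    · rw [mem_ball_zero_iff]
      exact ((key x).1 hx).trans_lt hk
  · rintro ⟨I, hI, h⟩
    exact Filter.mem_of_superset hI h

theorem exists_evalHom (z : σ → ℤ_[p]) (hz : ∀ i, ‖z i‖ < 1) :
    ∃ e : MvPowerSeries σ ℤ_[p] →ₐ[ℤ_[p]] ℤ_[p], ∀ i, e (X i) = z i := by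
  have := isLinearTopology_padicInt (p := p)
  let _ : UniformSpace (MvPowerSeries σ ℤ_[p]) := MvPowerSeries.WithPiTopology.instUniformSpace
  have ha : HasEval z := ⟨fun i => ?_, ?_⟩
  · refine ⟨aeval ha, fun i => ?_⟩
    have := eval₂_X (φ := algebraMap ℤ_[p] ℤ_[p]) z i
    rw [← coe_aeval ha] at this
    exact this
  · exact tendsto_pow_atTop_nhds_zero_of_norm_lt_one (hz i)
  · rw [Filter.cofinite_eq_bot]
    exact Filter.tendsto_bot

theorem exists_sub_C_mem_span (F : MvPowerSeries σ ℤ_[p]) :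
    ∃ (c : ℤ_[p]) (g : σ → MvPowerSeries σ ℤ_[p]), F = C c + ∑ i, g i * X i := by
  suffices h : ∀ (S : Finset σ), ∀ F ∈ Vars ℤ_[p] S, ∃ c : ℤ_[p],
      F - C c ∈ Ideal.span (Set.range (X : σ → MvPowerSeries σ ℤ_[p])) by
    obtain ⟨c, hc⟩ := h _ F (mem_Vars_univ F)
    obtain ⟨g, hg⟩ := Ideal.mem_span_range_iff_exists_fun.1 hc
    exact ⟨c, g, by rw [hg]; ring⟩
  intro S
  induction S using Finset.strongInduction with
  | H S ih =>
    intro F hF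
    rcases S.eq_empty_or_nonempty with rfl | ⟨l, hl⟩
    · exact ⟨constantCoeff F, by rw [← eq_C_of_mem_Vars_empty hF, sub_self]; exact zero_mem _⟩
    · obtain ⟨c, hc⟩ := ih _ (Finset.erase_ssubset hl) _ (cl_mem_Vars hF l 0)
      refine ⟨c, ?_⟩
      rw [cl_zero_add l F, add_sub_right_comm]
      exact add_mem hc (Ideal.mul_mem_right _ _ (Ideal.subset_span ⟨l, rfl⟩))

theorem norm_evalHom_sub_le (e₁ e₂ : MvPowerSeries σ ℤ_[p] →ₐ[ℤ_[p]] ℤ_[p]) {r : ℝ}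
    (hr : 0 ≤ r) (h : ∀ i, ‖e₁ (X i) - e₂ (X i)‖ ≤ r) (h2 : ∀ i, ‖e₂ (X i)‖ < 1)
    (F : MvPowerSeries σ ℤ_[p]) : ‖e₁ F - e₂ F‖ ≤ r := by
  have hp : (0 : ℝ) < p := by exact_mod_cast (Fact.out : p.Prime).pos
  have hp1 : (p : ℝ)⁻¹ < 1 := inv_lt_one_of_one_lt₀ (by exact_mod_cast (Fact.out : p.Prime).one_lt)
  have h2' : ∀ i, ‖e₂ (X i)‖ ≤ (p : ℝ)⁻¹ := by
    intro i
    have := (PadicInt.norm_le_pow_iff_norm_lt_pow_add_one (e₂ (X i)) (-1)).2 (by simpa using h2 i)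
    simpa using this
  have key : ∀ (k : ℕ) (F : MvPowerSeries σ ℤ_[p]), ‖e₁ F - e₂ F‖ ≤ max r ((p : ℝ)⁻¹ ^ k) := by
    intro k
    induction k with
    | zero => exact fun F => le_max_of_le_right (by simpa using PadicInt.norm_le_one _)
    | succ k ih =>
      intro F
      obtain ⟨c, g, rfl⟩ := exists_sub_C_mem_span F
      have hC : ∀ e : MvPowerSeries σ ℤ_[p] →ₐ[ℤ_[p]] ℤ_[p], e (C c) = c := fun e => e.commutes c
      simp only [map_add, map_sum, map_mul, hC, add_sub_add_left_eq_sub]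
      rw [← Finset.sum_sub_distrib]
      refine IsUltrametricDist.norm_sum_le_of_forall_le_of_nonneg (le_max_of_le_left hr) fun i _ => ?_
      have : e₁ (g i) * e₁ (X i) - e₂ (g i) * e₂ (X i) =
        e₁ (g i) * (e₁ (X i) - e₂ (X i)) + (e₁ (g i) - e₂ (g i)) * e₂ (X i) := by ring
      rw [this]
      refine (IsUltrametricDist.norm_add_le_max _ _).trans (max_le ?_ ?_)
      · rw [norm_mul]
        exact le_max_of_le_left ((mul_le_of_le_one_left (norm_nonneg _)
          (PadicInt.norm_le_one _)).trans (h i))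
      · rw [norm_mul]
        refine (mul_le_mul (ih (g i)) (h2' i) (norm_nonneg _) (le_max_of_le_left hr)).trans ?_
        rw [max_mul_of_nonneg _ _ (by positivity), ← pow_succ]
        exact max_le_max_right _ (mul_le_of_le_one_right hr hp1.le)
  have lim : Filter.Tendsto (fun k : ℕ => max r ((p : ℝ)⁻¹ ^ k)) Filter.atTop (nhds (max r 0)) :=
    tendsto_const_nhds.max (tendsto_pow_atTop_nhds_zero_of_lt_one (by positivity) hp1)
  rw [max_eq_left hr] at lim
  exact ge_of_tendsto' lim fun k => key k F

theorem evalHom_ext {e₁ e₂ : MvPowerSeries σ ℤ_[p] →ₐ[ℤ_[p]] ℤ_[p]}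
    (h : ∀ i, e₁ (X i) = e₂ (X i)) (h2 : ∀ i, ‖e₂ (X i)‖ < 1) : e₁ = e₂ := by
  ext F
  refine sub_eq_zero.1 (norm_le_zero_iff.1 (norm_evalHom_sub_le e₁ e₂ le_rfl ?_ h2 F))
  intro i
  simp [h i]

open Classical in
/-- Evaluation at a point of the open unit polydisc (and at the origin outside of it). -/
noncomputable def evh (x : σ → ℚ_[p]) : MvPowerSeries σ ℤ_[p] →ₐ[ℤ_[p]] ℤ_[p] :=
  if h : ∀ i, ‖x i‖ < 1 then
    (exists_evalHom (fun i => (⟨x i, (h i).le⟩ : ℤ_[p])) h).choose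
  else (exists_evalHom (0 : σ → ℤ_[p]) (by simp)).choose

/-- The value of a power series at a point. -/
noncomputable def ev (F : MvPowerSeries σ ℤ_[p]) (x : σ → ℚ_[p]) : ℚ_[p] := (evh x F : ℤ_[p])

variable {x y : σ → ℚ_[p]} (F G : MvPowerSeries σ ℤ_[p])

theorem evh_X (hx : ∀ i, ‖x i‖ < 1) (i : σ) : ((evh x (X i) : ℤ_[p]) : ℚ_[p]) = x i := by
  rw [evh, dif_pos hx, (exists_evalHom (fun i => (⟨x i, (hx i).le⟩ : ℤ_[p])) hx).choose_spec i]

theorem norm_evh_X_lt (hx : ∀ i, ‖x i‖ < 1) (i : σ) : ‖evh x (X i : MvPowerSeries σ ℤ_[p])‖ < 1 := by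
  rw [PadicInt.norm_def, evh_X hx]; exact hx i

theorem ev_X (hx : ∀ i, ‖x i‖ < 1) (i : σ) : ev (X i) x = x i := evh_X hx i

@[simp] theorem ev_mul : ev (F * G) x = ev F x * ev G x := by simp [ev]
@[simp] theorem ev_add : ev (F + G) x = ev F x + ev G x := by simp [ev]
@[simp] theorem ev_one : ev (1 : MvPowerSeries σ ℤ_[p]) x = 1 := by simp [ev]
@[simp] theorem ev_pow (k : ℕ) : ev (F ^ k) x = ev F x ^ k := by simp [ev]
@[simp] theorem ev_C (c : ℤ_[p]) : ev (C c : MvPowerSeries σ ℤ_[p]) x = c :=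
  congrArg _ ((evh x).commutes c)
theorem ev_prod {ι : Type*} (s : Finset ι) (f : ι → MvPowerSeries σ ℤ_[p]) :
    ev (∏ i ∈ s, f i) x = ∏ i ∈ s, ev (f i) x := by
  classical
  induction s using Finset.induction_on with
  | empty => simp
  | insert a s ha ih => rw [Finset.prod_insert ha, Finset.prod_insert ha, ev_mul, ih]

theorem evh_eq (hx : ∀ i, ‖x i‖ < 1) {e : MvPowerSeries σ ℤ_[p] →ₐ[ℤ_[p]] ℤ_[p]}
    (h : ∀ i, ((e (X i) : ℤ_[p]) : ℚ_[p]) = x i) : evh x = e := by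
  refine (evalHom_ext (fun i => ?_) fun i => norm_evh_X_lt hx i).symm
  exact Subtype.ext ((h i).trans (evh_X hx i).symm)

theorem norm_ev_sub_le (hx : ∀ i, ‖x i‖ < 1) (hy : ∀ i, ‖y i‖ < 1) {r : ℝ} (hr : 0 ≤ r)
    (h : ∀ i, ‖x i - y i‖ ≤ r) : ‖ev F x - ev F y‖ ≤ r := by
  have := norm_evalHom_sub_le (evh x) (evh y) hr (fun i => ?_) (norm_evh_X_lt hy) F
  · rwa [PadicInt.norm_def, PadicInt.coe_sub] at this
  · rw [PadicInt.norm_def, PadicInt.coe_sub, evh_X hx, evh_X hy]; exact h i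

theorem ev_zero : ev F (0 : σ → ℚ_[p]) = constantCoeff F := by
  have h : ∀ i, ‖(0 : σ → ℚ_[p]) i‖ < 1 := by simp
  obtain ⟨c, g, rfl⟩ := exists_sub_C_mem_span F
  have : evh (0 : σ → ℚ_[p]) (∑ i, g i * X i) = 0 := by
    rw [map_sum]
    refine Finset.sum_eq_zero fun i _ => ?_
    rw [map_mul, show evh (0 : σ → ℚ_[p]) (X i) = 0 from Subtype.ext (evh_X h i), mul_zero]
  rw [ev_add, ev_C, ev, this]
  simp

theorem norm_ev_sub_constantCoeff_le (hx : ∀ i, ‖x i‖ < 1) {r : ℝ} (hr : 0 ≤ r)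
    (h : ∀ i, ‖x i‖ ≤ r) : ‖ev F x - constantCoeff F‖ ≤ r := by
  rw [← ev_zero]
  exact norm_ev_sub_le F hx (by simp) hr (by simpa using h)

theorem continuous_ev : Continuous (ev F : (σ → ℚ_[p]) → ℚ_[p]) := by
  have hU : IsClopen {x : σ → ℚ_[p] | ∀ i, ‖x i‖ < 1} := by
    have : {x : σ → ℚ_[p] | ∀ i, ‖x i‖ < 1} = ⋂ i, (fun x => x i) ⁻¹' Metric.ball 0 1 := by
      ext; simp
    rw [this]
    exact isClopen_iInter_of_finite fun i =>
      (IsUltrametricDist.isClopen_ball _ _).preimage (continuous_apply i)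
  rw [continuous_iff_continuousAt]
  intro x
  by_cases hx : ∀ i, ‖x i‖ < 1
  · rw [Metric.continuousAt_iff']
    intro ε hε
    filter_upwards [hU.isOpen.mem_nhds hx, Metric.ball_mem_nhds x hε] with y hy hy2
    rw [dist_eq_norm]
    refine (norm_ev_sub_le F hy hx dist_nonneg fun i => ?_).trans_lt hy2
    rw [← dist_eq_norm]
    exact dist_le_pi_dist y x i
  · refine ContinuousAt.congr (continuousAt_const (y := ev F x)) ?_
    filter_upwards [hU.compl.isOpen.mem_nhds hx] with y hy
    have hy' : ¬ ∀ i, ‖y i‖ < 1 := hy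
    have : evh x = evh y := by rw [evh, evh, dif_neg hx, dif_neg hy']
    rw [ev, ev, this]

theorem norm_ev_le (τ : MvPowerSeries σ ℤ_[p]) (h : constantCoeff τ = 0)
    (hx : ∀ i, ‖x i‖ < 1) {r : ℝ} (hr : 0 ≤ r) (h' : ∀ i, ‖x i‖ ≤ r) : ‖ev τ x‖ ≤ r := by
  have := norm_ev_sub_constantCoeff_le τ hx hr h'
  simpa [h] using this

theorem norm_ev_lt_one {τ : MvPowerSeries σ ℤ_[p]} (h : constantCoeff τ = 0)
    (hx : ∀ i, ‖x i‖ < 1) : ‖ev τ x‖ < 1 := by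
  by_cases hne : Nonempty σ
  · obtain ⟨j, -, hj⟩ := Finset.exists_max_image Finset.univ (fun i => ‖x i‖) Finset.univ_nonempty
    exact (norm_ev_le τ h hx (norm_nonneg (x j))
      fun i => hj i (Finset.mem_univ i)).trans_lt (hx j)
  · exact (norm_ev_le τ h hx le_rfl
      fun i => (hne ⟨i⟩).elim).trans_lt one_pos

theorem ev_sub (i : σ) {τ : MvPowerSeries σ ℤ_[p]} (h : constantCoeff τ = 0)
    (hx : ∀ i, ‖x i‖ < 1) : ev (sub i τ F) x = ev F (Function.update x i (ev τ x)) := by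
  have hy : ∀ k, ‖Function.update x i (ev τ x) k‖ < 1 := by
    intro k
    by_cases hk : k = i
    · subst hk; simpa using norm_ev_lt_one h hx
    · simpa [hk] using hx k
  have := evh_eq hy (e := (evh x).comp (sub i τ)) fun k => ?_
  · rw [ev, ev, this]; rfl
  · by_cases hk : k = i
    · subst hk; simp [sub_X_self h, ev]
    · simp [hk, sub_X_of_ne hk, evh_X hx]

theorem ev_coe (P : MvPolynomial σ ℤ_[p]) (hx : ∀ i, ‖x i‖ < 1) :
    ev (P : MvPowerSeries σ ℤ_[p]) x = MvPolynomial.aeval x P := by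
  induction P using MvPolynomial.induction_on with
  | C a => simp
  | add P Q hP hQ => simp [hP, hQ]
  | mul_X P i hP => simp [hP, ev_X hx]

theorem constantCoeff_dvd_norm {u : MvPowerSeries σ ℤ_[p]} (hu : constantCoeff u ≠ 0)
    (hx : ∀ i, ‖x i‖ < 1) (h : ∀ i, ‖x i‖ ≤ ‖constantCoeff u‖ / 2) :
    ‖ev u x‖ = ‖constantCoeff u‖ := by
  have h0 : 0 < ‖constantCoeff u‖ := norm_pos_iff.2 hu
  have := norm_ev_sub_constantCoeff_le u hx (by positivity) h
  rw [PadicInt.norm_def] at *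
  have h2 := IsUltrametricDist.norm_eq_of_add_norm_lt_max (x := ev u x)
    (y := -((constantCoeff u : ℤ_[p]) : ℚ_[p])) (by
      rw [← sub_eq_add_neg, norm_neg]; exact lt_max_of_lt_right (by linarith))
  rwa [norm_neg] at h2

end Evaluation
end PadicZeta

namespace PadicZeta
open MeasureTheory Measure
open scoped Pointwise ENNReal NNReal

section Haar

variable {p : ℕ} [Fact p.Prime] [MeasurableSpace ℚ_[p]] [BorelSpace ℚ_[p]]

theorem distribHaarChar_units_padic (g : ℚ_[p]ˣ) : distribHaarChar ℚ_[p] g = ‖(g : ℚ_[p])‖₊ := by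
  have hp : p.Prime := Fact.out
  set B : Set ℚ_[p] := Metric.closedBall 0 1 with hB
  have mB : ∀ x : ℚ_[p], x ∈ B ↔ ‖x‖ ≤ 1 := fun x => by simp [hB]
  have hB0 : addHaar B ≠ 0 := (Metric.measure_closedBall_pos _ _ one_pos).ne'
  have hBt : addHaar B ≠ ∞ := (isCompact_closedBall _ _).measure_lt_top.ne
  have unit : ∀ u : ℚ_[p]ˣ, ‖(u : ℚ_[p])‖ = 1 → distribHaarChar ℚ_[p] u = 1 := by
    intro u hu
    refine distribHaarChar_eq_of_measure_smul_eq_mul (μ := addHaar) hB0 hBt ?_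
    have : u • B = B := by
      ext x
      rw [Set.mem_smul_set_iff_inv_smul_mem, mB, mB, Units.smul_def, smul_eq_mul, norm_mul]
      simp [hu]
    simp [this]
  set pu : ℚ_[p]ˣ := Units.mk0 (p : ℚ_[p]) (by exact_mod_cast hp.ne_zero) with hpu
  have mpB : ∀ x : ℚ_[p], x ∈ pu • B ↔ ‖x‖ < 1 := by
    intro x
    have h1 := Padic.norm_le_pow_iff_norm_lt_pow_add_one x (-1)
    rw [Set.mem_smul_set_iff_inv_smul_mem, mB, Units.smul_def, smul_eq_mul, norm_mul]
    have hp0 : (0 : ℝ) < p := by exact_mod_cast hp.pos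
    simp only [neg_add_cancel, zpow_zero, zpow_neg, zpow_one] at h1
    rw [← h1, Units.val_inv_eq_inv_val, norm_inv, hpu, Units.val_mk0, Padic.norm_p, inv_inv,
      ← le_inv_mul_iff₀ hp0, mul_one]
  have prime : distribHaarChar ℚ_[p] pu = (p : ℝ≥0)⁻¹ := by
    refine distribHaarChar_eq_of_measure_smul_eq_mul (μ := addHaar) hB0 hBt ?_
    have hdec : B = ⋃ j ∈ Finset.range p, ((j : ℚ_[p]) +ᵥ (pu • B)) := by
      ext x
      simp only [Set.mem_iUnion, Finset.mem_range, Set.mem_vadd_set_iff_neg_vadd_mem, mpB, vadd_eq_add,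
        exists_prop, mB]
      constructor
      · intro hx
        obtain ⟨z, rfl⟩ : ∃ z : ℤ_[p], (z : ℚ_[p]) = x := ⟨⟨x, hx⟩, rfl⟩
        obtain ⟨j, hj, h⟩ := PadicInt.exists_mem_range z
        refine ⟨j, hj, ?_⟩
        rw [PadicInt.maximalIdeal_eq_span_p, Ideal.mem_span_singleton,
          ← PadicInt.norm_lt_one_iff_dvd, PadicInt.norm_def] at h
        rw [neg_add_eq_sub]
        rwa [PadicInt.coe_sub, PadicInt.coe_natCast] at h
      · rintro ⟨j, -, h⟩
        have h2 : ‖(j : ℚ_[p])‖ ≤ 1 := by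
          have := PadicInt.norm_le_one (j : ℤ_[p])
          rwa [PadicInt.norm_def, PadicInt.coe_natCast] at this
        have := IsUltrametricDist.norm_add_le_max (-(j : ℚ_[p]) + x) j
        rw [neg_add_cancel_comm] at this
        exact this.trans (max_le h.le h2)
    have hmeas : MeasurableSet (pu • B) := (Metric.isClosed_closedBall.measurableSet).const_smul pu
    have hm : addHaar B = p * addHaar (pu • B) := by
      conv_lhs => rw [hdec]
      rw [measure_biUnion_finset]
      · simp [measure_vadd]
      · intro i hi j hj hij
        refine Set.disjoint_left.2 fun x hx hy => hij ?_
        rw [Set.mem_vadd_set_iff_neg_vadd_mem, mpB, vadd_eq_add] at hx hy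
        have h := IsUltrametricDist.norm_add_le_max (-(i : ℚ_[p]) + x) (-(-(j : ℚ_[p]) + x))
        rw [← sub_eq_add_neg, add_sub_add_right_eq_sub, norm_neg] at h
        have h2 : ‖(((j : ℤ) - i : ℤ) : ℚ_[p])‖ < 1 := by
          push_cast
          rw [show (j : ℚ_[p]) - i = - (i : ℚ_[p]) - - j by ring]
          exact h.trans_lt (max_lt hx hy)
        rw [Padic.norm_intCast_lt_one_iff] at h2
        have hi' := Finset.mem_range.1 (Finset.mem_coe.1 hi)
        have hj' := Finset.mem_range.1 (Finset.mem_coe.1 hj)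
        have := Int.eq_zero_of_abs_lt_dvd h2 (by rw [abs_lt]; omega)
        omega
      · intro i _
        exact hmeas.const_vadd _
    rw [hm, ← mul_assoc]
    have : ((((p : ℝ≥0)⁻¹ : ℝ≥0)) : ℝ≥0∞) * p = 1 := by
      have h0 : (p : ℝ≥0) ≠ 0 := by exact_mod_cast hp.ne_zero
      rw [← ENNReal.coe_natCast, ← ENNReal.coe_mul, inv_mul_cancel₀ h0, ENNReal.coe_one]
    rw [this, one_mul]
  set k := (g : ℚ_[p]).valuation with hk
  have hg : ‖(g : ℚ_[p])‖ = (p : ℝ) ^ (-k) := Padic.norm_eq_zpow_neg_valuation g.ne_zero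
  have h1 := unit (g * pu ^ (-k)) (by
    rw [Units.val_mul, norm_mul, hg, Units.val_zpow_eq_zpow_val, norm_zpow, hpu, Units.val_mk0,
      Padic.norm_p]
    have : (p : ℝ) ≠ 0 := by exact_mod_cast hp.ne_zero
    rw [inv_zpow, ← mul_inv_cancel₀ (zpow_ne_zero (-k) this)])
  have h2 : g = (g * pu ^ (-k)) * pu ^ k := by simp
  rw [h2, map_mul, h1, one_mul, map_zpow, prime, ← h2]
  apply NNReal.coe_injective
  rw [coe_nnnorm, hg]
  simp

theorem lintegral_comp_affine (lam : Measure ℚ_[p]) [lam.IsAddHaarMeasure] {a : ℚ_[p]} (ha : a ≠ 0)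
    (b : ℚ_[p]) {h : ℚ_[p] → ℝ≥0∞} (hh : Measurable h) :
    (∫⁻ t, h (a * t + b) ∂lam) * ‖a‖ₑ = ∫⁻ t, h t ∂lam := by
  have hmap : map (fun t => a * t) lam = ‖a‖ₑ⁻¹ • lam := by
    ext s hs
    rw [map_apply (measurable_const_mul a) hs, Measure.smul_apply, smul_eq_mul]
    have h := distribHaarChar_mul lam (Units.mk0 a ha)⁻¹ s
    have h2 : (Units.mk0 a ha)⁻¹ • s = (fun t => a * t) ⁻¹' s := by
      ext x; rw [Set.mem_smul_set_iff_inv_smul_mem, inv_inv]; rfl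
    rw [h2, distribHaarChar_units_padic] at h
    rw [← h]
    congr 1
    rw [Units.val_inv_eq_inv_val, Units.val_mk0, nnnorm_inv,
      ENNReal.coe_inv (by simpa using ha)]
    rfl
  have h1 : ∫⁻ t, h (a * t + b) ∂lam = ∫⁻ t, h (t + b) ∂(map (fun t => a * t) lam) :=
    (lintegral_map (f := fun t => h (t + b)) (hh.comp (measurable_add_const b))
      (measurable_const_mul a)).symm
  have h0 : ‖a‖ₑ ≠ 0 := by simpa using ha
  rw [h1, hmap, lintegral_smul_measure, lintegral_add_right_eq_self, smul_eq_mul, mul_comm,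
    ← mul_assoc, ENNReal.mul_inv_cancel h0 enorm_ne_top, one_mul]

theorem measure_closedBall_zpow (lam : Measure ℚ_[p]) [lam.IsAddHaarMeasure] (c : ℚ_[p]) (k : ℤ) :
    lam (Metric.closedBall c ((p : ℝ) ^ (-k))) =
      ENNReal.ofReal ((p : ℝ) ^ (-k)) * lam (Metric.closedBall 0 1) := by
  have hp : p.Prime := Fact.out
  have hp0 : (p : ℚ_[p]) ≠ 0 := by exact_mod_cast hp.ne_zero
  have hn : ‖(p : ℚ_[p]) ^ k‖ = (p : ℝ) ^ (-k) := by simp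
  have h := lintegral_comp_affine lam (a := (p : ℚ_[p]) ^ k) (zpow_ne_zero _ hp0) c
    (h := (Metric.closedBall c ((p : ℝ) ^ (-k))).indicator 1)
    (measurable_one.indicator Metric.isClosed_closedBall.measurableSet)
  rw [lintegral_indicator_one Metric.isClosed_closedBall.measurableSet] at h
  rw [← h, ← ofReal_norm, hn, mul_comm]
  congr 1
  rw [← lintegral_indicator_one Metric.isClosed_closedBall.measurableSet]
  congr 1
  ext t
  have : (p : ℚ_[p]) ^ k * t + c ∈ Metric.closedBall c ((p : ℝ) ^ (-k)) ↔
      t ∈ Metric.closedBall (0 : ℚ_[p]) 1 := by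
    rw [Metric.mem_closedBall, dist_eq_norm, add_sub_cancel_right, norm_mul, hn,
      mem_closedBall_zero_iff]
    have : (0 : ℝ) < (p : ℝ) ^ (-k) := by
      have : (0 : ℝ) < p := by exact_mod_cast hp.pos
      positivity
    exact mul_le_iff_le_one_right this
  by_cases h : t ∈ Metric.closedBall (0 : ℚ_[p]) 1
  · rw [Set.indicator_of_mem h, Set.indicator_of_mem (this.2 h)]; rfl
  · rw [Set.indicator_of_notMem h, Set.indicator_of_notMem (mt this.1 h)]

variable {σ : Type*} [Fintype σ] [DecidableEq σ] (lam : Measure ℚ_[p]) [lam.IsAddHaarMeasure]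

/-- The change of variables formula for a substitution affine in one coordinate. -/
theorem lintegral_comp_update_affine (i : σ) {A C : (σ → ℚ_[p]) → ℚ_[p]} (hA : Measurable A)
    (hC : Measurable C) (hAi : ∀ y t, A (Function.update y i t) = A y)
    (hCi : ∀ y t, C (Function.update y i t) = C y) {h : (σ → ℚ_[p]) → ℝ≥0∞} (hh : Measurable h) :
    ∫⁻ y, h (Function.update y i (A y * y i + C y)) * ‖A y‖ₑ ∂(Measure.pi fun _ : σ => lam) =
      ∫⁻ y in {y | A y ≠ 0}, h y ∂(Measure.pi fun _ : σ => lam) := by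
  have hs : MeasurableSet {y | A y ≠ 0} := hA (measurableSet_singleton 0).compl
  rw [← lintegral_indicator hs]
  have hupd : Measurable fun y : σ → ℚ_[p] => Function.update y i (A y * y i + C y) := by
    rw [measurable_pi_iff]
    intro j
    by_cases hj : j = i
    · subst hj; simp only [Function.update_self]; exact (hA.mul (measurable_pi_apply _)).add hC
    · simpa [hj] using measurable_pi_apply j
  refine lintegral_eq_of_lmarginal_eq (μ := fun _ : σ => lam) {i} ((hh.comp hupd).mul hA.enorm) (hh.indicator hs) ?_
  rw [lmarginal_singleton, lmarginal_singleton]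
  ext x
  simp only [hAi, hCi, Function.update_self, Function.update_idem]
  by_cases hx : A x = 0
  · have : ∀ t, ({y | A y ≠ 0}.indicator h (Function.update x i t)) = 0 := fun t =>
      Set.indicator_of_notMem (by simp [hAi, hx]) _
    simp [hx, this]
  · have : ∀ t, ({y | A y ≠ 0}.indicator h (Function.update x i t)) = h (Function.update x i t) :=
      fun t => Set.indicator_of_mem (by simp [hAi, hx]) _
    simp only [this]
    have hm : Measurable fun t => h (Function.update x i t) := hh.comp (measurable_update x)
    rw [← lintegral_comp_affine lam hx (C x) hm, lintegral_mul_const]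
    exact hm.comp ((measurable_const_mul _).add_const _)

end Haar
end PadicZeta

namespace PadicZeta
open MeasureTheory Measure
open scoped ENNReal NNReal

section Rational

/-- The factor `1 - p ^ (-v - N s)` attached to a pair `(N, v)`. -/
noncomputable def fac (p : ℕ) (q : ℤ × ℕ) (s : ℂ) : ℂ :=
  1 - (p : ℂ) ^ (-(q.2 : ℂ) - (q.1 : ℂ) * s)

/-- Finite sums of terms `c * p ^ (m s) / ∏ (1 - p ^ (-v - N s))` with at most `n` factors. -/
inductive IsRat (p n : ℕ) : (ℂ → ℂ) → Prop
  | zero : IsRat p n fun _ => 0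
  | add {R R' : ℂ → ℂ} (h : IsRat p n R) (h' : IsRat p n R') : IsRat p n fun s => R s + R' s
  | term (c : ℂ) (m : ℤ) (L : List (ℤ × ℕ)) (hL : L.length ≤ n)
      (h : ∀ q ∈ L, q.1 ≠ 0 ∧ 0 < q.2) :
      IsRat p n fun s => c * (p : ℂ) ^ ((m : ℂ) * s) * (L.map fun q => (fac p q s)⁻¹).prod

variable {p n n' : ℕ} {R R' : ℂ → ℂ}

theorem IsRat.const (c : ℂ) : IsRat p n fun _ => c := by
  simpa using IsRat.term (p := p) (n := n) c 0 [] (by simp) (by simp)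

theorem IsRat.mul [Fact p.Prime] (h : IsRat p n R) (h' : IsRat p n' R') :
    IsRat p (n + n') fun s => R s * R' s := by
  have hp : (p : ℂ) ≠ 0 := by exact_mod_cast (Fact.out : p.Prime).ne_zero
  induction h with
  | zero => simpa using IsRat.zero
  | add h₁ h₂ ih₁ ih₂ => simpa only [add_mul] using ih₁.add ih₂
  | term c m L hL hq =>
    induction h' with
    | zero => simpa using IsRat.zero
    | add h₁ h₂ ih₁ ih₂ => simpa only [mul_add] using ih₁.add ih₂
    | term c' m' L' hL' hq' =>
      convert IsRat.term (p := p) (n := n + n') (c * c') (m + m') (L ++ L')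
        (by rw [List.length_append]; omega) (fun q hq₀ => (List.mem_append.1 hq₀).elim (hq q) (hq' q)) using 2 with s
      rw [List.map_append, List.prod_append, Int.cast_add, add_mul, Complex.cpow_add _ _ hp]
      ring

theorem IsRat.prod [Fact p.Prime] {ι : Type*} (t : Finset ι) {R : ι → ℂ → ℂ}
    (h : ∀ i ∈ t, IsRat p 1 (R i)) : IsRat p t.card fun s => ∏ i ∈ t, R i s := by
  classical
  induction t using Finset.induction_on with
  | empty => simpa using IsRat.const 1
  | insert a t ha ih =>
    simp only [Finset.prod_insert ha, Finset.card_insert_of_notMem ha]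
    rw [add_comm]
    exact (h a (Finset.mem_insert_self a t)).mul (ih fun i hi => h i (Finset.mem_insert_of_mem hi))

theorem IsRat.const_mul [Fact p.Prime] (h : IsRat p n R) (c : ℂ) : IsRat p n fun s => c * R s := by
  simpa using (IsRat.const (p := p) (n := 0) c).mul h

end Rational

section AbsPow

/-- The power `r ^ s`, set to `0` for `r = 0`. -/
noncomputable def absPow (r : ℝ) (s : ℂ) : ℂ := if r = 0 then 0 else (r : ℂ) ^ s

theorem absPow_mul {x y : ℝ} (hx : 0 ≤ x) (hy : 0 ≤ y) (s : ℂ) :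
    absPow (x * y) s = absPow x s * absPow y s := by
  unfold absPow
  by_cases h : x = 0
  · simp [h]
  by_cases h' : y = 0
  · simp [h']
  rw [if_neg h, if_neg h', if_neg (mul_ne_zero h h'), Complex.ofReal_mul,
    Complex.mul_cpow_ofReal_nonneg hx hy]

theorem measurable_absPow (s : ℂ) : Measurable fun r : ℝ => absPow r s := by
  unfold absPow
  exact Measurable.ite (measurableSet_singleton 0) measurable_const
    (Complex.measurable_ofReal.pow_const s)

end AbsPow

section ZetaType

variable {p n : ℕ} {Ω Ω' : Type*} [MeasurableSpace Ω] [MeasurableSpace Ω']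

/-- The integrals of the family `F s` converge near the imaginary axis to a rational function. -/
def IsZ (p n : ℕ) (ν : Measure Ω) (F : ℂ → Ω → ℂ) : Prop :=
  ∃ R, IsRat p n R ∧ ∃ ε > 0, ∀ s : ℂ, |s.re| < ε → Integrable (F s) ν ∧ ∫ x, F s x ∂ν = R s

variable {ν ν' : Measure Ω} {F F' : ℂ → Ω → ℂ}

theorem isZ_zero : IsZ p n (0 : Measure Ω) F :=
  ⟨_, IsRat.zero, 1, one_pos, fun _ _ => by simp⟩

theorem IsZ.add (h : IsZ p n ν F) (h' : IsZ p n ν' F) : IsZ p n (ν + ν') F := by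
  obtain ⟨R, hR, ε, hε, H⟩ := h
  obtain ⟨R', hR', ε', hε', H'⟩ := h'
  refine ⟨_, hR.add hR', min ε ε', lt_min hε hε', fun s hs => ?_⟩
  obtain ⟨a, b⟩ := H s (hs.trans_le (min_le_left _ _))
  obtain ⟨a', b'⟩ := H' s (hs.trans_le (min_le_right _ _))
  exact ⟨a.add_measure a', by rw [integral_add_measure a a', b, b']⟩

theorem IsZ.congr (h : IsZ p n ν F) (hF : ∀ s, F s =ᵐ[ν] F' s) : IsZ p n ν F' := by
  obtain ⟨R, hR, ε, hε, H⟩ := h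
  refine ⟨R, hR, ε, hε, fun s hs => ⟨(H s hs).1.congr (hF s), ?_⟩⟩
  rw [← integral_congr_ae (hF s), (H s hs).2]

theorem IsZ.mul_rat [Fact p.Prime] (h : IsZ p n ν F) {R : ℂ → ℂ} (hR : IsRat p 0 R) :
    IsZ p n ν fun s x => R s * F s x := by
  obtain ⟨R', hR', ε, hε, H⟩ := h
  refine ⟨_, by simpa using hR.mul hR', ε, hε, fun s hs => ⟨(H s hs).1.const_mul _, ?_⟩⟩
  rw [integral_const_mul, (H s hs).2]

theorem IsZ.map {T : Ω → Ω'} (hT : Measurable T) {F : ℂ → Ω' → ℂ} (hF : ∀ s, Measurable (F s))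
    (h : IsZ p n ν fun s x => F s (T x)) : IsZ p n (ν.map T) F := by
  obtain ⟨R, hR, ε, hε, H⟩ := h
  refine ⟨R, hR, ε, hε, fun s hs => ⟨?_, ?_⟩⟩
  · exact (integrable_map_measure (hF s).aestronglyMeasurable hT.aemeasurable).2 (H s hs).1
  · rw [integral_map hT.aemeasurable (hF s).aestronglyMeasurable, (H s hs).2]

theorem IsZ.withDensity {w : Ω → ℝ≥0} (hw : Measurable w)
    (h : IsZ p n ν fun s x => (w x : ℂ) * F s x) :
    IsZ p n (ν.withDensity fun x => (w x : ℝ≥0∞)) F := by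
  obtain ⟨R, hR, ε, hε, H⟩ := h
  have hsm : ∀ s, (fun x => w x • F s x) = fun x => (w x : ℂ) * F s x := by
    intro s; ext x; rw [NNReal.smul_def, Complex.real_smul]
  refine ⟨R, hR, ε, hε, fun s hs => ⟨?_, ?_⟩⟩
  · rw [integrable_withDensity_iff_integrable_smul hw, hsm]; exact (H s hs).1
  · rw [integral_withDensity_eq_integral_smul hw, ← (H s hs).2]
    exact congrArg (fun f => ∫ x, f x ∂ν) (hsm s)

theorem IsZ.restrict_union {A B : Set Ω} (hAB : Disjoint A B) (hB : MeasurableSet B)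
    (hA : IsZ p n (ν.restrict A) F) (h : IsZ p n (ν.restrict B) F) :
    IsZ p n (ν.restrict (A ∪ B)) F := by
  rw [Measure.restrict_union hAB hB]; exact hA.add h

theorem IsZ.pi [Fact p.Prime] {σ : Type*} [Fintype σ] {ν : σ → Measure Ω} [∀ i, SigmaFinite (ν i)]
    {F : σ → ℂ → Ω → ℂ} (h : ∀ i, IsZ p 1 (ν i) (F i)) :
    IsZ p (Fintype.card σ) (Measure.pi ν) fun s x => ∏ i, F i s (x i) := by
  choose R hR ε hε H using h
  obtain ⟨δ, hδ, hδε⟩ : ∃ δ > 0, ∀ i, δ ≤ ε i := by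
    by_cases hne : Nonempty σ
    · obtain ⟨j, -, hj⟩ := Finset.exists_min_image Finset.univ ε Finset.univ_nonempty
      exact ⟨ε j, hε j, fun i => hj i (Finset.mem_univ i)⟩
    · exact ⟨1, one_pos, fun i => (hne ⟨i⟩).elim⟩
  refine ⟨_, IsRat.prod Finset.univ fun i _ => hR i, δ, hδ, fun s hs => ⟨?_, ?_⟩⟩
  · exact Integrable.fintype_prod fun i => (H i s (hs.trans_le (hδε i))).1
  · rw [integral_fintype_prod_eq_prod (f := fun i => F i s)]
    exact Finset.prod_congr rfl fun i _ => (H i s (hs.trans_le (hδε i))).2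

end ZetaType

section Clopen

/-- A property of clopen sets stable under disjoint unions and holding locally holds for compact
sets. -/
theorem clopen_induction {E : Type*} [TopologicalSpace E] {K : Set E} (hK : IsCompact K)
    (hK' : IsClopen K) {P : Set E → Prop} (h0 : P ∅)
    (hU : ∀ A B, IsClopen A → IsClopen B → Disjoint A B → P A → P B → P (A ∪ B))
    (hloc : ∀ x ∈ K, ∃ U, IsClopen U ∧ x ∈ U ∧ ∀ W ⊆ U, IsClopen W → P W) : P K := by
  have : ∃ W, IsClopen W ∧ K ⊆ W ∧ ∀ W' ⊆ W, IsClopen W' → P W' := by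
    refine hK.induction_on (p := fun s => ∃ W, IsClopen W ∧ s ⊆ W ∧ ∀ W' ⊆ W, IsClopen W' → P W')
      ⟨∅, isClopen_empty, subset_rfl, ?_⟩ ?_ ?_ ?_
    · intro W' h _
      rwa [Set.subset_eq_empty h rfl]
    · rintro s t hst ⟨W, h1, h2, h3⟩
      exact ⟨W, h1, hst.trans h2, h3⟩
    · rintro s t ⟨W, h1, h2, h3⟩ ⟨W', h1', h2', h3'⟩
      refine ⟨W ∪ W', h1.union h1', Set.union_subset_union h2 h2', fun W₀ h hc => ?_⟩
      rw [← Set.inter_union_sdiff W₀ W]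
      refine hU _ _ (hc.inter h1) (hc.diff h1) Set.disjoint_sdiff_inter.symm
        (h3 _ Set.inter_subset_right (hc.inter h1)) (h3' _ ?_ (hc.diff h1))
      exact fun x hx => (h hx.1).resolve_left hx.2
    · intro x hx
      obtain ⟨U, h1, h2, h3⟩ := hloc x hx
      exact ⟨U, mem_nhdsWithin_of_mem_nhds (h1.isOpen.mem_nhds h2), U, h1, subset_rfl, h3⟩
  obtain ⟨W, -, h, h'⟩ := this
  exact h' K h hK'

theorem ball_induction {E : Type*} [PseudoMetricSpace E] [IsUltrametricDist E] {K : Set E}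
    (hK : IsCompact K) (hK' : IsOpen K) {P : Set E → Prop} (h0 : P ∅)
    (hU : ∀ A B, IsClopen A → IsClopen B → Disjoint A B → P A → P B → P (A ∪ B))
    (hloc : ∀ x ∈ K, ∀ δ > 0, Metric.ball x δ ⊆ K → P (Metric.ball x δ)) : P K := by
  obtain ⟨δ, hδ, hδK⟩ := hK.exists_thickening_subset_open hK' subset_rfl
  have hsatK : ∀ x ∈ K, Metric.ball x δ ⊆ K := fun x hx y hy =>
    hδK (Metric.mem_thickening_iff.2 ⟨x, hx, hy⟩)
  let Sat : Set E → Prop := fun W => ∀ x ∈ W, Metric.ball x δ ⊆ W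
  have hSo : ∀ W, Sat W → IsOpen W := fun W h =>
    Metric.isOpen_iff.2 fun x hx => ⟨δ, hδ, h x hx⟩
  have hSd : ∀ W W', Sat W → Sat W' → Sat (W \ W') := fun W W' h h' x hx y hy =>
    ⟨h x hx.1 hy, fun hy' => hx.2 (h' y hy' (Metric.mem_ball_comm.1 hy))⟩
  have hSc : ∀ W, Sat W → IsClopen W := fun W h =>
    ⟨⟨by simpa [Set.compl_eq_univ_sdiff] using hSo _ (hSd Set.univ W (fun _ _ => Set.subset_univ _) h)⟩,
      hSo W h⟩
  have hSi : ∀ W W', Sat W → Sat W' → Sat (W ∩ W') := fun W W' h h' x hx =>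
    Set.subset_inter (h x hx.1) (h' x hx.2)
  have : ∃ W, Sat W ∧ K ⊆ W ∧ ∀ W' ⊆ W, W' ⊆ K → Sat W' → P W' := by
    refine hK.induction_on
      (p := fun s => ∃ W, Sat W ∧ s ⊆ W ∧ ∀ W' ⊆ W, W' ⊆ K → Sat W' → P W')
      ⟨∅, fun _ h => h.elim, subset_rfl, ?_⟩ ?_ ?_ ?_
    · intro W' h _ _
      rwa [Set.subset_eq_empty h rfl]
    · rintro s t hst ⟨W, h1, h2, h3⟩
      exact ⟨W, h1, hst.trans h2, h3⟩
    · rintro s t ⟨W, h1, h2, h3⟩ ⟨W', h1', h2', h3'⟩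
      refine ⟨W ∪ W', ?_, Set.union_subset_union h2 h2', fun W₀ h hk hc => ?_⟩
      · rintro x (hx | hx)
        · exact (h1 x hx).trans Set.subset_union_left
        · exact (h1' x hx).trans Set.subset_union_right
      · rw [← Set.inter_union_sdiff W₀ W]
        refine hU _ _ (hSc _ (hSi _ _ hc h1)) (hSc _ (hSd _ _ hc h1)) Set.disjoint_sdiff_inter.symm
          (h3 _ Set.inter_subset_right (Set.inter_subset_left.trans hk) (hSi _ _ hc h1))
          (h3' _ ?_ (Set.sdiff_subset.trans hk) (hSd _ _ hc h1))
        exact fun x hx => (h hx.1).resolve_left hx.2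
    · intro x hx
      refine ⟨Metric.ball x δ, mem_nhdsWithin_of_mem_nhds (Metric.ball_mem_nhds x hδ),
        Metric.ball x δ, fun y hy => ?_, subset_rfl, fun W' hW' hk hS => ?_⟩
      · rw [IsUltrametricDist.ball_eq_of_mem hy]
      · rcases W'.eq_empty_or_nonempty with rfl | ⟨y, hy⟩
        · exact h0
        · have : W' = Metric.ball x δ := by
            refine hW'.antisymm ?_
            rw [IsUltrametricDist.ball_eq_of_mem (hW' hy)]
            exact hS y hy
          rw [this] at hk ⊢
          exact hloc x hx δ hδ hk
  obtain ⟨W, -, h, h'⟩ := this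
  exact h' K h subset_rfl hsatK

end Clopen
end PadicZeta

namespace PadicZeta
open MeasureTheory Measure
open scoped ENNReal NNReal

section OneVariable

variable {p : ℕ} [Fact p.Prime]

theorem absPow_zpow (k : ℤ) (s : ℂ) : absPow ((p : ℝ) ^ k) s = (p : ℂ) ^ ((k : ℂ) * s) := by
  have hp : (0 : ℝ) < p := by exact_mod_cast (Fact.out : p.Prime).pos
  have hp' : (p : ℂ) ≠ 0 := by exact_mod_cast (Fact.out : p.Prime).ne_zero
  rw [absPow, if_neg (zpow_ne_zero _ hp.ne'),
    Complex.cpow_def_of_ne_zero (by exact_mod_cast zpow_ne_zero _ hp.ne'),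
    Complex.cpow_def_of_ne_zero hp', ← Complex.ofReal_log (by positivity), Real.log_zpow,
    Complex.ofReal_mul, Complex.ofReal_intCast, Complex.ofReal_log hp.le, Complex.ofReal_natCast]
  ring_nf

/-- The monomial integrand of one variable. -/
noncomputable def monoInt (a b c : ℕ) (s : ℂ) (t : ℚ_[p]) : ℂ :=
  (‖t‖ : ℂ) ^ c * absPow (‖t‖ ^ a / ‖t‖ ^ b) s

theorem monoInt_eq (a b c : ℕ) (s : ℂ) {t : ℚ_[p]} {k : ℤ} (ht : ‖t‖ = (p : ℝ) ^ k) :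
    monoInt a b c s t = (p : ℂ) ^ ((k * c : ℤ) : ℂ) * (p : ℂ) ^ (((k * (a - b) : ℤ) : ℂ) * s) := by
  have hp : (p : ℝ) ≠ 0 := by exact_mod_cast (Fact.out : p.Prime).ne_zero
  have h : ((p : ℝ) ^ k) ^ a / ((p : ℝ) ^ k) ^ b = (p : ℝ) ^ (k * (a - b)) := by
    rw [← zpow_natCast, ← zpow_natCast, ← zpow_mul, ← zpow_mul, ← zpow_sub₀ hp, mul_sub]
  rw [monoInt, ht, h, absPow_zpow, Complex.cpow_intCast, zpow_mul, zpow_natCast]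
  push_cast
  rfl

theorem exists_norm_eq_zpow {t : ℚ_[p]} (ht : t ≠ 0) : ∃ k : ℤ, ‖t‖ = (p : ℝ) ^ k :=
  ⟨_, Padic.norm_eq_zpow_neg_valuation ht⟩

variable [MeasurableSpace ℚ_[p]] [BorelSpace ℚ_[p]] (lam : Measure ℚ_[p]) [lam.IsAddHaarMeasure]

theorem measureReal_shell (j : ℤ) : lam.real {t | ‖t‖ = (p : ℝ) ^ (-j)} =
    (p : ℝ) ^ (-j) * ((1 - (p : ℝ)⁻¹) * lam.real (Metric.closedBall 0 1)) := by
  have hp : (1 : ℝ) < p := by exact_mod_cast (Fact.out : p.Prime).one_lt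
  have hset : {t : ℚ_[p] | ‖t‖ = (p : ℝ) ^ (-j)} =
      Metric.closedBall 0 ((p : ℝ) ^ (-j)) \ Metric.closedBall 0 ((p : ℝ) ^ (-(j + 1))) := by
    ext t
    have h1 := Padic.norm_le_pow_iff_norm_lt_pow_add_one t (-(j + 1))
    rw [show -(j + 1) + 1 = -j by ring] at h1
    simp only [Set.mem_ofPred_eq, Set.mem_sdiff, mem_closedBall_zero_iff, h1, not_lt]
    exact ⟨fun h => ⟨h.le, h.ge⟩, fun h => h.1.antisymm h.2⟩
  have hr : ∀ k : ℤ, lam.real (Metric.closedBall 0 ((p : ℝ) ^ (-k))) =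
      (p : ℝ) ^ (-k) * lam.real (Metric.closedBall 0 1) := by
    intro k
    rw [measureReal_def, measure_closedBall_zpow, ENNReal.toReal_mul,
      ENNReal.toReal_ofReal (by positivity)]
    rfl
  rw [hset, measureReal_sdiff (Metric.closedBall_subset_closedBall
    (zpow_le_zpow_right₀ hp.le (by omega))) Metric.isClosed_closedBall.measurableSet
    (isCompact_closedBall _ _).measure_lt_top.ne, hr, hr,
    show -(j + 1) = -j + -1 by ring, zpow_add₀ (by positivity), zpow_neg_one]
  ring

theorem isZ_ball (x : ℚ_[p]) {δ : ℝ} (hδ : 0 < δ) (a b c : ℕ) :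
    IsZ p 1 (lam.restrict (Metric.ball x δ)) (monoInt a b c) := by
  have hp1 : (1 : ℝ) < p := by exact_mod_cast (Fact.out : p.Prime).one_lt
  have hp0 : 0 < p := (Fact.out : p.Prime).pos
  have hpC : (p : ℂ) ≠ 0 := by exact_mod_cast hp0.ne'
  by_cases h0 : (0 : ℚ_[p]) ∈ Metric.ball x δ
  · rw [IsUltrametricDist.ball_eq_of_mem h0]
    obtain ⟨m, hm1, hm2⟩ := exists_mem_Ioc_zpow hδ hp1
    set S : ℕ → Set ℚ_[p] := fun k => {t | ‖t‖ = (p : ℝ) ^ (-(-m + k))} with hS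
    have hSm : ∀ k, MeasurableSet (S k) := fun k =>
      measurable_norm (measurableSet_singleton _)
    have hSd : Pairwise (Function.onFun Disjoint S) := by
      intro i j hij
      refine Set.disjoint_left.2 fun t hi hj => hij ?_
      have := zpow_right_injective₀ (by linarith) hp1.ne' ((Eq.symm hi).trans hj)
      omega
    have hball : Metric.ball (0 : ℚ_[p]) δ =ᵐ[lam] ⋃ k, S k := by
      have : Metric.ball (0 : ℚ_[p]) δ = (⋃ k, S k) ∪ {0} := by
        ext t
        rw [mem_ball_zero_iff, Set.mem_union, Set.mem_iUnion, Set.mem_singleton_iff]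
        constructor
        · intro ht
          by_cases h : t = 0
          · exact Or.inr h
          · obtain ⟨k, hk⟩ := exists_norm_eq_zpow h
            rw [hk] at ht
            have := (zpow_lt_zpow_iff_right₀ hp1).1 (ht.trans_le hm2)
            refine Or.inl ⟨(m - k).toNat, ?_⟩
            rw [hS, Set.mem_ofPred_eq, hk, Int.toNat_of_nonneg (by omega)]
            congr 1; ring
        · rintro (⟨k, hk⟩ | rfl)
          · rw [hS, Set.mem_ofPred_eq] at hk
            rw [hk]
            exact (zpow_le_zpow_right₀ hp1.le (by omega)).trans_lt hm1
          · simpa using hδ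
      rw [this]
      exact union_ae_eq_left_of_ae_eq_empty (ae_eq_empty.2 (measure_singleton 0))
    rw [Measure.restrict_congr_set hball]
    set κ : ℝ := (1 - (p : ℝ)⁻¹) * lam.real (Metric.closedBall 0 1) with hκ
    set N : ℤ := a - b with hN
    set z : ℂ → ℂ := fun s => (p : ℂ) ^ (-((c + 1 : ℕ) : ℂ) - (N : ℂ) * s) with hz
    set K : ℂ → ℕ → ℂ := fun s k => (p : ℂ) ^ ((-(-m + k) * c : ℤ) : ℂ) *
      (p : ℂ) ^ (((-(-m + k) * (a - b) : ℤ) : ℂ) * s) with hK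
    have hmono : ∀ s k, ∀ t ∈ S k, monoInt a b c s t = K s k := fun s k t ht =>
      monoInt_eq a b c s ht
    have hfin : ∀ k, lam (S k) ≠ ∞ := fun k =>
      ((measure_mono fun t ht => mem_closedBall_zero_iff.2 (le_of_eq ht)).trans_lt
        (isCompact_closedBall (0 : ℚ_[p]) ((p : ℝ) ^ (-(-m + k : ℤ)))).measure_lt_top).ne
    have hval : ∀ s k, lam.real (S k) • K s k = (κ : ℂ) * z s ^ (-m + k : ℤ) := by
      intro s k
      simp only [hS, hK, hz]
      rw [measureReal_shell, ← hκ, Complex.real_smul, Complex.ofReal_mul,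
        ← Complex.cpow_mul_int, Complex.ofReal_zpow, Complex.ofReal_natCast, ← Complex.cpow_intCast,
        ← Complex.cpow_add _ _ hpC, mul_right_comm, ← Complex.cpow_add _ _ hpC, mul_comm _ (κ : ℂ)]
      congr 2
      push_cast [hN]
      ring
    have hint : ∀ s k, IntegrableOn (monoInt a b c s) (S k) lam := fun s k =>
      (integrableOn_congr_fun (hmono s k) (hSm k)).2 (integrableOn_const (hfin k))
    have hval2 : ∀ s k, ∫ t in S k, monoInt a b c s t ∂lam = (κ : ℂ) * z s ^ (-m + k : ℤ) := by
      intro s k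
      rw [setIntegral_congr_fun (hSm k) (hmono s k), setIntegral_const, hval]
    have hval3 : ∀ s k, ∫ t in S k, ‖monoInt a b c s t‖ ∂lam =
        ‖(κ : ℂ) * z s ^ (-m + k : ℤ)‖ := by
      intro s k
      rw [setIntegral_congr_fun (g := fun _ => ‖K s k‖) (hSm k)
        (fun t ht => congrArg _ (hmono s k t ht)), setIntegral_const, ← hval, norm_smul,
        Real.norm_of_nonneg measureReal_nonneg, smul_eq_mul]
    have hznorm : ∀ s : ℂ, |s.re| < 1 / (|(N : ℝ)| + 1) → ‖z s‖ < 1 := by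
      intro s hs
      rw [hz, Complex.norm_natCast_cpow_of_pos hp0]
      refine Real.rpow_lt_one_of_one_lt_of_neg hp1 ?_
      have h1 : |(N : ℝ) * s.re| < 1 := by
        rw [abs_mul]
        have h2 : 0 ≤ |(N : ℝ)| := abs_nonneg _
        rw [lt_div_iff₀ (by linarith)] at hs
        nlinarith [abs_nonneg s.re]
      have h3 : (-((c + 1 : ℕ) : ℂ) - (N : ℂ) * s).re = -((c : ℝ) + 1) - N * s.re := by
        simp
      rw [h3]
      have := (abs_lt.1 h1).1
      have : (0 : ℝ) ≤ c := Nat.cast_nonneg c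
      linarith
    have hz0 : ∀ s, z s ≠ 0 := fun s => by simp [hz, hpC]
    have hmain : ∀ s : ℂ, |s.re| < 1 / (|(N : ℝ)| + 1) →
        IntegrableOn (monoInt a b c s) (⋃ k, S k) lam ∧
        ∫ t in ⋃ k, S k, monoInt a b c s t ∂lam = κ * z s ^ (-m) * (1 - z s)⁻¹ := by
      intro s hs
      have hg := (hasSum_geometric_of_norm_lt_one (hznorm s hs)).mul_left ((κ : ℂ) * z s ^ (-m))
      have hterm : ∀ k : ℕ, (κ : ℂ) * z s ^ (-m + k : ℤ) = (κ : ℂ) * z s ^ (-m) * z s ^ k := by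
        intro k
        rw [zpow_add₀ (hz0 s), zpow_natCast, mul_assoc]
      have hi : IntegrableOn (monoInt a b c s) (⋃ k, S k) lam := by
        refine integrableOn_iUnion_of_summable_integral_norm (hint s) ?_
        simp only [hval3, hterm]
        exact hg.summable.norm
      refine ⟨hi, ?_⟩
      have := hasSum_integral_iUnion hSm hSd hi
      simp only [hval2, hterm] at this
      exact this.unique hg
    have hzm : ∀ s, z s ^ (-m) = (p : ℂ) ^ ((((c + 1 : ℕ) : ℤ) * m : ℤ) : ℂ) *
        (p : ℂ) ^ (((N * m : ℤ) : ℂ) * s) := by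
      intro s
      rw [hz, ← Complex.cpow_mul_int, ← Complex.cpow_add _ _ hpC]
      congr 1
      push_cast
      ring
    have hε : 0 < 1 / (|(N : ℝ)| + 1) := by positivity
    by_cases hN0 : N = 0
    · refine ⟨_, IsRat.term (κ * (p : ℂ) ^ ((((c + 1 : ℕ) : ℤ) * m : ℤ) : ℂ) *
        (1 - (p : ℂ) ^ (-((c + 1 : ℕ) : ℂ)))⁻¹) (N * m) [] (by simp) (by simp), _, hε, fun s hs => ?_⟩
      refine ⟨(hmain s hs).1, ?_⟩
      rw [(hmain s hs).2, hzm]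
      simp only [hz, hN0]
      simp
    · refine ⟨_, IsRat.term (κ * (p : ℂ) ^ ((((c + 1 : ℕ) : ℤ) * m : ℤ) : ℂ)) (N * m) [(N, c + 1)]
        (by simp) (by simp [hN0]), _, hε, fun s hs => ?_⟩
      refine ⟨(hmain s hs).1, ?_⟩
      rw [(hmain s hs).2, hzm]
      simp only [List.map_cons, List.map_nil, List.prod_cons, List.prod_nil, mul_one, fac, hz]
      ring
  · have hx0 : x ≠ 0 := by
      rintro rfl
      exact h0 (Metric.mem_ball_self hδ)
    have hxδ : δ ≤ ‖x‖ := by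
      simpa [Metric.mem_ball, dist_comm] using h0
    obtain ⟨k, hk⟩ := exists_norm_eq_zpow hx0
    have hball : ∀ t ∈ Metric.ball x δ, ‖t‖ = (p : ℝ) ^ k := by
      intro t ht
      rw [← hk]
      have h2 := IsUltrametricDist.norm_eq_of_add_norm_lt_max (x := t) (y := -x) (by
        rw [← sub_eq_add_neg, norm_neg, ← dist_eq_norm]
        exact lt_max_of_lt_right (ht.trans_le hxδ))
      rwa [norm_neg] at h2
    have hfin : lam (Metric.ball x δ) ≠ ∞ := measure_ball_lt_top.ne
    refine ⟨_, IsRat.term ((lam.real (Metric.ball x δ) : ℂ) * (p : ℂ) ^ ((k * c : ℤ) : ℂ))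
      (k * (a - b)) [] (by simp) (by simp), 1, one_pos, fun s _ => ⟨?_, ?_⟩⟩
    · refine (integrableOn_congr_fun (fun t ht => monoInt_eq a b c s (hball t ht))
        Metric.isOpen_ball.measurableSet).2 (integrableOn_const hfin)
    · rw [setIntegral_congr_fun Metric.isOpen_ball.measurableSet
        (fun t ht => monoInt_eq a b c s (hball t ht)), setIntegral_const, Complex.real_smul]
      simp
      ring

end OneVariable
end PadicZeta

namespace PadicZeta
open MeasureTheory Measure MvPowerSeries
open scoped ENNReal NNReal

section Leaf

variable {p : ℕ} [Fact p.Prime] [MeasurableSpace ℚ_[p]] [BorelSpace ℚ_[p]]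
  {σ : Type*} [Fintype σ] [DecidableEq σ] (lam : Measure ℚ_[p]) [lam.IsAddHaarMeasure]

/-- Every zeta integral of divisors of `F` is of zeta type on small clopen sets. -/
def ZetaNear (F : MvPowerSeries σ ℤ_[p]) : Prop :=
  ∀ f g J : MvPowerSeries σ ℤ_[p], f ∣ F → g ∣ F → J ∣ F → ∃ r : ℝ, 0 < r ∧ r < 1 ∧
    ∀ B : Set (σ → ℚ_[p]), IsClopen B → (∀ x ∈ B, ∀ i, ‖x i‖ ≤ r) →
      IsZ p (Fintype.card σ)
        (((Measure.pi fun _ : σ => lam).restrict B).withDensity fun x => (‖ev J x‖₊ : ℝ≥0∞))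
        fun s x => absPow ‖ev f x / ev g x‖ s

theorem norm_ev_mono {x : σ → ℚ_[p]} (hx : ∀ i, ‖x i‖ < 1) (a : σ → ℕ)
    {u : MvPowerSeries σ ℤ_[p]} (hu : constantCoeff u ≠ 0)
    (h : ∀ i, ‖x i‖ ≤ ‖constantCoeff u‖ / 2) :
    ‖ev (mono ℤ_[p] a * u) x‖ = (∏ i, ‖x i‖ ^ a i) * ‖constantCoeff u‖ := by
  rw [ev_mul, norm_mul, constantCoeff_dvd_norm hu hx h, mono, ev_prod, norm_prod]
  congr 1
  refine Finset.prod_congr rfl fun i _ => ?_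
  rw [ev_pow, ev_X hx, norm_pow]

theorem isCompact_of_norm_le {B : Set (σ → ℚ_[p])} (hB : IsClosed B) {r : ℝ} (hr : 0 ≤ r)
    (h : ∀ x ∈ B, ∀ i, ‖x i‖ ≤ r) : IsCompact B := by
  refine (isCompact_closedBall (0 : σ → ℚ_[p]) r).of_isClosed_subset hB fun x hx => ?_
  rw [mem_closedBall_zero_iff, pi_norm_le_iff_of_nonneg hr]
  exact h x hx

theorem absPow_prod {ι : Type*} (t : Finset ι) (f : ι → ℝ) (hf : ∀ i, 0 ≤ f i) (s : ℂ) :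
    absPow (∏ i ∈ t, f i) s = ∏ i ∈ t, absPow (f i) s := by
  classical
  induction t using Finset.induction_on with
  | empty => simp [absPow]
  | insert a t ha ih =>
    rw [Finset.prod_insert ha, Finset.prod_insert ha,
      absPow_mul (hf a) (Finset.prod_nonneg fun i _ => hf i), ih]

theorem IsMon.zetaNear {F : MvPowerSeries σ ℤ_[p]} (hF : IsMon F) : ZetaNear lam F := by
  intro f g J hf hg hJ
  obtain ⟨a, uf, huf, rfl⟩ := hF.of_dvd hf
  obtain ⟨b, ug, hug, rfl⟩ := hF.of_dvd hg
  obtain ⟨c, uJ, huJ, rfl⟩ := hF.of_dvd hJ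
  have hf0 := norm_pos_iff.2 huf
  have hg0 := norm_pos_iff.2 hug
  have hJ0 := norm_pos_iff.2 huJ
  refine ⟨min (1 / 2) (min (‖constantCoeff uf‖ / 2) (min (‖constantCoeff ug‖ / 2)
    (‖constantCoeff uJ‖ / 2))), by positivity, (min_le_left _ _).trans_lt (by norm_num),
    fun B hB hBr => ?_⟩
  simp only [le_min_iff] at hBr
  have hB1 : ∀ x ∈ B, ∀ i, ‖x i‖ < 1 := fun x hx i => (hBr x hx i).1.trans_lt (by norm_num)
  refine IsZ.withDensity (continuous_ev _).measurable.nnnorm ?_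
  have hcst : IsRat p 0 fun s =>
      (‖constantCoeff uJ‖ : ℂ) * absPow (‖constantCoeff uf‖ / ‖constantCoeff ug‖) s := by
    obtain ⟨k, hk⟩ := exists_norm_eq_zpow (p := p) (t := (constantCoeff uf : ℤ_[p])) (by simpa using huf)
    obtain ⟨l, hl⟩ := exists_norm_eq_zpow (p := p) (t := (constantCoeff ug : ℤ_[p])) (by simpa using hug)
    rw [← PadicInt.norm_def] at hk hl
    have hp : (p : ℝ) ≠ 0 := by exact_mod_cast (Fact.out : p.Prime).ne_zero
    simp only [hk, hl, ← zpow_sub₀ hp, absPow_zpow]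
    simpa using IsRat.term (p := p) (n := 0) (‖constantCoeff uJ‖ : ℂ) (k - l) [] (by simp) (by simp)
  have main : IsZ p (Fintype.card σ) ((Measure.pi fun _ : σ => lam).restrict B)
      fun s x => ∏ i, monoInt (a i) (b i) (c i) s (x i) := by
    refine ball_induction
      (P := fun W => IsZ p (Fintype.card σ) ((Measure.pi fun _ : σ => lam).restrict W)
        fun s x => ∏ i, monoInt (a i) (b i) (c i) s (x i))
      (isCompact_of_norm_le hB.isClosed (r := 1) zero_le_one fun x hx i => (hB1 x hx i).le)
      hB.isOpen ?_ ?_ ?_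
    · rw [restrict_empty]; exact isZ_zero
    · intro A A' _ hA' hd h h'
      exact IsZ.restrict_union hd hA'.isOpen.measurableSet h h'
    · intro x _ δ hδ _
      rw [ball_pi x hδ, Measure.restrict_pi_pi]
      exact IsZ.pi fun i => isZ_ball lam (x i) hδ (a i) (b i) (c i)
  refine (main.mul_rat hcst).congr fun s => ?_
  refine (ae_restrict_iff' hB.isOpen.measurableSet).2 (Filter.Eventually.of_forall fun x hx => ?_)
  have hn := hBr x hx
  beta_reduce
  rw [norm_div, norm_ev_mono (hB1 x hx) a huf fun i => (hn i).2.1,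
    norm_ev_mono (hB1 x hx) b hug fun i => (hn i).2.2.1, coe_nnnorm,
    norm_ev_mono (hB1 x hx) c huJ fun i => (hn i).2.2.2, mul_div_mul_comm, ← Finset.prod_div_distrib,
    absPow_mul (Finset.prod_nonneg fun i _ => by positivity) (by positivity),
    absPow_prod _ _ (fun i => by positivity)]
  simp only [monoInt, Finset.prod_mul_distrib]
  push_cast
  ring

end Leaf
end PadicZeta

namespace PadicZeta
open MeasureTheory Measure MvPowerSeries
open scoped ENNReal NNReal

section Steps

variable {p : ℕ} [Fact p.Prime] [MeasurableSpace ℚ_[p]] [BorelSpace ℚ_[p]]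
  {σ : Type*} [Fintype σ] [DecidableEq σ] (lam : Measure ℚ_[p]) [lam.IsAddHaarMeasure]

/-- The substitution `y i ↦ A y * y i + C y`. -/
noncomputable def upd (i : σ) (A C : (σ → ℚ_[p]) → ℚ_[p]) (y : σ → ℚ_[p]) : σ → ℚ_[p] :=
  Function.update y i (A y * y i + C y)

theorem measurable_upd (i : σ) {A C : (σ → ℚ_[p]) → ℚ_[p]} (hA : Measurable A)
    (hC : Measurable C) : Measurable (upd i A C) := by
  rw [measurable_pi_iff]
  intro j
  by_cases hj : j = i
  · subst hj; simp only [upd, Function.update_self]; exact (hA.mul (measurable_pi_apply _)).add hC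
  · simpa [upd, hj] using measurable_pi_apply j

theorem continuous_upd (i : σ) {A C : (σ → ℚ_[p]) → ℚ_[p]} (hA : Continuous A)
    (hC : Continuous C) : Continuous (upd i A C) :=
  continuous_id.update i ((hA.mul (continuous_apply i)).add hC)

theorem IsZ.smul_measure {n : ℕ} {Ω : Type*} [MeasurableSpace Ω] {ν : Measure Ω} {F : ℂ → Ω → ℂ}
    (h : IsZ p n ν F) (κ : ℝ≥0) : IsZ p n (κ • ν) F := by
  obtain ⟨R, hR, ε, hε, H⟩ := h
  refine ⟨_, hR.const_mul (κ : ℂ), ε, hε, fun s hs => ⟨(H s hs).1.smul_measure_nnreal, ?_⟩⟩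
  rw [integral_smul_nnreal_measure, (H s hs).2, NNReal.smul_def, Complex.real_smul]

theorem withDensity_eq_map_upd (i : σ) {A C : (σ → ℚ_[p]) → ℚ_[p]} (hA : Measurable A)
    (hC : Measurable C) (hAi : ∀ y t, A (Function.update y i t) = A y)
    (hCi : ∀ y t, C (Function.update y i t) = C y) {B B' : Set (σ → ℚ_[p])}
    (hB : MeasurableSet B) (hB' : MeasurableSet B')
    (hBB' : ∀ y, A y ≠ 0 → (y ∈ B' ↔ upd i A C y ∈ B))
    (hnull : (Measure.pi fun _ : σ => lam) (B ∩ {y | A y = 0}) = 0)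
    {w : (σ → ℚ_[p]) → ℝ≥0∞} (hw : Measurable w) :
    ((Measure.pi fun _ : σ => lam).restrict B).withDensity w =
      (((Measure.pi fun _ : σ => lam).restrict B').withDensity
        fun y => w (upd i A C y) * ‖A y‖ₑ).map (upd i A C) := by
  set V := Measure.pi fun _ : σ => lam
  have hT := measurable_upd i hA hC
  ext E hE
  rw [map_apply hT hE, withDensity_apply _ hE, withDensity_apply _ (hT hE),
    restrict_restrict hE, restrict_restrict (hT hE), ← lintegral_indicator ((hT hE).inter hB'),
    ← lintegral_indicator (hE.inter hB)]
  have h1 : ∀ y, (upd i A C ⁻¹' E ∩ B').indicator (fun y => w (upd i A C y) * ‖A y‖ₑ) y =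
      (E ∩ B).indicator w (upd i A C y) * ‖A y‖ₑ := by
    intro y
    by_cases hy : A y = 0
    · simp [hy, Set.indicator]
    · by_cases h : y ∈ upd i A C ⁻¹' E ∩ B'
      · rw [Set.indicator_of_mem h, Set.indicator_of_mem]
        exact ⟨h.1, (hBB' y hy).1 h.2⟩
      · rw [Set.indicator_of_notMem h, Set.indicator_of_notMem, zero_mul]
        exact fun h' => h ⟨h'.1, (hBB' y hy).2 h'.2⟩
  simp only [h1]
  have := lintegral_comp_update_affine lam i hA hC hAi hCi (hw.indicator (hE.inter hB))
  unfold upd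
  rw [this, lintegral_indicator (hE.inter hB), lintegral_indicator (hE.inter hB),
    restrict_restrict (hE.inter hB)]
  have hae : (E ∩ B ∩ {y | A y ≠ 0} : Set _) =ᵐ[V] (E ∩ B : Set _) := by
    refine (Filter.EventuallyLE.antisymm ?_ ?_)
    · exact Set.inter_subset_left.eventuallyLE
    · rw [ae_le_set]
      refine measure_mono_null ?_ hnull
      rintro y ⟨⟨h, h'⟩, h2⟩
      refine ⟨h', ?_⟩
      by_contra hne
      exact h2 ⟨⟨h, h'⟩, hne⟩
  rw [Measure.restrict_congr_set hae]

theorem isZ_of_upd (i : σ) {A C : (σ → ℚ_[p]) → ℚ_[p]} (hA : Measurable A)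
    (hC : Measurable C) (hAi : ∀ y t, A (Function.update y i t) = A y)
    (hCi : ∀ y t, C (Function.update y i t) = C y) {B B' : Set (σ → ℚ_[p])}
    (hB : MeasurableSet B) (hB' : MeasurableSet B')
    (hBB' : ∀ y, A y ≠ 0 → (y ∈ B' ↔ upd i A C y ∈ B))
    (hnull : (Measure.pi fun _ : σ => lam) (B ∩ {y | A y = 0}) = 0)
    {f g J f' g' J' : MvPowerSeries σ ℤ_[p]} (hf : ∀ y ∈ B', ev f' y = ev f (upd i A C y))
    (hg : ∀ y ∈ B', ev g' y = ev g (upd i A C y)) (κ : ℝ≥0)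
    (hJ : ∀ y ∈ B', ‖ev J (upd i A C y)‖₊ * ‖A y‖₊ = κ * ‖ev J' y‖₊) {n : ℕ}
    (hz : IsZ p n (((Measure.pi fun _ : σ => lam).restrict B').withDensity
      fun x => (‖ev J' x‖₊ : ℝ≥0∞)) fun s x => absPow ‖ev f' x / ev g' x‖ s) :
    IsZ p n (((Measure.pi fun _ : σ => lam).restrict B).withDensity
      fun x => (‖ev J x‖₊ : ℝ≥0∞)) fun s x => absPow ‖ev f x / ev g x‖ s := by
  have hfm : ∀ f : MvPowerSeries σ ℤ_[p], Measurable fun x => (‖ev f x‖₊ : ℝ≥0∞) := fun f =>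
    (continuous_ev f).measurable.enorm
  rw [withDensity_eq_map_upd lam i hA hC hAi hCi hB hB' hBB' hnull (hfm J)]
  refine IsZ.map (measurable_upd i hA hC) (fun s => (measurable_absPow s).comp
    ((continuous_ev f).measurable.div (continuous_ev g).measurable).norm) ?_
  have hd : ((Measure.pi fun _ : σ => lam).restrict B').withDensity
      (fun y => (‖ev J (upd i A C y)‖₊ : ℝ≥0∞) * ‖A y‖ₑ) =
      κ • ((Measure.pi fun _ : σ => lam).restrict B').withDensity
        fun x => (‖ev J' x‖₊ : ℝ≥0∞) := by
    change _ = (κ : ℝ≥0∞) • ((Measure.pi fun _ : σ => lam).restrict B').withDensity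
      fun x => (‖ev J' x‖₊ : ℝ≥0∞)
    rw [← withDensity_smul _ (hfm J')]
    refine withDensity_congr_ae ((ae_restrict_iff' hB').2 (Filter.Eventually.of_forall ?_))
    intro y hy
    change (‖ev J (upd i A C y)‖₊ : ℝ≥0∞) * (‖A y‖₊ : ℝ≥0∞) = (κ : ℝ≥0∞) * (‖ev J' y‖₊ : ℝ≥0∞)
    rw [← ENNReal.coe_mul, hJ y hy, ENNReal.coe_mul]
  rw [hd]
  refine (hz.smul_measure κ).congr fun s => ?_
  have hae : ∀ᵐ y ∂((Measure.pi fun _ : σ => lam).restrict B'), y ∈ B' := ae_restrict_mem hB'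
  have hae2 := (((withDensity_absolutelyContinuous _ (fun x => (‖ev J' x‖₊ : ℝ≥0∞))).smul_left
    (κ : ℝ≥0))).ae_le hae
  filter_upwards [hae2] with y hy
  rw [hf y hy, hg y hy]

end Steps
end PadicZeta

namespace PadicZeta
open MeasureTheory Measure MvPowerSeries
open scoped ENNReal NNReal

section Steps

variable {p : ℕ} [Fact p.Prime] [MeasurableSpace ℚ_[p]] [BorelSpace ℚ_[p]]
  {σ : Type*} [Fintype σ] [DecidableEq σ] (lam : Measure ℚ_[p]) [lam.IsAddHaarMeasure]

theorem ev_update_zero {S : Finset σ} {i : σ} (hi : i ∉ S) {φ : MvPowerSeries σ ℤ_[p]}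
    (hφ : φ ∈ Vars ℤ_[p] S) {y : σ → ℚ_[p]} (hy : ∀ k, ‖y k‖ < 1) :
    ev φ (Function.update y i 0) = ev φ y := by
  have h := ev_sub φ i (τ := 0) (by simp) hy
  rw [sub_eq_self hi hφ] at h
  rw [h]
  congr 2
  simpa using (ev_C (x := y) (0 : ℤ_[p])).symm

theorem ZetaNear.of_shear {S : Finset σ} {i : σ} {φ F : MvPowerSeries σ ℤ_[p]}
    (hφ : φ ∈ Vars ℤ_[p] (S.erase i)) (hφ0 : constantCoeff φ = 0)
    (h : ZetaNear lam (sub i (X i + φ) F)) : ZetaNear lam F := by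
  intro f g J hf hg hJ
  obtain ⟨r, hr0, hr1, H⟩ := h _ _ _ (map_dvd (sub i (X i + φ)) hf) (map_dvd (sub i (X i + φ)) hg)
    (map_dvd (sub i (X i + φ)) hJ)
  refine ⟨r, hr0, hr1, fun B hB hBr => ?_⟩
  set C' : (σ → ℚ_[p]) → ℚ_[p] := fun y => ev φ (Function.update y i 0)
  have hC' : Continuous C' := (continuous_ev φ).comp (continuous_id.update i continuous_const)
  have hT : Continuous (upd i 1 C') := continuous_upd i continuous_one hC'
  have hB' : IsClopen (upd i 1 C' ⁻¹' B) := hB.preimage hT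
  have hn : ∀ y ∈ upd i 1 C' ⁻¹' B, ∀ k, ‖y k‖ ≤ r := by
    intro y hy
    have h1 := hBr _ hy
    have h2 : ∀ k, k ≠ i → ‖y k‖ ≤ r := fun k hk => by simpa [upd, hk] using h1 k
    have h3 : ∀ k, ‖Function.update y i 0 k‖ ≤ r := by
      intro k
      by_cases hk : k = i
      · subst hk; simpa using hr0.le
      · simpa [hk] using h2 k hk
    intro k
    by_cases hk : k = i
    · subst hk
      have h4 := h1 k
      simp only [upd, Function.update_self, Pi.one_apply, one_mul] at h4
      have h5 : ‖C' y‖ ≤ r :=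
        norm_ev_le φ hφ0 (fun k => (h3 k).trans_lt hr1) hr0.le h3
      have h6 := IsUltrametricDist.norm_add_le_max (y k + C' y) (-C' y)
      rw [add_neg_cancel_right, norm_neg] at h6
      exact h6.trans (max_le h4 h5)
    · exact h2 k hk
  have hev : ∀ f : MvPowerSeries σ ℤ_[p], ∀ y ∈ upd i 1 C' ⁻¹' B,
      ev (sub i (X i + φ) f) y = ev f (upd i 1 C' y) := by
    intro f y hy
    have hy1 : ∀ k, ‖y k‖ < 1 := fun k => (hn y hy k).trans_lt hr1
    rw [ev_sub f i (by simp [hφ0]) hy1, upd, ev_add, ev_X hy1, Pi.one_apply, one_mul,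
      ← ev_update_zero (Finset.notMem_erase i S) hφ hy1]
  refine isZ_of_upd lam i (A := 1) (C := C') measurable_one hC'.measurable (fun _ _ => rfl)
    (fun y t => by simp [C']) hB.isOpen.measurableSet hB'.isOpen.measurableSet (fun _ _ => Iff.rfl)
    (by simp) (hev f) (hev g) 1 (fun y hy => ?_) (H _ hB' hn)
  rw [hev J y hy]; simp

theorem ZetaNear.of_scale {i : σ} {c : ℤ_[p]} (hc : c ≠ 0) {F : MvPowerSeries σ ℤ_[p]}
    (h : ZetaNear lam (sub i (C c * X i) F)) : ZetaNear lam F := by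
  intro f g J hf hg hJ
  obtain ⟨r, hr0, hr1, H⟩ := h _ _ _ (map_dvd (sub i (C c * X i)) hf)
    (map_dvd (sub i (C c * X i)) hg) (map_dvd (sub i (C c * X i)) hJ)
  have hc0 : 0 < ‖c‖ := norm_pos_iff.2 hc
  have hc1 : ‖c‖ ≤ 1 := PadicInt.norm_le_one c
  have hc' : (c : ℚ_[p]) ≠ 0 := by simpa using hc
  have hrc : r * ‖c‖ ≤ r := mul_le_of_le_one_right hr0.le hc1
  refine ⟨r * ‖c‖, by positivity, hrc.trans_lt hr1, fun B hB hBr => ?_⟩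
  set A : (σ → ℚ_[p]) → ℚ_[p] := fun _ => c
  have hT : Continuous (upd i A 0) := continuous_upd i continuous_const continuous_zero
  have hB' : IsClopen (upd i A 0 ⁻¹' B) := hB.preimage hT
  have hn : ∀ y ∈ upd i A 0 ⁻¹' B, ∀ k, ‖y k‖ ≤ r := by
    intro y hy k
    have h1 := hBr _ hy k
    by_cases hk : k = i
    · subst hk
      simp only [upd, Function.update_self, Pi.zero_apply, add_zero, A, norm_mul] at h1
      rw [← PadicInt.norm_def, mul_comm] at h1
      exact le_of_mul_le_mul_right h1 hc0
    · simp only [upd, ne_eq, hk, not_false_eq_true, Function.update_of_ne] at h1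
      exact h1.trans hrc
  have hev : ∀ f : MvPowerSeries σ ℤ_[p], ∀ y ∈ upd i A 0 ⁻¹' B,
      ev (sub i (C c * X i) f) y = ev f (upd i A 0 y) := by
    intro f y hy
    have hy1 : ∀ k, ‖y k‖ < 1 := fun k => (hn y hy k).trans_lt hr1
    rw [ev_sub f i (by simp) hy1, upd, ev_mul, ev_X hy1, ev_C, Pi.zero_apply, add_zero]
  refine isZ_of_upd lam i (A := A) (C := 0) measurable_const measurable_zero (fun _ _ => rfl)
    (fun y t => rfl) hB.isOpen.measurableSet hB'.isOpen.measurableSet (fun _ _ => Iff.rfl)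
    (by simp [A, hc]) (hev f) (hev g) ‖c‖₊ (fun y hy => ?_) (H _ hB' hn)
  rw [hev J y hy, mul_comm]; rfl

/-- The part of the neighbourhood of the origin covered by one chart of a blow-up. -/
theorem isZ_blowup_chart {i j : σ} (hij : i ≠ j) {F : MvPowerSeries σ ℤ_[p]}
    (h : ∀ η : ℤ_[p], ZetaNear lam (sub i (X j * (X i + C η)) F * X j))
    {K : Set ℚ_[p]} (hK : IsClopen K) (hK1 : K ⊆ Metric.closedBall 0 1)
    {f g J : MvPowerSeries σ ℤ_[p]} (hf : f ∣ F) (hg : g ∣ F) (hJ : J ∣ F) :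
    ∃ r : ℝ, 0 < r ∧ r < 1 ∧ ∀ B : Set (σ → ℚ_[p]), IsClopen B → (∀ x ∈ B, ∀ i, ‖x i‖ ≤ r) →
      IsZ p (Fintype.card σ)
        (((Measure.pi fun _ : σ => lam).restrict (B ∩ {x | x j ≠ 0 ∧ x i / x j ∈ K})).withDensity
          fun x => (‖ev J x‖₊ : ℝ≥0∞))
        fun s x => absPow ‖ev f x / ev g x‖ s := by
  have hm : ∀ W : Set ℚ_[p], IsClopen W →
      MeasurableSet {x : σ → ℚ_[p] | x j ≠ 0 ∧ x i / x j ∈ W} := by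
    intro W hW
    refine MeasurableSet.inter ?_ ?_
    · exact (measurableSet_eq_fun (measurable_pi_apply j) measurable_const).compl
    · exact ((measurable_pi_apply i).div (measurable_pi_apply j)) hW.isOpen.measurableSet
  refine clopen_induction (K := K) (P := fun W => ∃ r : ℝ, 0 < r ∧ r < 1 ∧
    ∀ B : Set (σ → ℚ_[p]), IsClopen B → (∀ x ∈ B, ∀ i, ‖x i‖ ≤ r) →
      IsZ p (Fintype.card σ)
        (((Measure.pi fun _ : σ => lam).restrict (B ∩ {x | x j ≠ 0 ∧ x i / x j ∈ W})).withDensity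
          fun x => (‖ev J x‖₊ : ℝ≥0∞))
        fun s x => absPow ‖ev f x / ev g x‖ s)
    ((isCompact_closedBall _ _).of_isClosed_subset hK.isClosed hK1) hK ?_ ?_ ?_
  · refine ⟨1 / 2, by norm_num, by norm_num, fun B _ _ => ?_⟩
    simpa using isZ_zero
  · rintro W W' hW hW' hd ⟨r, hr0, hr1, H⟩ ⟨r', hr0', hr1', H'⟩
    refine ⟨min r r', lt_min hr0 hr0', (min_le_left _ _).trans_lt hr1, fun B hB hBr => ?_⟩
    have hu : B ∩ {x : σ → ℚ_[p] | x j ≠ 0 ∧ x i / x j ∈ W ∪ W'} =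
        (B ∩ {x | x j ≠ 0 ∧ x i / x j ∈ W}) ∪ (B ∩ {x | x j ≠ 0 ∧ x i / x j ∈ W'}) := by
      ext x
      simp only [Set.mem_inter_iff, Set.mem_ofPred_eq, Set.mem_union]
      tauto
    have hm1 := hB.isOpen.measurableSet.inter (hm W hW)
    have hm2 := hB.isOpen.measurableSet.inter (hm W' hW')
    rw [hu, ← restrict_withDensity (hm1.union hm2)]
    refine IsZ.restrict_union ?_ hm2 ?_ ?_
    · rw [Set.disjoint_left]
      rintro x ⟨-, -, h1⟩ ⟨-, -, h2⟩
      exact Set.disjoint_left.1 hd h1 h2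
    · rw [restrict_withDensity hm1]
      exact H B hB fun x hx i => (hBr x hx i).trans (min_le_left _ _)
    · rw [restrict_withDensity hm2]
      exact H' B hB fun x hx i => (hBr x hx i).trans (min_le_right _ _)
  · intro z hz
    obtain ⟨η, rfl⟩ : ∃ η : ℤ_[p], (η : ℚ_[p]) = z := ⟨⟨z, by simpa using hK1 hz⟩, rfl⟩
    set τ : MvPowerSeries σ ℤ_[p] := X j * (X i + C η) with hτ
    obtain ⟨r, hr0, hr1, H⟩ := h η _ _ _ ((map_dvd (sub i τ) hf).mul_right (X j))
      ((map_dvd (sub i τ) hg).mul_right (X j)) (mul_dvd_mul_right (map_dvd (sub i τ) hJ) (X j))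
    refine ⟨Metric.closedBall (η : ℚ_[p]) r, IsUltrametricDist.isClopen_closedBall _ hr0.ne',
      Metric.mem_closedBall_self hr0.le, fun W hWU hW => ⟨r, hr0, hr1, fun B hB hBr => ?_⟩⟩
    set A : (σ → ℚ_[p]) → ℚ_[p] := fun y => y j
    set C' : (σ → ℚ_[p]) → ℚ_[p] := fun y => η * y j
    have hA : Continuous A := continuous_apply j
    have hC : Continuous C' := continuous_const.mul hA
    set B' : Set (σ → ℚ_[p]) := upd i A C' ⁻¹' B ∩ (fun y => y i + η) ⁻¹' W
    have hB' : IsClopen B' := (hB.preimage (continuous_upd i hA hC)).inter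
      (hW.preimage ((continuous_apply i).add continuous_const))
    have hn : ∀ y ∈ B', ∀ k, ‖y k‖ ≤ r := by
      rintro y ⟨hy, hyW⟩ k
      by_cases hk : k = i
      · subst hk
        simpa [dist_eq_norm] using hWU hyW
      · simpa [upd, hk] using hBr _ hy k
    have hev : ∀ f : MvPowerSeries σ ℤ_[p], ∀ y ∈ B', ev (sub i τ f) y = ev f (upd i A C' y) := by
      intro f y hy
      have hy1 : ∀ k, ‖y k‖ < 1 := fun k => (hn y hy k).trans_lt hr1
      rw [ev_sub f i (by simp [hτ]) hy1, upd, hτ, ev_mul, ev_add, ev_X hy1, ev_X hy1, ev_C]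
      congr 2
      simp only [A, C']
      ring
    have hj : ∀ y : σ → ℚ_[p], upd i A C' y j = y j := fun y => by simp [upd, hij.symm]
    have hi : ∀ y : σ → ℚ_[p], y j ≠ 0 → upd i A C' y i / y j = y i + η := fun y hy => by
      simp only [upd, Function.update_self, A, C']
      field_simp
    refine isZ_of_upd lam i (A := A) (C := C') (B' := B') hA.measurable hC.measurable
      (fun y t => by simp [A, hij.symm]) (fun y t => by simp [C', hij.symm])
      (hB.isOpen.measurableSet.inter (hm W hW)) hB'.isOpen.measurableSet (fun y hy => ?_)
      ?_ (hev f) (hev g) 1 (fun y hy => ?_) (H _ hB' hn)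
    · have hy' : y j ≠ 0 := hy
      simp only [B', Set.mem_inter_iff, Set.mem_preimage, Set.mem_ofPred_eq, hj, hi y hy']
      tauto
    · convert measure_empty (μ := Measure.pi fun _ : σ => lam)
      ext x
      simp only [A, Set.mem_inter_iff, Set.mem_ofPred_eq, Set.mem_empty_iff_false, iff_false]
      tauto
    · have hy1 : ∀ k, ‖y k‖ < 1 := fun k => (hn y hy k).trans_lt hr1
      rw [ev_mul, hev J y hy, ev_X hy1, one_mul, nnnorm_mul]

theorem ZetaNear.of_blowup {i j : σ} (hij : i ≠ j) {F : MvPowerSeries σ ℤ_[p]}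
    (h1 : ∀ η : ℤ_[p], ZetaNear lam (sub i (X j * (X i + C η)) F * X j))
    (h2 : ∀ η : ℤ_[p], ZetaNear lam (sub j (X i * (X j + C η)) F * X i)) : ZetaNear lam F := by
  intro f g J hf hg hJ
  obtain ⟨r, hr0, hr1, H⟩ := isZ_blowup_chart lam hij h1
    (K := Metric.closedBall 0 1) (IsUltrametricDist.isClopen_closedBall _ one_ne_zero) le_rfl
    hf hg hJ
  obtain ⟨r', hr0', hr1', H'⟩ := isZ_blowup_chart lam hij.symm h2
    (K := Metric.ball 0 1) (IsUltrametricDist.isClopen_ball _ _) Metric.ball_subset_closedBall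
    hf hg hJ
  refine ⟨min r r', lt_min hr0 hr0', (min_le_left _ _).trans_lt hr1, fun B hB hBr => ?_⟩
  have hm : ∀ i j : σ, ∀ W : Set ℚ_[p], MeasurableSet W →
      MeasurableSet (B ∩ {x : σ → ℚ_[p] | x j ≠ 0 ∧ x i / x j ∈ W}) := by
    intro i j W hW
    refine hB.isOpen.measurableSet.inter (MeasurableSet.inter ?_ ?_)
    · exact (measurableSet_eq_fun (measurable_pi_apply j) measurable_const).compl
    · exact ((measurable_pi_apply i).div (measurable_pi_apply j)) hW
  have hm1 := hm i j _ (Metric.isClosed_closedBall (x := (0 : ℚ_[p])) (ε := 1)).measurableSet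
  have hm2 := hm j i _ (Metric.isOpen_ball (x := (0 : ℚ_[p])) (ε := 1)).measurableSet
  have hae : (B : Set (σ → ℚ_[p])) =ᵐ[Measure.pi fun _ : σ => lam]
      ((B ∩ {x | x j ≠ 0 ∧ x i / x j ∈ Metric.closedBall (0 : ℚ_[p]) 1}) ∪
        (B ∩ {x | x i ≠ 0 ∧ x j / x i ∈ Metric.ball (0 : ℚ_[p]) 1}) : Set (σ → ℚ_[p])) := by
    filter_upwards [ae_eval_ne (μ := fun _ : σ => lam) i 0, ae_eval_ne (μ := fun _ : σ => lam) j 0]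
      with x hx hy
    have hx' := norm_pos_iff.2 hx
    have hy' := norm_pos_iff.2 hy
    refine propext ?_
    change x ∈ B ↔ x ∈ (_ ∪ _ : Set (σ → ℚ_[p]))
    simp only [Set.mem_union, Set.mem_inter_iff, Set.mem_ofPred_eq, mem_closedBall_zero_iff,
      mem_ball_zero_iff, norm_div, div_le_one hy', div_lt_one hx']
    have := le_or_gt ‖x i‖ ‖x j‖
    tauto
  rw [Measure.restrict_congr_set hae, ← restrict_withDensity (hm1.union hm2)]
  refine IsZ.restrict_union ?_ hm2 ?_ ?_
  · rw [Set.disjoint_left]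
    rintro x ⟨-, h1, h2⟩ ⟨-, h3, h4⟩
    rw [mem_closedBall_zero_iff, norm_div, div_le_one (norm_pos_iff.2 h1)] at h2
    rw [mem_ball_zero_iff, norm_div, div_lt_one (norm_pos_iff.2 h3)] at h4
    exact absurd h4 h2.not_gt
  · rw [restrict_withDensity hm1]
    exact H B hB fun x hx i => (hBr x hx i).trans (min_le_left _ _)
  · rw [restrict_withDensity hm2]
    exact H' B hB fun x hx i => (hBr x hx i).trans (min_le_right _ _)

theorem Good.zetaNear {S : Finset σ} {F : MvPowerSeries σ ℤ_[p]} (h : Good S F) :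
    ZetaNear lam F := by
  induction h with
  | leaf h => exact h.zetaNear lam
  | blowup i j _ _ hij _ _ ih1 ih2 => exact .of_blowup lam hij ih1 ih2
  | shear i _ φ hφ hφ0 _ ih => exact .of_shear lam hφ hφ0 ih
  | scale i _ c hc _ ih => exact .of_scale lam hc ih

end Steps
end PadicZeta

namespace PadicZeta
open MeasureTheory Measure
open scoped ENNReal NNReal

section Global

variable {p : ℕ} [Fact p.Prime] {σ : Type*} [Fintype σ] [DecidableEq σ]

theorem exists_integral_multiple (f : MvPolynomial σ ℚ_[p]) :
    ∃ c : ℤ_[p], c ≠ 0 ∧ ∃ P : MvPolynomial σ ℤ_[p],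
      MvPolynomial.map (algebraMap ℤ_[p] ℚ_[p]) P =
        MvPolynomial.C (algebraMap ℤ_[p] ℚ_[p] c) * f := by
  induction f using MvPolynomial.induction_on with
  | C a =>
    obtain ⟨x, y, hy, rfl⟩ := IsFractionRing.div_surjective (A := ℤ_[p]) a
    have hy0 : y ≠ 0 := nonZeroDivisors.ne_zero hy
    refine ⟨y, hy0, MvPolynomial.C x, ?_⟩
    have : algebraMap ℤ_[p] ℚ_[p] y ≠ 0 := by
      simpa using hy0
    rw [MvPolynomial.map_C, ← MvPolynomial.C_mul, mul_div_cancel₀ _ this]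
  | add f g hf hg =>
    obtain ⟨c, hc, P, hP⟩ := hf
    obtain ⟨d, hd, Q, hQ⟩ := hg
    refine ⟨c * d, mul_ne_zero hc hd, MvPolynomial.C d * P + MvPolynomial.C c * Q, ?_⟩
    simp only [map_add, map_mul, MvPolynomial.map_C, hP, hQ]
    ring
  | mul_X f i hf =>
    obtain ⟨c, hc, P, hP⟩ := hf
    refine ⟨c, hc, P * MvPolynomial.X i, ?_⟩
    rw [map_mul, hP, MvPolynomial.map_X, mul_assoc]

/-- The translate `f (x + a)`. -/
noncomputable def translate (a : σ → ℚ_[p]) : MvPolynomial σ ℚ_[p] →ₐ[ℚ_[p]] MvPolynomial σ ℚ_[p] :=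
  MvPolynomial.aeval fun i => MvPolynomial.X i + MvPolynomial.C (a i)

theorem eval_translate (a x : σ → ℚ_[p]) (f : MvPolynomial σ ℚ_[p]) :
    MvPolynomial.eval x (translate a f) = MvPolynomial.eval (x + a) f := by
  induction f using MvPolynomial.induction_on with
  | C c => simp [translate]
  | add f g hf hg => rw [map_add, map_add, map_add, hf, hg]
  | mul_X f i hf => rw [map_mul, map_mul, map_mul, hf]; simp [translate]

theorem translate_ne_zero (a : σ → ℚ_[p]) {f : MvPolynomial σ ℚ_[p]} (hf : f ≠ 0) :
    translate a f ≠ 0 := by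
  intro h
  refine hf (MvPolynomial.funext fun x => ?_)
  have := eval_translate a (x - a) f
  rw [h, sub_add_cancel] at this
  rw [← this, map_zero, map_zero]

variable [MeasurableSpace ℚ_[p]] [BorelSpace ℚ_[p]] (lam : Measure ℚ_[p]) [lam.IsAddHaarMeasure]

theorem measurable_zetaIntegrand (f g : MvPolynomial σ ℚ_[p]) (s : ℂ) :
    Measurable fun x => absPow ‖MvPolynomial.eval x f / MvPolynomial.eval x g‖ s :=
  (measurable_absPow s).comp ((MvPolynomial.continuous_eval f).measurable.div
    (MvPolynomial.continuous_eval g).measurable).norm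

theorem isZ_near_point {f g : MvPolynomial σ ℚ_[p]} (hf : f ≠ 0) (hg : g ≠ 0) (a : σ → ℚ_[p]) :
    ∃ U : Set (σ → ℚ_[p]), IsClopen U ∧ a ∈ U ∧ ∀ W ⊆ U, IsClopen W →
      IsZ p (Fintype.card σ) ((Measure.pi fun _ : σ => lam).restrict W)
        fun s x => absPow ‖MvPolynomial.eval x f / MvPolynomial.eval x g‖ s := by
  obtain ⟨c, hc, P, hP⟩ := exists_integral_multiple (translate a f)
  obtain ⟨d, hd, Q, hQ⟩ := exists_integral_multiple (translate a g)
  have hc' : algebraMap ℤ_[p] ℚ_[p] c ≠ 0 := by simpa using hc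
  have hd' : algebraMap ℤ_[p] ℚ_[p] d ≠ 0 := by simpa using hd
  have hne : ∀ {c : ℤ_[p]} {f} {P : MvPolynomial σ ℤ_[p]}, algebraMap ℤ_[p] ℚ_[p] c ≠ 0 → f ≠ 0 →
      MvPolynomial.map (algebraMap ℤ_[p] ℚ_[p]) P =
        MvPolynomial.C (algebraMap ℤ_[p] ℚ_[p] c) * translate a f → P ≠ 0 := by
    rintro c f P hc hf hP rfl
    rw [map_zero] at hP
    exact mul_ne_zero (by simpa using hc) (translate_ne_zero a hf) hP.symm
  have hP0 := hne hc' hf hP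
  have hQ0 := hne hd' hg hQ
  set P' : MvPowerSeries σ ℤ_[p] := ((MvPolynomial.C d * P : MvPolynomial σ ℤ_[p]) :)
  set Q' : MvPowerSeries σ ℤ_[p] := ((MvPolynomial.C c * Q : MvPolynomial σ ℤ_[p]) :)
  have hP'0 : P' ≠ 0 := fun h =>
    mul_ne_zero (by simpa using hd) hP0 (MvPolynomial.coe_eq_zero_iff.1 h)
  have hQ'0 : Q' ≠ 0 := fun h =>
    mul_ne_zero (by simpa using hc) hQ0 (MvPolynomial.coe_eq_zero_iff.1 h)
  have haev : ∀ (P : MvPolynomial σ ℤ_[p]) x, MvPolynomial.aeval x P =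
      MvPolynomial.eval x (MvPolynomial.map (algebraMap ℤ_[p] ℚ_[p]) P) := fun P x => by
    rw [MvPolynomial.eval_map, MvPolynomial.aeval_def]
  have hev : ∀ x : σ → ℚ_[p], (∀ i, ‖x i‖ < 1) → ev P' x / ev Q' x =
      MvPolynomial.eval (x + a) f / MvPolynomial.eval (x + a) g := by
    intro x hx
    rw [ev_coe _ hx, ev_coe _ hx, haev, haev]
    simp only [map_mul, hP, hQ, MvPolynomial.map_C, MvPolynomial.eval_C, eval_translate]
    rw [← mul_assoc, ← mul_assoc, mul_comm (algebraMap ℤ_[p] ℚ_[p] d),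
      mul_div_mul_left _ _ (mul_ne_zero hc' hd')]
  obtain ⟨r, hr0, hr1, H⟩ := (good_of_ne_zero Finset.univ (P' * Q') (mem_Vars_univ _)
    (mul_ne_zero hP'0 hQ'0)).zetaNear lam P' Q' 1 (dvd_mul_right _ _) (dvd_mul_left _ _)
    (one_dvd _)
  have hcl : IsClopen {x : σ → ℚ_[p] | ∀ i, ‖x i - a i‖ ≤ r} := by
    have : {x : σ → ℚ_[p] | ∀ i, ‖x i - a i‖ ≤ r} =
        ⋂ i, (fun x => x i) ⁻¹' Metric.closedBall (a i) r := by
      ext; simp [dist_eq_norm]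
    rw [this]
    exact isClopen_iInter_of_finite fun i =>
      (IsUltrametricDist.isClopen_closedBall _ hr0.ne').preimage (continuous_apply i)
  refine ⟨_, hcl, fun i => by simpa using hr0.le, fun W hWU hW => ?_⟩
  have hB : IsClopen ((fun x => x + a) ⁻¹' W) := hW.preimage (continuous_id.add continuous_const)
  have hBr : ∀ x ∈ (fun x => x + a) ⁻¹' W, ∀ i, ‖x i‖ ≤ r := fun x hx i => by
    simpa using hWU hx i
  have hmp := (measurePreserving_add_right (Measure.pi fun _ : σ => lam) a).restrict_preimage
    hW.isOpen.measurableSet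
  rw [← hmp.map_eq]
  refine IsZ.map hmp.measurable (measurable_zetaIntegrand f g) ?_
  have h := H _ hB hBr
  simp only [ev_one, nnnorm_one, ENNReal.coe_one, withDensity_const, one_smul] at h
  refine h.congr fun s => ?_
  filter_upwards [ae_restrict_mem hB.isOpen.measurableSet] with x hx
  rw [hev x fun i => (hBr x hx i).trans_lt hr1]

theorem isZ_zero_fun {n : ℕ} {Ω : Type*} [MeasurableSpace Ω] {ν : Measure Ω} :
    IsZ p n ν fun _ _ => 0 :=
  ⟨_, IsRat.zero, 1, one_pos, fun _ _ => by simp⟩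

theorem isZ_pi {f g : MvPolynomial σ ℚ_[p]} (hf : f ≠ 0) (hg : g ≠ 0) {Φ : (σ → ℚ_[p]) → ℂ}
    (hΦ : IsLocallyConstant Φ) (hc : HasCompactSupport Φ) :
    IsZ p (Fintype.card σ) (Measure.pi fun _ : σ => lam)
        fun s x => Φ x * absPow ‖MvPolynomial.eval x f / MvPolynomial.eval x g‖ s := by
  have hK : IsClopen (Function.support Φ) := by
    have := (hΦ.isClopen_fiber 0).compl
    convert this using 1
    ext x; simp
  have hK' : IsCompact (Function.support Φ) :=
    hc.isCompact.of_isClosed_subset hK.isClosed subset_closure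
  have main := clopen_induction hK' hK
    (P := fun W => IsZ p (Fintype.card σ) ((Measure.pi fun _ : σ => lam).restrict W)
        fun s x => Φ x * absPow ‖MvPolynomial.eval x f / MvPolynomial.eval x g‖ s)
    (by simpa using isZ_zero) (fun A B _ hB hAB => IsZ.restrict_union hAB hB.isOpen.measurableSet) ?_
  · rw [← Measure.restrict_univ (μ := Measure.pi fun _ : σ => lam),
      ← Set.union_compl_self (Function.support Φ)]
    refine IsZ.restrict_union disjoint_compl_right hK.compl.isOpen.measurableSet main ?_
    refine isZ_zero_fun.congr fun s => ?_
    filter_upwards [ae_restrict_mem hK.compl.isOpen.measurableSet] with x hx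
    rw [Function.notMem_support.1 hx, zero_mul]
  · intro a _
    obtain ⟨U, hU, haU, H⟩ := isZ_near_point lam hf hg a
    refine ⟨U ∩ {x | Φ x = Φ a}, hU.inter (hΦ.isClopen_fiber _), ⟨haU, rfl⟩, fun W hWU hW => ?_⟩
    refine ((H W (hWU.trans Set.inter_subset_left) hW).mul_rat (IsRat.const (Φ a))).congr
      fun s => ?_
    filter_upwards [ae_restrict_mem hW.isOpen.measurableSet] with x hx
    rw [(hWU hx).2]

theorem isZ_haar [MeasurableSpace (σ → ℚ_[p])] [BorelSpace (σ → ℚ_[p])]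
    (μ : Measure (σ → ℚ_[p])) [μ.IsAddHaarMeasure] {f g : MvPolynomial σ ℚ_[p]} (hf : f ≠ 0)
    (hg : g ≠ 0) {Φ : (σ → ℚ_[p]) → ℂ} (hΦ : IsLocallyConstant Φ) (hc : HasCompactSupport Φ) :
    IsZ p (Fintype.card σ) μ
      fun s x => Φ x * absPow ‖MvPolynomial.eval x f / MvPolynomial.eval x g‖ s := by
  rename_i m hm _
  obtain rfl : m = MeasurableSpace.pi := by
    rw [hm.measurable_eq]; exact (Pi.borelSpace (X := fun _ : σ => ℚ_[p])).measurable_eq.symm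
  rw [isAddLeftInvariant_eq_smul μ (Measure.pi fun _ : σ => (addHaar : Measure ℚ_[p]))]
  exact (isZ_pi addHaar hf hg hΦ hc).smul_measure _

end Global
end PadicZeta

namespace PadicZeta
open Topology

section Laurent

variable {p : ℕ} [Fact p.Prime]

/-- Functions of `s` given by a Laurent polynomial in `p ^ (-s)`. -/
def IsLaur (p : ℕ) (H : ℂ → ℂ) : Prop :=
  ∃ (Q : Polynomial ℂ) (d : ℕ), ∀ s, H s = Q.eval ((p : ℂ) ^ (-s)) / ((p : ℂ) ^ (-s)) ^ d

theorem natCast_prime_ne_zero : (p : ℂ) ≠ 0 := by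
  exact_mod_cast (Fact.out : p.Prime).ne_zero

theorem cpow_prime_ne_zero (s : ℂ) : (p : ℂ) ^ s ≠ 0 := by
  rw [Ne, Complex.cpow_eq_zero_iff, not_and_or]
  exact Or.inl natCast_prime_ne_zero

variable {H H' : ℂ → ℂ}

theorem IsLaur.const (c : ℂ) : IsLaur p fun _ => c := ⟨.C c, 0, by simp⟩

theorem IsLaur.add (h : IsLaur p H) (h' : IsLaur p H') : IsLaur p fun s => H s + H' s := by
  obtain ⟨Q, d, h⟩ := h
  obtain ⟨Q', d', h'⟩ := h'
  refine ⟨Q * .X ^ d' + Q' * .X ^ d, d + d', fun s => ?_⟩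
  have := cpow_prime_ne_zero (p := p) (-s)
  beta_reduce
  rw [h, h']
  simp only [Polynomial.eval_add, Polynomial.eval_mul, Polynomial.eval_pow, Polynomial.eval_X]
  field_simp
  ring

theorem IsLaur.mul (h : IsLaur p H) (h' : IsLaur p H') : IsLaur p fun s => H s * H' s := by
  obtain ⟨Q, d, h⟩ := h
  obtain ⟨Q', d', h'⟩ := h'
  refine ⟨Q * Q', d + d', fun s => ?_⟩
  beta_reduce
  rw [h, h', Polynomial.eval_mul, pow_add, div_mul_div_comm]

theorem IsLaur.cpow (m : ℤ) : IsLaur p fun s => (p : ℂ) ^ ((m : ℂ) * s) := by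
  obtain ⟨k, rfl | rfl⟩ := m.eq_nat_or_neg
  · refine ⟨1, k, fun s => ?_⟩
    rw [Polynomial.eval_one, ← Complex.cpow_nat_mul, one_div, ← Complex.cpow_neg]
    simp
  · refine ⟨.X ^ k, 0, fun s => ?_⟩
    rw [Polynomial.eval_pow, Polynomial.eval_X, ← Complex.cpow_nat_mul]
    simp

theorem isLaur_fac (q : ℤ × ℕ) : IsLaur p (fac p q) := by
  have := (IsLaur.const (p := p) 1).add
    ((IsLaur.const (-(p : ℂ) ^ (-(q.2 : ℂ)))).mul (IsLaur.cpow (-q.1)))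
  convert this using 2 with s
  rw [fac, sub_eq_add_neg, sub_eq_add_neg (-(q.2 : ℂ)),
    Complex.cpow_add _ _ natCast_prime_ne_zero]
  push_cast
  ring_nf

theorem isLaur_prod_fac (L : List (ℤ × ℕ)) : IsLaur p fun s => (L.map fun q => fac p q s).prod := by
  induction L with
  | nil => simpa using IsLaur.const 1
  | cons q L ih => simpa using (isLaur_fac q).mul ih

theorem log_prime_pos : 0 < Real.log p :=
  Real.log_pos (by exact_mod_cast (Fact.out : p.Prime).one_lt)

theorem fac_eq (q : ℤ × ℕ) (s : ℂ) :
    fac p q s = 1 - Complex.exp ((Real.log p : ℂ) * (-(q.2 : ℂ) - (q.1 : ℂ) * s)) := by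
  rw [fac, Complex.cpow_def_of_ne_zero natCast_prime_ne_zero, Complex.natCast_log]

theorem fac_eq_zero {q : ℤ × ℕ} (hq : q.1 ≠ 0) {s : ℂ} (h : fac p q s = 0) :
    ∃ m : ℤ, s = -(q.2 : ℂ) / (q.1 : ℂ) +
      (2 * Real.pi * Complex.I * (m : ℂ)) / ((q.1 : ℂ) * Real.log p) := by
  rw [fac_eq, sub_eq_zero, eq_comm, Complex.exp_eq_one_iff] at h
  obtain ⟨m, hm⟩ := h
  have h1 : (q.1 : ℂ) ≠ 0 := by exact_mod_cast hq
  have h2 : (Real.log p : ℂ) ≠ 0 := by exact_mod_cast (log_prime_pos (p := p)).ne'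
  refine ⟨-m, ?_⟩
  rw [Int.cast_neg]
  generalize (Real.log p : ℂ) = l at *
  field_simp
  linear_combination -hm

theorem fac_ne_zero_of_re {q : ℤ × ℕ} {s : ℂ} (h : |(q.1 : ℝ)| * |s.re| < q.2) :
    fac p q s ≠ 0 := by
  intro h0
  rw [fac, sub_eq_zero] at h0
  have h1 := congrArg norm h0
  have hp1 : (1 : ℝ) < p := by exact_mod_cast (Fact.out : p.Prime).one_lt
  rw [norm_one, ← Complex.ofReal_natCast, Complex.norm_cpow_eq_rpow_re_of_pos (by linarith)] at h1
  refine (Real.rpow_lt_one_of_one_lt_of_neg hp1 ?_).ne' h1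
  have h2 : (-(q.2 : ℂ) - (q.1 : ℂ) * s).re = -(q.2 : ℝ) - q.1 * s.re := by simp
  rw [h2]
  rw [← abs_mul] at h
  linarith [neg_abs_le ((q.1 : ℝ) * s.re)]

theorem exists_strip (L : List (ℤ × ℕ)) (hL : ∀ q ∈ L, q.1 ≠ 0 ∧ 0 < q.2) :
    ∃ ε > 0, ∀ s : ℂ, |s.re| < ε → ∀ q ∈ L, fac p q s ≠ 0 := by
  induction L with
  | nil => exact ⟨1, one_pos, by simp⟩
  | cons q L ih =>
    obtain ⟨ε, hε, H⟩ := ih fun q hq => hL q (List.mem_cons_of_mem _ hq)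
    obtain ⟨h1, h2⟩ := hL q List.mem_cons_self
    have h1' : 0 < |(q.1 : ℝ)| := by simpa using h1
    have h2' : (0 : ℝ) < q.2 := by exact_mod_cast h2
    refine ⟨min ε (q.2 / |(q.1 : ℝ)|), lt_min hε (by positivity), fun s hs q' hq' => ?_⟩
    rcases List.mem_cons.1 hq' with rfl | hq'
    · exact fac_ne_zero_of_re ((lt_div_iff₀' h1').1 (hs.trans_le (min_le_right _ _)))
    · exact H s (hs.trans_le (min_le_left _ _)) q' hq'

theorem analyticAt_fac (q : ℤ × ℕ) (s : ℂ) : AnalyticAt ℂ (fac p q) s := by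
  have : fac p q = fun s => 1 - Complex.exp ((Real.log p : ℂ) * (-(q.2 : ℂ) - (q.1 : ℂ) * s)) :=
    funext (fac_eq q)
  rw [this]
  fun_prop

theorem analyticAt_cpow_mul (m : ℂ) (s : ℂ) : AnalyticAt ℂ (fun s => (p : ℂ) ^ (m * s)) s := by
  simp only [Complex.cpow_def_of_ne_zero (natCast_prime_ne_zero (p := p))]
  fun_prop

theorem exists_analyticAt_inv_fac {q : ℤ × ℕ} (hq : q.1 ≠ 0) (s₀ : ℂ) :
    ∃ G : ℂ → ℂ, AnalyticAt ℂ G s₀ ∧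
      ∀ᶠ s in 𝓝[≠] s₀, (fac p q s)⁻¹ = G s / (s - s₀) := by
  by_cases h0 : fac p q s₀ = 0
  · have hd : HasDerivAt (fac p q) ((Real.log p : ℂ) * q.1) s₀ := by
      have h1 : HasDerivAt (fun s : ℂ => (Real.log p : ℂ) * (-(q.2 : ℂ) - (q.1 : ℂ) * s))
          ((Real.log p : ℂ) * -(q.1 * 1)) s₀ :=
        (((hasDerivAt_id s₀).const_mul (q.1 : ℂ)).const_sub _).const_mul _
      have h2 := (h1.cexp).const_sub 1
      have h3 : fac p q = fun s =>
        1 - Complex.exp ((Real.log p : ℂ) * (-(q.2 : ℂ) - (q.1 : ℂ) * s)) := funext (fac_eq q)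
      rw [fac_eq, sub_eq_zero] at h0
      rw [← h0] at h2
      rw [h3]
      exact h2.congr_deriv (by ring)
    have hd0 : deriv (fac p q) s₀ ≠ 0 := by
      rw [hd.deriv]
      exact mul_ne_zero (by exact_mod_cast (log_prime_pos (p := p)).ne') (by exact_mod_cast hq)
    have ho := (analyticAt_fac (p := p) q s₀).analyticOrderAt_sub_eq_one_of_deriv_ne_zero hd0
    simp only [h0, sub_zero] at ho
    obtain ⟨g, hg, hg0, hgE⟩ := ((analyticAt_fac q s₀).analyticOrderAt_eq_natCast (n := 1)).1 ho
    refine ⟨fun s => (g s)⁻¹, hg.inv hg0, ?_⟩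
    filter_upwards [hgE.filter_mono nhdsWithin_le_nhds] with s hs
    rw [hs, pow_one, smul_eq_mul, mul_inv, mul_comm, div_eq_mul_inv]
  · refine ⟨fun s => (s - s₀) * (fac p q s)⁻¹,
      (analyticAt_id.sub analyticAt_const).mul ((analyticAt_fac q s₀).inv h0), ?_⟩
    filter_upwards [self_mem_nhdsWithin] with s hs
    rw [mul_div_cancel_left₀ _ (sub_ne_zero.2 hs)]

theorem exists_analyticAt_prod_inv_fac (L : List (ℤ × ℕ)) (hL : ∀ q ∈ L, q.1 ≠ 0 ∧ 0 < q.2)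
    (s₀ : ℂ) : ∃ G : ℂ → ℂ, AnalyticAt ℂ G s₀ ∧
      ∀ᶠ s in 𝓝[≠] s₀, (L.map fun q => (fac p q s)⁻¹).prod = G s / (s - s₀) ^ L.length := by
  induction L with
  | nil => exact ⟨fun _ => 1, analyticAt_const, by simp⟩
  | cons q L ih =>
    obtain ⟨G, hG, h⟩ := ih fun q hq => hL q (List.mem_cons_of_mem _ hq)
    obtain ⟨G', hG', h'⟩ := exists_analyticAt_inv_fac (p := p) (hL q List.mem_cons_self).1 s₀
    refine ⟨fun s => G' s * G s, hG'.mul hG, ?_⟩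
    filter_upwards [h, h'] with s hs hs'
    rw [List.map_cons, List.prod_cons, hs, hs', List.length_cons, pow_succ', div_mul_div_comm]

theorem analyticAt_prod_inv_fac (L : List (ℤ × ℕ)) {s₀ : ℂ} (hL : ∀ q ∈ L, fac p q s₀ ≠ 0) :
    AnalyticAt ℂ (fun s => (L.map fun q => (fac p q s)⁻¹).prod) s₀ := by
  induction L with
  | nil => simpa using analyticAt_const
  | cons q L ih =>
    simp only [List.map_cons, List.prod_cons]
    exact ((analyticAt_fac q s₀).inv (hL q List.mem_cons_self)).mul
      (ih fun q hq => hL q (List.mem_cons_of_mem _ hq))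

theorem prod_inv_mul_prod_fac (L : List (ℤ × ℕ)) {s : ℂ} (hL : ∀ q ∈ L, fac p q s ≠ 0) :
    (L.map fun q => (fac p q s)⁻¹).prod * (L.map fun q => fac p q s).prod = 1 := by
  induction L with
  | nil => simp
  | cons q L ih =>
    have h1 := hL q List.mem_cons_self
    have h2 := ih fun q hq => hL q (List.mem_cons_of_mem _ hq)
    simp only [List.map_cons, List.prod_cons]
    rw [mul_mul_mul_comm, h2, inv_mul_cancel₀ h1, one_mul]

theorem IsRat.exists_factors {n : ℕ} {R : ℂ → ℂ} (h : IsRat p n R) :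
    ∃ L : List (ℤ × ℕ), (∀ q ∈ L, q.1 ≠ 0 ∧ 0 < q.2) ∧
      (∃ H, IsLaur p H ∧ ∀ s, (∀ q ∈ L, fac p q s ≠ 0) →
        R s * (L.map fun q => fac p q s).prod = H s) ∧
      (∀ s₀, (∀ q ∈ L, fac p q s₀ ≠ 0) → AnalyticAt ℂ R s₀) ∧
      ∀ s₀, ∃ G : ℂ → ℂ, AnalyticAt ℂ G s₀ ∧ ∀ᶠ s in 𝓝[≠] s₀, R s = G s / (s - s₀) ^ n := by
  induction h with
  | zero =>
    exact ⟨[], by simp, ⟨_, IsLaur.const 0, by simp⟩, fun _ _ => analyticAt_const,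
      fun s₀ => ⟨fun _ => 0, analyticAt_const, by simp⟩⟩
  | @add R R' _ _ ih ih' =>
    obtain ⟨L, hL, ⟨H, hH, hE⟩, hA, hP⟩ := ih
    obtain ⟨L', hL', ⟨H', hH', hE'⟩, hA', hP'⟩ := ih'
    refine ⟨L ++ L', fun q hq => (List.mem_append.1 hq).elim (hL q) (hL' q),
      ⟨_, (hH.mul (isLaur_prod_fac L')).add (hH'.mul (isLaur_prod_fac L)), fun s hs => ?_⟩,
      fun s₀ hs => ?_, fun s₀ => ?_⟩
    · have h1 := hE s fun q hq => hs q (List.mem_append_left _ hq)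
      have h2 := hE' s fun q hq => hs q (List.mem_append_right _ hq)
      rw [List.map_append, List.prod_append, ← h1, ← h2]
      ring
    · exact (hA s₀ fun q hq => hs q (List.mem_append_left _ hq)).add
        (hA' s₀ fun q hq => hs q (List.mem_append_right _ hq))
    · obtain ⟨G, hG, h⟩ := hP s₀
      obtain ⟨G', hG', h'⟩ := hP' s₀
      refine ⟨fun s => G s + G' s, hG.add hG', ?_⟩
      filter_upwards [h, h'] with s hs hs'
      rw [hs, hs', add_div]
  | term c m L hn hL =>
    have ha : ∀ s, AnalyticAt ℂ (fun s => c * (p : ℂ) ^ ((m : ℂ) * s)) s := fun s =>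
      analyticAt_const.mul (analyticAt_cpow_mul _ s)
    refine ⟨L, hL, ⟨_, (IsLaur.const c).mul (IsLaur.cpow m), fun s hs => ?_⟩,
      fun s₀ hs => (ha s₀).mul (analyticAt_prod_inv_fac L hs), fun s₀ => ?_⟩
    · rw [mul_assoc, prod_inv_mul_prod_fac L hs, mul_one]
    · obtain ⟨G, hG, h⟩ := exists_analyticAt_prod_inv_fac (p := p) L hL s₀
      refine ⟨fun s => c * (p : ℂ) ^ ((m : ℂ) * s) * G s * (s - s₀) ^ (n - L.length),
        ((ha s₀).mul hG).mul ((analyticAt_id.sub analyticAt_const).pow _), ?_⟩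
      filter_upwards [h, self_mem_nhdsWithin] with s hs hs'
      have h1 : s - s₀ ≠ 0 := sub_ne_zero.2 hs'
      rw [hs, ← Nat.add_sub_cancel' hn, pow_add, Nat.add_sub_cancel_left]
      field_simp

end Laurent
end PadicZeta

open MeasureTheory Complex MvPolynomial

/-- Meromorphic continuation and rationality of the `p`-adic local zeta function of a
meromorphic (rational) function `f/g`. -/
theorem padic_zeta_function_meromorphic_continuation
    (p : ℕ) [Fact p.Prime] (n : ℕ)
    [MeasurableSpace (Fin n → ℚ_[p])] [BorelSpace (Fin n → ℚ_[p])]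
    (μ : Measure (Fin n → ℚ_[p])) [μ.IsAddHaarMeasure]
    (hμ : μ (Set.univ.pi fun _ : Fin n => {x : ℚ_[p] | ‖x‖ ≤ 1}) = 1)
    (f g : MvPolynomial (Fin n) ℚ_[p]) (hf : f ≠ 0) (hg : g ≠ 0)
    (hfg : ∀ c : ℚ_[p], f ≠ c • g)
    (Φ : (Fin n → ℚ_[p]) → ℂ) (hΦlc : IsLocallyConstant Φ) (hΦc : HasCompactSupport Φ)
    (D : Set (Fin n → ℚ_[p]))
    (hD : D = {x | eval x f = 0 ∨ eval x g = 0})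
    (Z : ℂ → ℂ)
    (hZ : ∀ s : ℂ, Z s =
      ∫ x in Dᶜ, Φ x * (‖eval x f / eval x g‖ : ℂ) ^ s ∂μ) :
    ∃ (α β : ℝ), β < 0 ∧ 0 < α ∧
      -- (1) integrability on the strip β < Re(s) < α
      (∀ s : ℂ, β < s.re → s.re < α →
        IntegrableOn (fun x => Φ x * (‖eval x f / eval x g‖ : ℂ) ^ s) Dᶜ μ) ∧
      -- (2) rationality: a finite family of data (Nᵢ, vᵢ) and a Laurent polynomial
      ∃ (k : ℕ) (N : Fin k → ℤ) (v : Fin k → ℕ),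
        (∀ i, N i ≠ 0) ∧ (∀ i, 0 < v i) ∧
        ∃ (Q : Polynomial ℂ) (d : ℕ),
          (∀ s : ℂ, β < s.re → s.re < α →
            Z s * ∏ i, (1 - (p : ℂ) ^ (-(v i : ℂ) - (N i : ℂ) * s)) =
              Q.eval ((p : ℂ) ^ (-s)) / ((p : ℂ) ^ (-s)) ^ d) ∧
          -- in particular: a meromorphic extension, analytic away from the candidate
          -- poles, all poles of order at most n
          ∃ F : ℂ → ℂ,
            (∀ s : ℂ, β < s.re → s.re < α → F s = Z s) ∧
            (∀ s₀ : ℂ,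
              (¬ ∃ (i : Fin k) (m : ℤ), s₀ = -(v i : ℂ) / (N i : ℂ) +
                  (2 * Real.pi * Complex.I * (m : ℂ)) / ((N i : ℂ) * Real.log p)) →
              AnalyticAt ℂ F s₀) ∧
            (∀ s₀ : ℂ, ∃ G : ℂ → ℂ, AnalyticAt ℂ G s₀ ∧
              ∀ᶠ s in nhdsWithin s₀ {s₀}ᶜ, F s = G s / (s - s₀) ^ n) := by
  let _ : MeasurableSpace ℚ_[p] := borel _
  have : BorelSpace ℚ_[p] := ⟨rfl⟩
  obtain ⟨R, hR, ε, hε, H⟩ := PadicZeta.isZ_haar μ hf hg hΦlc hΦc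
  rw [Fintype.card_fin] at hR
  obtain ⟨L, hL, ⟨E, ⟨Q, d, hE⟩, hRE⟩, hA, hP⟩ := hR.exists_factors
  obtain ⟨δ, hδ, hs⟩ := PadicZeta.exists_strip (p := p) L hL
  have hDc : MeasurableSet Dᶜ := by
    rw [hD]
    exact ((isClosed_eq (MvPolynomial.continuous_eval f) continuous_const).union
      (isClosed_eq (MvPolynomial.continuous_eval g) continuous_const)).measurableSet.compl
  have hre : ∀ s : ℂ, -min ε δ < s.re → s.re < min ε δ → |s.re| < ε ∧ |s.re| < δ :=
    fun s h h' => lt_min_iff.1 (abs_lt.2 ⟨h, h'⟩)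
  have hon : ∀ s : ℂ, Set.EqOn
      (fun x => Φ x * PadicZeta.absPow ‖eval x f / eval x g‖ s)
      (fun x => Φ x * (‖eval x f / eval x g‖ : ℂ) ^ s) Dᶜ := by
    intro s x hx
    rw [hD, Set.mem_compl_iff, Set.mem_ofPred_eq, not_or] at hx
    have : ‖eval x f / eval x g‖ ≠ 0 := norm_ne_zero_iff.2 (div_ne_zero hx.1 hx.2)
    simp only [PadicZeta.absPow, if_neg this]
  have hZR : ∀ s : ℂ, |s.re| < ε → Z s = R s := by
    intro s h
    rw [hZ, ← (H s h).2, ← setIntegral_congr_fun hDc (hon s)]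
    refine setIntegral_eq_integral_of_forall_compl_eq_zero fun x hx => ?_
    rw [Set.notMem_compl_iff, hD] at hx
    have : ‖eval x f / eval x g‖ = 0 := by
      rcases hx with hx | hx <;> simp [hx]
    simp only [PadicZeta.absPow, if_pos this, mul_zero]
  have hprod : ∀ s : ℂ, ∏ i : Fin L.length,
      (1 - (p : ℂ) ^ (-((L[i.1].2 : ℕ) : ℂ) - ((L[i.1].1 : ℤ) : ℂ) * s)) =
        (L.map fun q => PadicZeta.fac p q s).prod :=
    fun s => Fin.prod_univ_fun_getElem L fun q => PadicZeta.fac p q s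
  refine ⟨min ε δ, -min ε δ, neg_lt_zero.2 (lt_min hε hδ), lt_min hε hδ, fun s h h' => ?_,
    L.length, fun i => L[i.1].1, fun i => L[i.1].2, fun i => (hL _ (List.getElem_mem _)).1,
    fun i => (hL _ (List.getElem_mem _)).2, Q, d, fun s h h' => ?_, R,
    fun s h h' => (hZR s (hre s h h').1).symm, fun s₀ hs₀ => hA s₀ fun q hq h0 => hs₀ ?_, hP⟩
  · exact ((H s (hre s h h').1).1.integrableOn).congr_fun (hon s) hDc
  · rw [hprod, hZR s (hre s h h').1, hRE s (hs s (hre s h h').2), hE]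
  · obtain ⟨i, hi, rfl⟩ := List.mem_iff_getElem.1 hq
    obtain ⟨m, hm⟩ := PadicZeta.fac_eq_zero (hL _ hq).1 h0
    exact ⟨⟨i, hi⟩, m, hm⟩
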